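/- arXiv:2102.01967 — 7 statements merged into one kernel-verified Lean document; each statement's English description precedes it below -/
import Mathlib

section
/- Let p be an odd rational prime, r a positive integer, and m ≠ 1 a squarefree rational integer not divisible by p, such that F(x) = x^(p^r) − m is irreducible over ℚ. Let α be a complex root of F and K = ℚ(α). If ν_p(m^(p−1) − 1) > p and r ≥ p, then K is not monogenic. -/
open Polynomial NumberField

lemma exists_injective_primes {R ι : Type*} [CommRing R] (a : R) (D : ι → R)
    (hD : ∀ i j, i ≠ j → a ∣ D i * D j) (hnil : ∀ i n, ¬ a ∣ D i ^ n) :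
    ∃ Q : ι → Ideal R, Function.Injective Q ∧ (∀ i, (Q i).IsPrime) ∧ ∀ i, a ∈ Q i := by
  have h : ∀ i, ∃ Q : Ideal R, Q.IsPrime ∧ a ∈ Q ∧ D i ∉ Q := by
    intro i
    have h1 : D i ∉ (Ideal.span {a}).radical := by
      rintro ⟨n, hn⟩
      exact hnil i n (Ideal.mem_span_singleton.1 hn)
    rw [Ideal.radical_eq_sInf, Ideal.mem_sInf] at h1
    push Not at h1
    obtain ⟨Q, ⟨hQ, hQ'⟩, hD⟩ := h1
    exact ⟨Q, hQ', hQ (Ideal.mem_span_singleton_self a), hD⟩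
  choose Q hQ haQ hDQ using h
  refine ⟨Q, fun i j hij ↦ ?_, hQ, haQ⟩
  by_contra hne
  rcases (hQ i).mem_or_mem ((Q i).mem_of_dvd (hD i j hne) (haQ i)) with h | h
  · exact hDQ i h
  · exact hDQ j (hij ▸ h)

lemma dvd_chain_sub_mul_sub {R : Type*} [CommRing R] {a : R} {e : ℕ} {E : ℕ → R}
    (hE : ∀ k l, l ≤ k → k ≤ e → a ∣ E k * E l - E l) {i j : ℕ} (hi : i < e) (hj : j < e)
    (hij : i ≠ j) : a ∣ (E (i + 1) - E i) * (E (j + 1) - E j) := by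
  wlog h : i < j generalizing i j
  · rw [mul_comm]
    exact this hj hi hij.symm (by omega)
  have h1 := hE (j + 1) (i + 1) (by omega) (by omega)
  have h2 := hE (j + 1) i (by omega) (by omega)
  have h3 := hE j (i + 1) (by omega) (by omega)
  have h4 := hE j i (by omega) (by omega)
  convert dvd_sub (dvd_sub h1 h2) (dvd_sub h3 h4) using 1
  ring

lemma dvd_chain_sub_sq {R : Type*} [CommRing R] {a : R} {e : ℕ} {E : ℕ → R}
    (hE : ∀ k l, l ≤ k → k ≤ e → a ∣ E k * E l - E l) {i : ℕ} (hi : i < e) :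
    a ∣ (E (i + 1) - E i) ^ 2 - (E (i + 1) - E i) := by
  have h1 := hE (i + 1) (i + 1) (by omega) (by omega)
  have h2 := hE (i + 1) i (by omega) (by omega)
  have h4 := hE i i (by omega) (by omega)
  convert dvd_add (dvd_sub h1 (h2.mul_left 2)) h4 using 1
  ring

lemma pow_dvd_of_dvd_pow {R : Type*} [CommRing R] {a D : R} {t n : ℕ}
    (hD : a ^ t ∣ D ^ 2 - D) (h : a ∣ D ^ n) : a ^ t ∣ D := by
  have h1 : ∀ k, a ^ t ∣ D ^ (k + 1) - D := by
    intro k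
    induction k with
    | zero => simp
    | succ k ih =>
      convert dvd_add (ih.mul_left D) hD using 1
      ring
  have h2 : a ^ t ∣ D ^ (n * t + 1) := by
    rw [pow_succ, pow_mul]
    exact (pow_dvd_pow_of_dvd h t).mul_right D
  simpa using dvd_sub h2 (h1 (n * t))

lemma exists_mul_eq_of_sq_sub {K : Type*} [Field K] [NumberField K] {n : ℕ} (hn : n ≠ 0)
    {S : 𝓞 K} (h : (n : 𝓞 K) ^ 2 ∣ S * S - n * S) : ∃ E : 𝓞 K, n * E = S := by
  obtain ⟨w, hw⟩ := h
  have hw' : (S : K) * S - n * S = n ^ 2 * w := by exact_mod_cast congrArg (algebraMap (𝓞 K) K) hw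
  have hn' : (n : K) ≠ 0 := Nat.cast_ne_zero.2 hn
  have hint : IsIntegral (𝓞 K) ((S : K) / n) := by
    refine ⟨X ^ 2 - X - C w, ?_, ?_⟩
    · monicity!
    · simp only [eval₂_sub, eval₂_X_pow, eval₂_X, eval₂_C]
      field_simp
      linear_combination hw'
  obtain ⟨E, hE⟩ := IsIntegrallyClosed.isIntegral_iff.1 hint
  refine ⟨E, ?_⟩
  apply RingOfIntegers.coe_injective
  rw [map_mul, map_natCast, hE]
  field_simp

lemma exists_chain_of_pow_eq {K : Type*} [Field K] [NumberField K] {p e t : ℕ} (hp : 0 < p)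
    {x z : 𝓞 K} (hx : x ^ p ^ e = 1 + p ^ (2 * e + t) * z) :
    ∃ E : ℕ → 𝓞 K,
      (∀ k ≤ e, p ^ (e - k) * E k = ∑ j ∈ Finset.range (p ^ (e - k)), x ^ (p ^ k * j)) ∧
      ∀ k l, l ≤ k → k ≤ e → (p : 𝓞 K) ^ t ∣ E k * E l - E l := by
  set S : ℕ → 𝓞 K := fun k ↦ ∑ j ∈ Finset.range (p ^ (e - k)), x ^ (p ^ k * j) with hS
  have hS1 : ∀ l ≤ e, (x ^ p ^ l - 1) * S l = p ^ (2 * e + t) * z := by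
    intro l hl
    simp only [hS, pow_mul]
    rw [mul_geom_sum, ← pow_mul, ← pow_add, Nat.add_sub_cancel' hl, hx]
    ring
  have hS2 : ∀ k l, l ≤ k → k ≤ e →
      (p : 𝓞 K) ^ (2 * e + t) ∣ S k * S l - p ^ (e - k) * S l := by
    intro k l hlk hke
    have h : S k * S l - p ^ (e - k) * S l =
        ∑ j ∈ Finset.range (p ^ (e - k)), (x ^ (p ^ k * j) - 1) * S l := by
      rw [← Finset.sum_mul, Finset.sum_sub_distrib]
      simp [hS, sub_mul]
    rw [h]
    refine Finset.dvd_sum fun j _ ↦ ?_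
    have h1 : x ^ p ^ l - 1 ∣ x ^ (p ^ k * j) - 1 := by
      obtain ⟨d, hd⟩ := pow_dvd_pow p hlk
      rw [hd, mul_assoc, pow_mul x]
      exact sub_one_dvd_pow_sub_one _ _
    exact (Dvd.intro _ (hS1 l (hlk.trans hke)).symm).trans (mul_dvd_mul_right h1 _)
  have hex : ∀ k, ∃ E : 𝓞 K, k ≤ e → p ^ (e - k) * E = S k := by
    intro k
    by_cases hk : k ≤ e
    · obtain ⟨E, hE⟩ := exists_mul_eq_of_sq_sub (n := p ^ (e - k)) (S := S k) (by positivity) (by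
        push_cast
        refine dvd_trans ?_ (hS2 k k le_rfl hk)
        rw [← pow_mul]
        exact pow_dvd_pow _ (by omega))
      exact ⟨E, fun _ ↦ by exact_mod_cast hE⟩
    · exact ⟨0, fun h ↦ absurd h hk⟩
  choose E hE using hex
  refine ⟨E, hE, fun k l hlk hke ↦ ?_⟩
  have h := hS2 k l hlk hke
  rw [← hE k hke, ← hE l (hlk.trans hke)] at h
  have hp0 : (p : 𝓞 K) ^ (e - k + (e - l)) ≠ 0 := by
    exact_mod_cast (pow_pos hp _).ne'
  rw [← mul_dvd_mul_iff_left hp0, ← pow_add]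
  refine dvd_trans (pow_dvd_pow _ (by omega)) (h.trans (dvd_of_eq ?_))
  ring

lemma trace_root_pow_eq_zero {F K : Type*} [Field F] [Field K] [Algebra F K] {n : ℕ} {a : F}
    (hirr : Irreducible (X ^ n - C a)) {α : K} (hgen : IntermediateField.adjoin F {α} = ⊤)
    (hα : α ^ n = algebraMap F K a) {i : ℕ} (hi0 : 0 < i) (hi : i < n) :
    Algebra.trace F K (α ^ i) = 0 := by
  have hn : n ≠ 0 := by omega
  have hmin : X ^ n - C a = minpoly F α :=
    minpoly.eq_of_irreducible_of_monic hirr (by simp [hα]) (monic_X_pow_sub_C a hn)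
  have hint : IsIntegral F α := ⟨_, monic_X_pow_sub_C a hn, by simp [hα]⟩
  let pb : PowerBasis F K := ((IntermediateField.adjoin.powerBasis hint).map
    ((IntermediateField.equivOfEq hgen).trans IntermediateField.topEquiv))
  have hgen : pb.gen = α := by
    simp [pb, PowerBasis.map_gen, IntermediateField.adjoin.powerBasis_gen]
  have hdim : pb.dim = n := by
    rw [← pb.natDegree_minpoly, hgen, ← hmin, natDegree_X_pow_sub_C]
  have hrepr : ∀ k (hk : k < pb.dim) (j : Fin pb.dim), k ≠ j → pb.basis.repr (α ^ k) j = 0 := by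
    intro k hk j hkj
    have : α ^ k = pb.basis ⟨k, hk⟩ := by simp [hgen]
    rw [this, Module.Basis.repr_self, Finsupp.single_apply, if_neg]
    rintro rfl
    exact hkj rfl
  rw [Algebra.trace_eq_matrix_trace pb.basis, Matrix.trace]
  refine Finset.sum_eq_zero fun j _ ↦ ?_
  rw [Matrix.diag_apply, Algebra.leftMulMatrix_eq_repr_mul, PowerBasis.basis_eq_pow, hgen,
    ← pow_add]
  have hj := j.2
  by_cases hij : i + j < pb.dim
  · exact hrepr _ hij j (by omega)
  · obtain ⟨d, hd⟩ := Nat.exists_eq_add_of_le (not_lt.1 hij)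
    have hpow : α ^ (i + j : ℕ) = a • α ^ d := by
      rw [hd, pow_add, hdim, hα, Algebra.smul_def]
    rw [hpow, map_smul, Finsupp.smul_apply,
      hrepr _ (by omega) j (by omega), smul_zero]

/-- If `m ^ (p - 1) ≡ 1` modulo `p ^ (k + 1)`, then `m⁻¹` is a `p ^ k`-th power modulo any power
of the odd prime `p`. -/
lemma exists_pow_mul_eq_one_add {p k : ℕ} (hp : p.Prime) (hodd : Odd p) {m : ℤ}
    (h : (p : ℤ) ^ (k + 1) ∣ m ^ (p - 1) - 1) (n : ℕ) :
    ∃ c z : ℤ, c ^ p ^ k * m = 1 + p ^ n * z := by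
  have hp3 : 3 ≤ p := by
    have := hp.two_le
    rcases hodd with ⟨t, rfl⟩
    omega
  suffices H : ∀ n, ∃ c z : ℤ, c ^ p ^ k * m = 1 + p ^ (n + (k + 1)) * z by
    obtain ⟨c, z, hz⟩ := H n
    exact ⟨c, p ^ (k + 1) * z, by rw [hz, pow_add, mul_assoc]⟩
  intro n
  induction n with
  | zero =>
    have h1 : p - 1 ∣ p ^ k * (p - 2) + 1 := by
      have h2 : p ^ k * (p - 2) + 1 ≡ 1 ^ k * (p - 2) + 1 [MOD p - 1] := by
        refine Nat.ModEq.add_right _ (Nat.ModEq.mul_right _ (Nat.ModEq.pow _ ?_))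
        exact ((Nat.modEq_iff_dvd' (by omega)).2 dvd_rfl).symm
      refine (Nat.modEq_zero_iff_dvd).1 (h2.trans ?_)
      rw [one_pow, one_mul, show p - 2 + 1 = p - 1 by omega]
      exact (Nat.modEq_zero_iff_dvd).2 dvd_rfl
    obtain ⟨e, he⟩ := h1
    have h3 : (p : ℤ) ^ (k + 1) ∣ (m ^ (p - 1)) ^ e - 1 :=
      h.trans (sub_one_dvd_pow_sub_one _ _)
    obtain ⟨z, hz⟩ := h3
    refine ⟨m ^ (p - 2), z, ?_⟩
    rw [zero_add, ← hz, ← pow_mul, ← pow_mul, ← he, pow_succ, mul_comm (p - 2)]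
    ring
  | succ n ih =>
    obtain ⟨c, z, hz⟩ := ih
    obtain ⟨y, hy⟩ := ZMod.exists_one_add_mul_pow_prime_pow_eq (R := ℤ) (u := p ^ (n + 1))
      (v := p) hp (dvd_pow_self _ (by omega))
      (by
        rw [← pow_succ', ← pow_succ, ← pow_mul]
        exact pow_dvd_pow _ (by nlinarith)) (-z) k
    refine ⟨c * (1 + p ^ (n + 1) * -z), y + z * p ^ n * p ^ k * (-z + p * y), ?_⟩
    rw [mul_pow, mul_right_comm, hz, hy]
    ring

lemma intCast_mem_iff_dvd {R : Type*} [CommRing R] {p : ℕ} (hp : p.Prime) {P : Ideal R}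
    (hP : P ≠ ⊤) (h : (p : R) ∈ P) (a : ℤ) : (a : R) ∈ P ↔ (p : ℤ) ∣ a := by
  constructor
  · intro ha
    by_contra hn
    have hc : IsCoprime (p : ℤ) a :=
      (Nat.prime_iff_prime_int.1 hp).coprime_iff_not_dvd.2 hn
    obtain ⟨u, v, huv⟩ := hc
    apply hP
    rw [Ideal.eq_top_iff_one]
    have := congrArg (Int.cast : ℤ → R) huv
    push_cast at this
    rw [← this]
    exact add_mem (P.mul_mem_left _ h) (P.mul_mem_left _ ha)
  · rintro ⟨b, rfl⟩
    push_cast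
    exact P.mul_mem_right _ h

lemma natCard_quotient_eq_of_forall_exists_int {R : Type*} [CommRing R] {p : ℕ} (hp : p.Prime)
    {P : Ideal R} (hP : P ≠ ⊤) (h : (p : R) ∈ P) (H : ∀ y : R, ∃ a : ℤ, y - a ∈ P) :
    Nat.card (R ⧸ P) = p := by
  have : Nontrivial (R ⧸ P) := Ideal.Quotient.nontrivial_iff.2 hP
  have : Fact p.Prime := ⟨hp⟩
  have hchar : CharP (R ⧸ P) p := by
    rw [CharP.charP_iff_prime_eq_zero hp, ← map_natCast (Ideal.Quotient.mk P)]
    exact Ideal.Quotient.eq_zero_iff_mem.2 h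
  rw [← Nat.card_zmod p]
  symm
  refine Nat.card_congr (Equiv.ofBijective (ZMod.castHom dvd_rfl (R ⧸ P)) ⟨?_, ?_⟩)
  · exact ZMod.castHom_injective _
  · intro y
    obtain ⟨y, rfl⟩ := Ideal.Quotient.mk_surjective y
    obtain ⟨a, ha⟩ := H y
    refine ⟨a, ?_⟩
    rw [map_intCast, ← map_intCast (Ideal.Quotient.mk P)]
    exact ((Ideal.Quotient.eq).2 ha).symm

/-- In a ring generated by one element, the primes over `p` whose residue fields have
`p` elements are at most `p` in number. -/
lemma not_pairwise_ne_of_adjoin_eq_top {R : Type*} [CommRing R] {p : ℕ} (hp : p.Prime) {θ : R}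
    (hθ : Algebra.adjoin ℤ {θ} = ⊤) (Q : Fin (p + 1) → Ideal R) (hQ : ∀ i, (Q i).IsPrime)
    (hpQ : ∀ i, (p : R) ∈ Q i) (hθQ : ∀ i, θ ^ p - θ ∈ Q i) : ¬ Function.Injective Q := by
  have := Fact.mk hp
  have key : ∀ i, ∃ a : ZMod p, θ - (a.val : R) ∈ Q i := by
    intro i
    have : CharP (R ⧸ Q i) p := by
      rw [CharP.charP_iff_prime_eq_zero hp, ← map_natCast (Ideal.Quotient.mk (Q i))]
      exact Ideal.Quotient.eq_zero_iff_mem.2 (hpQ i)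
    let := ZMod.algebra (R ⧸ Q i) p
    have hs : Splits (X ^ p - X : (ZMod p)[X]) := by
      rw [splits_iff_card_roots, FiniteField.X_pow_card_sub_X_natDegree_eq _ hp.one_lt]
      have h := FiniteField.roots_X_pow_card_sub_X (ZMod p)
      rw [ZMod.card p] at h
      rw [h, ← Finset.card_def, Finset.card_univ, ZMod.card]
    obtain ⟨a, ha⟩ := hs.mem_range_of_isRoot
      (FiniteField.X_pow_card_sub_X_ne_zero (ZMod p) hp.one_lt)
      (i := ZMod.castHom dvd_rfl (R ⧸ Q i)) (x := Ideal.Quotient.mk (Q i) θ) (by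
        simpa [← map_pow, ← map_sub] using Ideal.Quotient.eq_zero_iff_mem.2 (hθQ i))
    refine ⟨a, ?_⟩
    rw [← Ideal.Quotient.eq, ← ha, map_natCast]
    simp
  choose a ha using key
  obtain ⟨i, j, hij, hij'⟩ := Fintype.exists_ne_map_eq_of_card_lt a (by simp [ZMod.card])
  intro hinj
  apply hij
  apply hinj
  ext y
  obtain ⟨f, rfl⟩ : ∃ f : ℤ[X], aeval θ f = y := by
    have : y ∈ Algebra.adjoin ℤ {θ} := hθ ▸ Algebra.mem_top
    rwa [Algebra.adjoin_singleton_eq_range_aeval] at this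
  have key2 : ∀ i, aeval θ f ∈ Q i ↔ (p : ℤ) ∣ f.eval ((a i).val : ℤ) := by
    intro i
    rw [← intCast_mem_iff_dvd hp (hQ i).ne_top (hpQ i)]
    have h := (Q i).mem_of_dvd (sub_dvd_eval_sub θ ((a i).val : R) (f.map (Int.castRingHom R)))
      (ha i)
    rw [eval_map, eval_map, ← algebraMap_int_eq, ← aeval_def, ← aeval_def] at h
    have h2 : aeval ((a i).val : R) f = ((f.eval ((a i).val : ℤ) : ℤ) : R) := by
      simpa using aeval_algebraMap_apply R ((a i).val : ℤ) f
    rw [h2] at h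
    exact ⟨fun h' ↦ by simpa using sub_mem h' h, fun h' ↦ by simpa using add_mem h h'⟩
  rw [key2, key2, hij']

lemma finrank_eq_of_root {F K : Type*} [Field F] [Field K] [Algebra F K] {n : ℕ} (hn : n ≠ 0)
    {a : F} (hirr : Irreducible (X ^ n - C a)) {α : K}
    (hgen : IntermediateField.adjoin F {α} = ⊤) (hα : α ^ n = algebraMap F K a) :
    Module.finrank F K = n := by
  have hint : IsIntegral F α := ⟨_, monic_X_pow_sub_C a hn, by simp [hα]⟩
  rw [← IntermediateField.finrank_top', ← hgen, IntermediateField.adjoin.finrank hint,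
    ← minpoly.eq_of_irreducible_of_monic hirr (by simp [hα]) (monic_X_pow_sub_C a hn),
    natDegree_X_pow_sub_C]

theorem exists_injective_primes_of_root {K : Type*} [Field K] [NumberField K] {p r e : ℕ}
    (hp : p.Prime) (hodd : Odd p) {m : ℤ} (hm : (p : ℤ) ^ (e + 1) ∣ m ^ (p - 1) - 1)
    (her : e ≤ r) (hirr : Irreducible ((X : ℚ[X]) ^ p ^ r - C (m : ℚ))) {α : K}
    (hgen : IntermediateField.adjoin ℚ {α} = ⊤) (hα : α ^ p ^ r = (m : K)) :
    ∃ Q : Fin (e + 1) → Ideal (𝓞 K), Function.Injective Q ∧ (∀ i, (Q i).IsPrime) ∧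
      ∀ i, (p : 𝓞 K) ∈ Q i := by
  have hα' : α ^ p ^ r = algebraMap ℚ K m := by simpa using hα
  have hpr : p ^ r ≠ 0 := (pow_pos hp.pos r).ne'
  have hint : IsIntegral ℤ α :=
    .of_pow (pow_pos hp.pos r) (hα ▸ isIntegral_algebraMap (x := m))
  obtain ⟨a, rfl⟩ : ∃ a : 𝓞 K, (a : K) = α := ⟨⟨α, hint⟩, rfl⟩
  have ha : a ^ p ^ r = m := by
    apply RingOfIntegers.coe_injective
    simpa using hα
  obtain ⟨c, z, hz⟩ := exists_pow_mul_eq_one_add hp hodd hm (2 * e + (r + 1))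
  have hx : (c * a ^ p ^ (r - e)) ^ p ^ e = 1 + (p : 𝓞 K) ^ (2 * e + (r + 1)) * (z : 𝓞 K) := by
    rw [mul_pow, ← pow_mul, ← pow_add, Nat.sub_add_cancel her, ha]
    exact_mod_cast congrArg (Int.cast : ℤ → 𝓞 K) hz
  obtain ⟨E, hE, hEmul⟩ := exists_chain_of_pow_eq hp.pos hx
  have htr : ∀ k ≤ e, Algebra.trace ℤ (𝓞 K) (E k) = p ^ (r - e + k) := by
    intro k hk
    have h : Algebra.trace ℤ (𝓞 K) (p ^ (e - k) * E k) = p ^ r := by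
      rw [hE k hk, map_sum, Finset.sum_eq_single_of_mem 0 (by simp [hp.pos])]
      · have := Algebra.trace_algebraMap (S := 𝓞 K) (1 : ℤ)
        rw [map_one] at this
        simp [this, RingOfIntegers.rank, finrank_eq_of_root hpr hirr hgen hα']
      · intro j hj hj0
        rw [Finset.mem_range] at hj
        have h0 : Algebra.trace ℚ K ((a : K) ^ (p ^ (r - e) * (p ^ k * j))) = 0 := by
          refine trace_root_pow_eq_zero hirr hgen hα' ?_ ?_
          · have := hp.pos
            positivity
          · rw [show p ^ r = p ^ (r - e) * (p ^ k * p ^ (e - k)) by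
              rw [← pow_add, ← pow_add]
              congr 1
              omega]
            have := hp.pos
            gcongr
        rw [mul_pow, ← pow_mul, ← Int.cast_pow, ← zsmul_eq_mul, map_zsmul]
        have h1 : Algebra.trace ℤ (𝓞 K) (a ^ (p ^ (r - e) * (p ^ k * j))) = 0 := by
          rw [← Int.cast_inj (α := ℚ), Algebra.coe_trace_int]
          simpa using h0
        rw [h1, smul_zero]
    have h2 : (p : 𝓞 K) ^ (e - k) * E k = ((p : ℤ) ^ (e - k)) • E k := by simp
    rw [h2, map_zsmul, smul_eq_mul] at h
    have hp0 : (p : ℤ) ^ (e - k) ≠ 0 := by exact_mod_cast (pow_pos hp.pos _).ne'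
    apply mul_left_cancel₀ hp0
    rw [h, ← pow_add]
    congr 1
    omega
  set E' : ℕ → 𝓞 K := fun k ↦ k.casesOn 0 E with hE'
  have hE'mul : ∀ k l, l ≤ k → k ≤ e + 1 → (p : 𝓞 K) ^ (r + 1) ∣ E' k * E' l - E' l := by
    rintro k (_ | l) hl hk
    · simp [hE']
    · obtain ⟨k, rfl⟩ : ∃ k', k = k' + 1 := ⟨k - 1, by omega⟩
      exact hEmul k l (by omega) (by omega)
  have htrD : ∀ i ≤ e, 0 < Algebra.trace ℤ (𝓞 K) (E' (i + 1) - E' i) ∧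
      Algebra.trace ℤ (𝓞 K) (E' (i + 1) - E' i) < p ^ (r + 1) := by
    have hp1 : (1 : ℤ) < p := by exact_mod_cast hp.one_lt
    rintro (_ | i) hi
    · rw [show E' (0 + 1) - E' 0 = E 0 from sub_zero _, htr 0 hi]
      exact ⟨by positivity, pow_lt_pow_right₀ hp1 (by omega)⟩
    · simp only [hE', map_sub, htr (i + 1) hi, htr i (by omega)]
      have h1 : (p : ℤ) ^ (r - e + i) < p ^ (r - e + (i + 1)) :=
        pow_lt_pow_right₀ hp1 (by omega)
      have h2 : (p : ℤ) ^ (r - e + (i + 1)) < p ^ (r + 1) :=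
        pow_lt_pow_right₀ hp1 (by omega)
      have h3 : (0 : ℤ) < p ^ (r - e + i) := by positivity
      constructor <;> linarith
  refine exists_injective_primes (p : 𝓞 K) (fun i : Fin (e + 1) ↦ E' (i + 1) - E' i) ?_ ?_
  · intro i j hij
    exact (dvd_pow_self _ (by omega)).trans
      (dvd_chain_sub_mul_sub hE'mul i.2 j.2 (fun h ↦ hij (Fin.ext h)))
  · intro i n h
    obtain ⟨y, hy⟩ := pow_dvd_of_dvd_pow (dvd_chain_sub_sq hE'mul i.2) h
    obtain ⟨h1, h2⟩ := htrD i (by omega)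
    have h3 : (p : 𝓞 K) ^ (r + 1) * y = ((p : ℤ) ^ (r + 1)) • y := by simp
    rw [hy, h3, map_zsmul, smul_eq_mul] at h1 h2
    exact (Int.le_of_dvd h1 (Dvd.intro _ rfl)).not_gt h2

/-- In the ring of integers of the `p ^ r`-th cyclotomic field, every element is congruent to
an integer modulo all primes over `p`. -/
lemma exists_int_sub_mem_of_isCyclotomicExtension {F : Type*} [Field F] [NumberField F] {p r : ℕ}
    (hp : p.Prime) [IsCyclotomicExtension {p ^ r} ℚ F] (y : 𝓞 F) :
    ∃ a : ℤ, ∀ P : Ideal (𝓞 F), P.IsPrime → (p : 𝓞 F) ∈ P → y - a ∈ P := by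
  have : NeZero (p ^ r) := ⟨(pow_pos hp.pos r).ne'⟩
  have hζ := IsCyclotomicExtension.zeta_spec (p ^ r) ℚ F
  obtain ⟨f, hf⟩ : ∃ f : ℤ[X], aeval hζ.toInteger f = y := by
    have : y ∈ Algebra.adjoin ℤ {hζ.integralPowerBasis.gen} :=
      hζ.integralPowerBasis.adjoin_gen_eq_top ▸ Algebra.mem_top
    rwa [Algebra.adjoin_singleton_eq_range_aeval, IsPrimitiveRoot.integralPowerBasis_gen] at this
  refine ⟨f.eval 1, fun P hP hpP ↦ ?_⟩
  have hζP : hζ.toInteger - 1 ∈ P := by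
    have : Fact p.Prime := ⟨hp⟩
    obtain ⟨t, ht⟩ := exists_add_pow_prime_pow_eq hp (hζ.toInteger - 1) 1 r
    rw [sub_add_cancel, hζ.toInteger_isPrimitiveRoot.pow_eq_one, one_pow] at ht
    refine hP.mem_of_pow_mem (p ^ r) ?_
    rw [show (hζ.toInteger - 1) ^ p ^ r = p * (-((hζ.toInteger - 1) * 1 * t)) by
      linear_combination -ht]
    exact P.mul_mem_right _ hpP
  have h := P.mem_of_dvd (sub_dvd_eval_sub hζ.toInteger 1 (f.map (Int.castRingHom (𝓞 F)))) hζP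
  rw [eval_map, eval_map, ← algebraMap_int_eq, ← aeval_def, ← aeval_def, hf] at h
  have h1 : aeval (1 : 𝓞 F) f = ((f.eval 1 : ℤ) : 𝓞 F) := by
    simpa using aeval_algebraMap_apply (𝓞 F) (1 : ℤ) f
  rwa [h1] at h

lemma mul_eq_inv_mul_of_inverts {N : Type*} [Field N] [Algebra ℚ N] {n : ℕ} [NeZero n] {ζ β : N}
    (hζ : IsPrimitiveRoot ζ n) (hβ0 : β ≠ 0) (hβ : ∀ σ : Gal(N/ℚ), (σ β / β) ^ n = 1)
    (hext : ∀ σ τ : Gal(N/ℚ), σ ζ = τ ζ → σ β = τ β → σ = τ)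
    {σ τ : Gal(N/ℚ)} (hσ : σ ζ = ζ) (hτ : τ ζ = ζ⁻¹) : σ * (τ * σ) = τ := by
  obtain ⟨i, -, hi⟩ := hζ.eq_pow_of_pow_eq_one (hβ σ)
  obtain ⟨j, -, hj⟩ := hζ.eq_pow_of_pow_eq_one (hβ τ)
  have hi' : σ β = ζ ^ i * β := by rw [hi]; field_simp
  have hj' : τ β = ζ ^ j * β := by rw [hj]; field_simp
  have hζ0 : ζ ≠ 0 := hζ.ne_zero (NeZero.ne n)
  apply hext
  · simp [hσ, hτ]
  · simp only [AlgEquiv.mul_apply, hi', hj', map_mul, map_pow, hσ, hτ, map_inv₀, inv_pow]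
    field_simp

lemma pow_eq_one_of_fixes {N : Type*} [Field N] [Algebra ℚ N] {n : ℕ} [NeZero n] {ζ β : N}
    (hζ : IsPrimitiveRoot ζ n) (hβ0 : β ≠ 0) (hβ : ∀ σ : Gal(N/ℚ), (σ β / β) ^ n = 1)
    (hext : ∀ σ τ : Gal(N/ℚ), σ ζ = τ ζ → σ β = τ β → σ = τ)
    {σ : Gal(N/ℚ)} (hσ : σ ζ = ζ) : σ ^ n = 1 := by
  obtain ⟨i, -, hi⟩ := hζ.eq_pow_of_pow_eq_one (hβ σ)
  have hi' : σ β = ζ ^ i * β := by rw [hi]; field_simp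
  have h1 : ∀ k, (σ ^ k) ζ = ζ := by
    intro k
    induction k with
    | zero => simp
    | succ k ih => rw [pow_succ, AlgEquiv.mul_apply, hσ, ih]
  have h2 : ∀ k, (σ ^ k) β = (ζ ^ i) ^ k * β := by
    intro k
    induction k with
    | zero => simp
    | succ k ih =>
      rw [pow_succ', AlgEquiv.mul_apply, ih]
      simp only [map_mul, map_pow, hσ, hi']
      ring
  apply hext
  · simp [h1]
  · simp [h2, pow_right_comm, hζ.pow_eq_one]

/-- If an automorphism `σ` of odd order acts as the `p`-th power map modulo an ideal `P`, and is
inverted by an element of the decomposition group of `P`, then the `p`-th power map is trivial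
modulo `P`. -/
lemma pow_sub_self_mem_of_inverted {G S : Type*} [Group G] [CommRing S] [MulSemiringAction G S]
    {P : Ideal S} {σ τ : G} {p n : ℕ} (hn : Odd n) (hσn : σ ^ n = 1)
    (hσ : ∀ x : S, σ • x - x ^ p ∈ P) (hτ : ∀ x ∈ P, τ • x ∈ P) (hστ : σ * (τ * σ) = τ)
    (x : S) : x ^ p - x ∈ P := by
  have hmk : ∀ x, Ideal.Quotient.mk P (σ • x) = Ideal.Quotient.mk P x ^ p := fun x ↦ by
    rw [← map_pow, Ideal.Quotient.eq]
    exact hσ x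
  have h2 : ∀ x : S, Ideal.Quotient.mk P x ^ p ^ 2 = Ideal.Quotient.mk P x := by
    intro x
    have h := hτ _ (hσ (τ⁻¹ • σ • x))
    have h1 : τ • σ • τ⁻¹ • σ • x = x := by
      apply smul_left_cancel σ
      rw [← mul_smul τ, ← mul_smul σ, hστ, smul_inv_smul]
    rwa [smul_sub, smul_pow', smul_inv_smul, h1, ← Ideal.Quotient.eq, map_pow, hmk, ← pow_mul,
      ← sq, eq_comm] at h
  have h2k : ∀ (k : ℕ), Ideal.Quotient.mk P x ^ p ^ (2 * k) = Ideal.Quotient.mk P x := by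
    intro k
    induction k with
    | zero => simp
    | succ k ih => rw [mul_add, mul_one, pow_add, pow_mul, ih, h2]
  have hk : ∀ (k : ℕ) (x : S), Ideal.Quotient.mk P (σ ^ k • x) = Ideal.Quotient.mk P x ^ p ^ k := by
    intro k
    induction k with
    | zero => simp
    | succ k ih => intro x; rw [pow_succ', mul_smul, hmk, ih, ← pow_mul, ← pow_succ]
  obtain ⟨k, rfl⟩ := hn
  rw [← Ideal.Quotient.eq, map_pow]
  have := hk (2 * k + 1) x
  rwa [hσn, one_smul, pow_succ, pow_mul, h2k, eq_comm] at this

open scoped Pointwise in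
theorem pow_sub_self_mem_of_galois {N : Type*} [Field N] [NumberField N] [IsGalois ℚ N]
    {p r : ℕ} (hp : p.Prime) (hodd : Odd p) {ζ β : N} (hζ : IsPrimitiveRoot ζ (p ^ r))
    (hβ0 : β ≠ 0) (hβ : ∀ σ : Gal(N/ℚ), (σ β / β) ^ p ^ r = 1)
    (hext : ∀ σ τ : Gal(N/ℚ), σ ζ = τ ζ → σ β = τ β → σ = τ) {P : Ideal (𝓞 N)} [hP : P.IsPrime]
    (hpP : (p : 𝓞 N) ∈ P) (x : 𝓞 N) : x ^ p - x ∈ P := by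
  have : NeZero (p ^ r) := ⟨(pow_pos hp.pos r).ne'⟩
  let F := IntermediateField.adjoin ℚ {ζ}
  have hF : IsCyclotomicExtension {p ^ r} ℚ F :=
    hζ.intermediateField_adjoin_isCyclotomicExtension ℚ
  let H := fixingSubgroup Gal(N/ℚ) (F : Set N)
  have hH : IsGaloisGroup H (𝓞 F) (𝓞 N) := IsGaloisGroup.of_isFractionRing H (𝓞 F) (𝓞 N) F N
  have hHζ : ∀ h : H, (h : Gal(N/ℚ)) ζ = ζ := fun h ↦
    h.2 ⟨ζ, IntermediateField.mem_adjoin_simple_self ℚ ζ⟩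
  have hmem : ∀ (Q : Ideal (𝓞 N)), Q.IsPrime → (p : 𝓞 N) ∈ Q → (p : 𝓞 F) ∈ Q.under (𝓞 F) := by
    intro Q hQ hpQ
    simpa [Ideal.under_def] using hpQ
  have hfin : Finite (𝓞 N ⧸ P) := by
    refine Ideal.finiteQuotientOfFreeOfNeBot P ?_
    rintro rfl
    exact hp.ne_zero (by exact_mod_cast (Ideal.mem_bot.1 hpP))
  obtain ⟨σ, hσ⟩ := IsArithFrobAt.exists_of_isInvariant (𝓞 F) H P
  have hcard : Nat.card (𝓞 F ⧸ P.under (𝓞 F)) = p :=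
    natCard_quotient_eq_of_forall_exists_int hp (hP.under (𝓞 F)).ne_top (hmem P hP hpP) fun y ↦
      (exists_int_sub_mem_of_isCyclotomicExtension (r := r) hp y).imp fun a h ↦
        h _ (hP.under _) (hmem P hP hpP)
  obtain ⟨τ₀, hτ₀⟩ : ∃ τ : Gal(N/ℚ), τ ζ = ζ⁻¹ := by
    refine minpoly.exists_algEquiv_of_root' (Algebra.IsAlgebraic.isAlgebraic ζ) ?_
    rw [← cyclotomic_eq_minpoly_rat hζ (NeZero.pos _),
      cyclotomic_eq_minpoly_rat hζ.inv (NeZero.pos _)]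
    exact minpoly.aeval _ _
  have hpP' : (p : 𝓞 N) ∈ τ₀ • P := by
    have h := Ideal.smul_mem_pointwise_smul τ₀ _ P hpP
    rwa [show τ₀ • (p : 𝓞 N) = p from
      map_natCast (MulSemiringAction.toRingHom Gal(N/ℚ) (𝓞 N) τ₀) p] at h
  have hP' : (τ₀ • P).IsPrime := hP.smul τ₀
  obtain ⟨g, hg⟩ := Algebra.IsInvariant.exists_smul_of_under_eq (𝓞 F) (𝓞 N) H (τ₀ • P) P (by
    ext y
    obtain ⟨a, ha⟩ := exists_int_sub_mem_of_isCyclotomicExtension (r := r) hp y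
    have h : ∀ Q : Ideal (𝓞 N), Q.IsPrime → (p : 𝓞 N) ∈ Q →
        (y ∈ Q.under (𝓞 F) ↔ (p : ℤ) ∣ a) := by
      intro Q hQ hpQ
      have hQ' := hQ.under (𝓞 F)
      have h := ha _ hQ' (hmem Q hQ hpQ)
      rw [← intCast_mem_iff_dvd hp hQ'.ne_top (hmem Q hQ hpQ)]
      exact ⟨fun h' ↦ by simpa using sub_mem h' h, fun h' ↦ by simpa using add_mem h h'⟩
    rw [h _ hP' hpP', h P hP hpP])
  refine pow_sub_self_mem_of_inverted (σ := (σ : Gal(N/ℚ))) (τ := g * τ₀) (n := p ^ r) hodd.pow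
    (pow_eq_one_of_fixes hζ hβ0 hβ hext (hHζ σ)) ?_ ?_
    (mul_eq_inv_mul_of_inverts hζ hβ0 hβ hext (hHζ σ) ?_) x
  · intro x
    have := hσ x
    rw [hcard] at this
    exact this
  · intro x hx
    rw [hg, mul_smul]
    exact Ideal.smul_mem_pointwise_smul g _ _ (Ideal.smul_mem_pointwise_smul τ₀ _ P hx)
  · rw [AlgEquiv.mul_apply, hτ₀, map_inv₀, hHζ]

lemma exists_isPrimitiveRoot_of_splits {L : Type*} [Field L] [CharZero L] {n : ℕ} (hn : 0 < n)
    {a : L} (ha : a ≠ 0) (h : (X ^ n - C a : L[X]).Splits) : ∃ ζ : L, IsPrimitiveRoot ζ n := by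
  have : NeZero (n : L) := ⟨by exact_mod_cast hn.ne'⟩
  have h1 : (X ^ n - 1 : L[X]).Splits := by
    simpa using splits_X_pow_sub_one_of_X_pow_sub_C (RingHom.id L) n ha (by simpa using h)
  have h2 : (cyclotomic n L).Splits :=
    h1.of_dvd (monic_X_pow_sub_C 1 hn.ne').ne_zero (cyclotomic.dvd_X_pow_sub_one n L)
  obtain ⟨ζ, hζ⟩ := h2.exists_eval_eq_zero (degree_cyclotomic_pos n L hn).ne'
  exact ⟨ζ, isRoot_cyclotomic_iff.mp hζ⟩

lemma algEquiv_ext_of_isSplittingField_X_pow_sub_C {F L : Type*} [Field F] [Field L] [Algebra F L]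
    {n : ℕ} (hn : 0 < n) {a : F} [hL : IsSplittingField F L (X ^ n - C a)] {ζ β : L}
    (hζ : IsPrimitiveRoot ζ n) (hβ0 : β ≠ 0) (hβ : β ^ n = algebraMap F L a) {σ τ : L ≃ₐ[F] L}
    (h1 : σ ζ = τ ζ) (h2 : σ β = τ β) : σ = τ := by
  have : NeZero n := ⟨hn.ne'⟩
  suffices h : σ.toAlgHom = τ.toAlgHom from AlgEquiv.ext fun x ↦ DFunLike.congr_fun h x
  refine AlgHom.ext_of_adjoin_eq_top (IsSplittingField.adjoin_rootSet L (X ^ n - C a)) fun x hx ↦ ?_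
  have hx' : x ^ n = algebraMap F L a := by
    simpa [sub_eq_zero] using (mem_rootSet.mp hx).2
  obtain ⟨i, -, hi⟩ := hζ.eq_pow_of_pow_eq_one (ξ := x / β) (by
    rw [div_pow, hx', hβ, div_self (hβ ▸ pow_ne_zero n hβ0)])
  have hxi : x = ζ ^ i * β := by rw [hi, div_mul_cancel₀ x hβ0]
  change σ x = τ x
  rw [hxi, map_mul, map_mul, map_pow, map_pow, h1, h2]

/-- Every prime over an odd prime `p` of a pure field of degree `p ^ r` has residue degree one. -/
lemma pow_sub_self_mem_of_root {K : Type*} [Field K] [NumberField K] {p r : ℕ} (hp : p.Prime)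
    (hodd : Odd p) {m : ℤ} (hm : m ≠ 0) (hirr : Irreducible ((X : ℚ[X]) ^ p ^ r - C (m : ℚ)))
    {α : K} (hgen : IntermediateField.adjoin ℚ {α} = ⊤) (hα : α ^ p ^ r = (m : K))
    {Q : Ideal (𝓞 K)} [Q.IsPrime] (hpQ : (p : 𝓞 K) ∈ Q) (x : 𝓞 K) : x ^ p - x ∈ Q := by
  have hn : 0 < p ^ r := pow_pos hp.pos r
  set f : ℚ[X] := X ^ p ^ r - C (m : ℚ) with hf
  let L := f.SplittingField
  have : IsSplittingField ℚ L (X ^ p ^ r - C (m : ℚ)) := by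
    convert IsSplittingField.splittingField f
    exact Subsingleton.elim _ _
  have : IsGalois ℚ L := IsGalois.of_separable_splitting_field (p := f) hirr.separable
  have : NumberField L := { to_charZero := inferInstance, to_finiteDimensional := inferInstance }
  have hsplit : (f.map (algebraMap ℚ L)).Splits := IsSplittingField.splits L f
  have hmin : minpoly ℚ α = f :=
    (minpoly.eq_of_irreducible_of_monic hirr (by simp [hf, hα]) (monic_X_pow_sub_C _ hn.ne')).symm
  obtain ⟨j⟩ := IntermediateField.nonempty_algHom_of_adjoin_splits (K := L) (S := {α})
    (fun s hs ↦ by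
      rw [Set.mem_singleton_iff.mp hs, hmin]
      exact ⟨Algebra.IsIntegral.isIntegral α, hsplit⟩) hgen
  have hβ : j α ^ p ^ r = (m : L) := by rw [← map_pow, hα, map_intCast]
  have hβ0 : j α ≠ 0 := fun h ↦ by
    rw [h, zero_pow hn.ne'] at hβ
    exact hm (by exact_mod_cast hβ.symm)
  obtain ⟨ζ, hζ⟩ := exists_isPrimitiveRoot_of_splits (a := (m : L)) hn (by exact_mod_cast hm)
    (by simpa [hf, -map_intCast, ← C_eq_intCast] using hsplit)
  let _ : Algebra K L := j.toRingHom.toAlgebra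
  obtain ⟨P, -, hP, hPQ⟩ := Ideal.exists_ideal_over_prime_of_isIntegral (S := 𝓞 L) Q ⊥
    ((Ideal.comap_bot_of_injective _ (RingOfIntegers.algebraMap.injective K L)).trans_le bot_le)
  rw [← hPQ, Ideal.mem_comap] at hpQ ⊢
  rw [map_sub, map_pow]
  refine pow_sub_self_mem_of_galois hp hodd hζ hβ0 (fun σ ↦ ?_) (fun σ τ ↦
    algEquiv_ext_of_isSplittingField_X_pow_sub_C hn (a := (m : ℚ)) hζ hβ0 (by simpa using hβ))
    (by simpa using hpQ) _
  rw [div_pow, ← map_pow, hβ, map_intCast, div_self (by exact_mod_cast hm)]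

/-- Let `p` be an odd prime, `r` a positive integer, and `m ≠ 1` squarefree and not
divisible by `p`, such that `x^(p^r) - m` is irreducible over `ℚ`. If
`ν_p(m^(p-1) - 1) > p` and `r ≥ p`, then `K = ℚ(α)` is not monogenic, where `α`
is a root. -/
theorem pure_field_not_monogenic_of_padicValInt_gt
    (p r : ℕ) (hp : p.Prime) (hodd : Odd p) (hr : 0 < r)
    (m : ℤ) (hm : Squarefree m) (hm1 : m ≠ 1) (hpm : ¬ (p : ℤ) ∣ m)
    (hF : Irreducible ((X : ℚ[X]) ^ p ^ r - C (m : ℚ)))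
    (K : Type*) [Field K] [NumberField K] (α : K)
    (hgen : IntermediateField.adjoin ℚ {α} = ⊤)
    (hroot : α ^ p ^ r = (m : K))
    (hval : p < padicValInt p (m ^ (p - 1) - 1)) (hrp : p ≤ r) :
    ¬ ∃ θ : 𝓞 K, Algebra.adjoin ℤ {θ} = ⊤ := by
  rintro ⟨θ, hθ⟩
  have hdvd : (p : ℤ) ^ (p + 1) ∣ m ^ (p - 1) - 1 :=
    (pow_dvd_pow _ hval).trans (padicValInt_dvd _)
  obtain ⟨Q, hinj, hQ, hpQ⟩ := exists_injective_primes_of_root hp hodd hdvd hrp hF hgen hroot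
  exact not_pairwise_ne_of_adjoin_eq_top hp hθ Q hQ hpQ
    (fun i ↦ have := hQ i
      pow_sub_self_mem_of_root hp hodd hm.ne_zero hF hgen hroot (hpQ i) θ) hinj
end

section
/- Let r ≥ 3 be an integer and m ≠ 1 a squarefree rational integer with m ≡ 1 (mod 81) or m ≡ −1 (mod 81), such that F(x) = x^(3^r) − m is irreducible over ℚ. Let α be a complex root of F and K = ℚ(α). Then K is not monogenic. -/
open Polynomial NumberField

open scoped Pointwise in
/-- Above `3`, some automorphism inducing the cubing map modulo `Q` fixes `ζ`, and some automorphism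
preserving `Q` inverts `ζ`, for `ζ` a root of unity of `3`-power order. -/
theorem exists_frobenius_fixing_zeta {N : Type*} [Field N] [NumberField N] [IsGalois ℚ N] {r : ℕ}
    {ζ : N} (hζ : IsPrimitiveRoot ζ (3 ^ (r + 1))) (Q : Ideal (𝓞 N)) [Q.IsPrime]
    (h3 : (3 : 𝓞 N) ∈ Q) :
    (∃ h : Gal(N/ℚ), h ζ = ζ ∧ ∀ x : 𝓞 N, h • x - x ^ 3 ∈ Q) ∧
    ∃ σ : Gal(N/ℚ), σ ζ = ζ⁻¹ ∧ ∀ x ∈ Q, σ • x ∈ Q := by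
  have : Fact (Nat.Prime 3) := ⟨Nat.prime_three⟩
  let F := IntermediateField.adjoin ℚ {ζ}
  have hF : IsCyclotomicExtension {3 ^ (r + 1)} ℚ F :=
    hζ.intermediateField_adjoin_isCyclotomicExtension ℚ
  have hzF : ζ ∈ F := IntermediateField.mem_adjoin_simple_self ℚ ζ
  have hfix (h : Gal(N/F)) : h.restrictScalars ℚ ζ = ζ := h.commutes ⟨ζ, hzF⟩
  have hlies (P : Ideal (𝓞 N)) [P.IsPrime] (hP : (3 : 𝓞 N) ∈ P) :
      (P.under (𝓞 F)).LiesOver (Ideal.span {((3 : ℕ) : ℤ)}) := by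
    rw [Ideal.liesOver_iff]
    refine (Int.ideal_span_isMaximal_of_prime 3).eq_of_le Ideal.IsPrime.ne_top' ?_
    rw [Ideal.span_singleton_le_iff_mem]
    simpa [Ideal.mem_comap] using hP
  constructor
  · have : Finite (𝓞 N ⧸ Q) := Ring.HasFiniteQuotients.finiteQuotient (by
      rintro rfl
      simp at h3)
    obtain ⟨h, hh⟩ := IsArithFrobAt.exists_of_isInvariant (𝓞 F) Gal(N/F) Q
    refine ⟨h.restrictScalars ℚ, hfix h, fun x ↦ ?_⟩
    have := hlies Q h3
    have hcard : Nat.card (𝓞 F ⧸ Q.under (𝓞 F)) = 3 := by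
      rw [IsCyclotomicExtension.Rat.eq_span_zeta_sub_one_of_liesOver 3 r F hF.zeta_spec
        (Q.under (𝓞 F))]
      exact IsCyclotomicExtension.Rat.absNorm_span_zeta_sub_one 3 r hF.zeta_spec
    have := hh x
    rw [hcard] at this
    exact this
  · have hconj : IsConjRoot ℚ ζ⁻¹ ζ := by
      rw [IsConjRoot, ← Polynomial.cyclotomic_eq_minpoly_rat hζ (by positivity),
        ← Polynomial.cyclotomic_eq_minpoly_rat hζ.inv (by positivity)]
    obtain ⟨g, hg⟩ := isConjRoot_iff_exists_algEquiv.1 hconj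
    have h3' : (3 : 𝓞 N) ∈ g • Q := by
      have := Ideal.smul_mem_pointwise_smul g _ Q h3
      rwa [show g • (3 : 𝓞 N) = 3 from
        map_ofNat (MulSemiringAction.toRingHom Gal(N/ℚ) (𝓞 N) g) 3] at this
    have h1 := hlies Q h3
    have h2 := hlies (g • Q) h3'
    have hu : (g • Q).under (𝓞 F) = Q.under (𝓞 F) := by
      rw [IsCyclotomicExtension.Rat.eq_span_zeta_sub_one_of_liesOver 3 r F hF.zeta_spec
          (Q.under (𝓞 F)), IsCyclotomicExtension.Rat.eq_span_zeta_sub_one_of_liesOver 3 r F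
          hF.zeta_spec ((g • Q).under (𝓞 F))]
    obtain ⟨h, hh⟩ := Algebra.IsInvariant.exists_smul_of_under_eq (𝓞 F) (𝓞 N) Gal(N/F) (g • Q) Q hu
    refine ⟨h.restrictScalars ℚ * g, ?_, fun x hx ↦ ?_⟩
    · rw [AlgEquiv.mul_apply, hg, map_inv₀, hfix]
    · have := Ideal.smul_mem_pointwise_smul h _ _ (Ideal.smul_mem_pointwise_smul g _ Q hx)
      rw [← hh] at this
      rw [mul_smul]
      exact this

/-- In the splitting field of `X ^ 3 ^ (r + 1) - m`, primes above `3` have residue field `𝔽₃`. -/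
theorem pow_three_sub_self_mem {N : Type*} [Field N] [NumberField N] [IsGalois ℚ N] {r : ℕ}
    {ζ a m : N} (hζ : IsPrimitiveRoot ζ (3 ^ (r + 1))) (hm : m ≠ 0)
    (hmfix : ∀ g : Gal(N/ℚ), g m = m) (ha : a ^ 3 ^ (r + 1) = m)
    (hgen : Algebra.adjoin ℚ {y : N | y ^ 3 ^ (r + 1) = m} = ⊤)
    (Q : Ideal (𝓞 N)) [Q.IsPrime] (h3 : (3 : 𝓞 N) ∈ Q) (x : 𝓞 N) : x ^ 3 - x ∈ Q := by
  obtain ⟨⟨h, hhζ, hh⟩, σ, hσζ, hσ⟩ := exists_frobenius_fixing_zeta hζ Q h3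
  have ha0 : a ≠ 0 := by
    rintro rfl
    exact hm (by rw [← ha, zero_pow (by positivity)])
  have hroot {w : N} (hw : w ^ 3 ^ (r + 1) = 1) : h w = w ∧ σ w = w⁻¹ := by
    obtain ⟨i, -, rfl⟩ := hζ.eq_pow_of_pow_eq_one hw
    simp [hhζ, hσζ]
  have hquot {y z : N} (hy : y ^ 3 ^ (r + 1) = m) (hz : z ^ 3 ^ (r + 1) = m) :
      ∃ w : N, w ^ 3 ^ (r + 1) = 1 ∧ z = w * y := by
    have hy0 : y ≠ 0 := by
      rintro rfl
      exact hm (by rw [← hy, zero_pow (by positivity)])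
    exact ⟨z / y, by rw [div_pow, hy, hz, div_self hm], by field_simp⟩
  have hact (g : Gal(N/ℚ)) {y : N} (hy : y ^ 3 ^ (r + 1) = m) : g y ^ 3 ^ (r + 1) = m := by
    rw [← map_pow, hy, hmfix]
  obtain ⟨ω, hω, hωa⟩ := hquot ha (hact h ha)
  have hhroot {y : N} (hy : y ^ 3 ^ (r + 1) = m) : h y = ω * y := by
    obtain ⟨w, hw, rfl⟩ := hquot ha hy
    rw [map_mul, (hroot hw).1, hωa]
    ring
  have hω0 : ω ≠ 0 := by
    rintro rfl
    simp at hω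
  have hinv : h * (σ * h * σ⁻¹) = 1 := by
    have : (h * (σ * h * σ⁻¹) : Gal(N/ℚ)).toAlgHom = AlgHom.id ℚ N := by
      refine AlgHom.ext_of_adjoin_eq_top hgen fun y hy ↦ ?_
      change h (σ (h (σ⁻¹ y))) = y
      have hσy : σ (σ⁻¹ y) = y := by
        rw [← AlgEquiv.mul_apply, mul_inv_cancel, AlgEquiv.one_apply]
      rw [hhroot (hact σ⁻¹ hy), map_mul, (hroot hω).2, map_mul, map_inv₀, (hroot hω).1, hσy,
        hhroot hy]
      field_simp
    exact AlgEquiv.ext fun y ↦ DFunLike.congr_fun this y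
  have hpow : h ^ 3 ^ (r + 1) = 1 := by
    have hiter (i : ℕ) {y : N} (hy : y ^ 3 ^ (r + 1) = m) : (h ^ i) y = ω ^ i * y := by
      induction i with
      | zero => simp
      | succ i ih =>
        rw [pow_succ', AlgEquiv.mul_apply, ih, map_mul, map_pow, (hroot hω).1, hhroot hy]
        ring
    have : (h ^ 3 ^ (r + 1) : Gal(N/ℚ)).toAlgHom = AlgHom.id ℚ N := by
      refine AlgHom.ext_of_adjoin_eq_top hgen fun y hy ↦ ?_
      change (h ^ 3 ^ (r + 1) : Gal(N/ℚ)) y = y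
      rw [hiter _ hy, hω, one_mul]
    exact AlgEquiv.ext fun y ↦ DFunLike.congr_fun this y
  let π := Ideal.Quotient.mk Q
  have hπ (y : 𝓞 N) : π (h • y) = π y ^ 3 := by
    rw [← map_pow]
    exact Ideal.Quotient.eq.2 (hh y)
  have hnine (y : 𝓞 N) : π y ^ 9 = π y := by
    have hconj : π ((σ * h * σ⁻¹) • y) = π y ^ 3 := by
      have := hσ _ (hh (σ⁻¹ • y))
      rw [smul_sub, smul_pow', smul_inv_smul, ← mul_smul, ← mul_smul] at this
      rw [← map_pow]
      exact Ideal.Quotient.eq.2 this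
    have := hπ ((σ * h * σ⁻¹) • y)
    rw [← mul_smul, hinv, one_smul, hconj, ← pow_mul] at this
    exact this.symm
  have hnine_iter (i : ℕ) : π x ^ 9 ^ i = π x := by
    induction i with
    | zero => simp
    | succ i ih => rw [pow_succ, pow_mul, ih, hnine]
  have hiter (i : ℕ) : π ((h ^ i) • x) = π x ^ 3 ^ i := by
    induction i with
    | zero => simp
    | succ i ih => rw [pow_succ', mul_smul, hπ, ih, ← pow_mul, pow_succ]
  obtain ⟨t, ht⟩ : Odd (3 ^ (r + 1)) := Odd.pow (by decide)
  have := hiter (3 ^ (r + 1))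
  rw [hpow, one_smul, ht, pow_succ, pow_mul 3 2 t, pow_mul (π x), show 3 ^ 2 = 9 by norm_num,
    hnine_iter] at this
  rw [← Ideal.Quotient.eq, map_pow]
  exact this.symm

/-- The average `(1 + y + ⋯ + y ^ (q - 1)) / q` of the first `q` powers of `y`. -/
noncomputable def geomAverage {N : Type*} [Field N] (q : ℕ) (y : N) : N :=
  (∑ i ∈ Finset.range q, y ^ i) / q

theorem geomAverage_mul_sub_one {N : Type*} [Field N] [CharZero N] {q : ℕ} (hq : q ≠ 0) {y : N} :
    geomAverage q y * (y - 1) * q = y ^ q - 1 := by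
  have : (q : N) ≠ 0 := Nat.cast_ne_zero.2 hq
  rw [geomAverage, ← geom_sum_mul]
  field_simp

theorem isIntegral_geomAverage {N : Type*} [Field N] [CharZero N] {q : ℕ} (hq0 : q ≠ 0)
    (hq : ∀ j < q, q ^ (j + 1) ∣ q.choose (j + 1) * 81 ^ j)
    {y : N} {k : ℤ} (hk : k ≠ 0) (hy : y ^ q = 1 + 81 * k) : IsIntegral ℤ (geomAverage q y) := by
  choose! a ha using hq
  set e := geomAverage q y
  have hqN : (q : N) ≠ 0 := Nat.cast_ne_zero.2 hq0
  have hkN : (81 * k : N) ≠ 0 := mul_ne_zero (by norm_num) (Int.cast_ne_zero.2 hk)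
  have hte : (y - 1) * e * q = 81 * k := by
    have := geomAverage_mul_sub_one hq0 (y := y)
    rw [hy] at this
    linear_combination this
  have hbinom : ∑ j ∈ Finset.range q, (y - 1) ^ (j + 1) * (q.choose (j + 1) : N) = 81 * k := by
    have := add_pow (y - 1) 1 q
    rw [Finset.sum_range_succ'] at this
    simp only [one_pow, mul_one, sub_add_cancel, hy, pow_zero, Nat.choose_zero_right,
      Nat.cast_one] at this
    linear_combination -this
  have hrel : e ^ q = ∑ j ∈ Finset.range q, ((a j : ℤ) * k ^ j : ℤ) * e ^ (q - 1 - j) := by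
    refine mul_left_cancel₀ hkN ?_
    rw [← hbinom, Finset.sum_mul, hbinom, Finset.mul_sum]
    refine Finset.sum_congr rfl fun j hj ↦ ?_
    have hj' := Finset.mem_range.1 hj
    refine mul_left_cancel₀ (pow_ne_zero (j + 1) hqN) ?_
    have haj : (q.choose (j + 1) : N) * 81 ^ j = q ^ (j + 1) * a j := by exact_mod_cast ha j hj'
    have hexp : e ^ q = e ^ (j + 1) * e ^ (q - 1 - j) := by
      rw [← pow_add]
      congr 1
      omega
    calc (q : N) ^ (j + 1) * ((y - 1) ^ (j + 1) * (q.choose (j + 1) : N) * e ^ q)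
        = ((y - 1) * e * q) ^ (j + 1) * q.choose (j + 1) * e ^ (q - 1 - j) := by
          rw [hexp, mul_pow, mul_pow]
          ring
      _ = (81 * k) * k ^ j * (q.choose (j + 1) * 81 ^ j) * e ^ (q - 1 - j) := by
          rw [hte]
          ring
      _ = _ := by
          rw [haj]
          push_cast
          ring
  refine ⟨X ^ q - ∑ j ∈ Finset.range q, C ((a j : ℤ) * k ^ j) * X ^ (q - 1 - j),
    monic_X_pow_sub ?_, ?_⟩
  · refine (degree_sum_le _ _).trans_lt ((Finset.sup_lt_iff (WithBot.bot_lt_coe q)).2 ?_)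
    intro j hj
    have hj' := Finset.mem_range.1 hj
    refine (degree_C_mul_X_pow_le _ _).trans_lt ?_
    exact WithBot.coe_lt_coe.2 (by simp; omega)
  · simp only [eval₂_sub, eval₂_X_pow, eval₂_finsetSum, eval₂_mul, eval₂_C,
      algebraMap_int_eq, Int.coe_castRingHom]
    rw [hrel, sub_self]

theorem sum_geomAverage {N : Type*} [Field N] [CharZero N] {q : ℕ} (hq : q ≠ 0) {ζ : N}
    (hζ : IsPrimitiveRoot ζ q) (y : N) :
    ∑ b ∈ Finset.range q, geomAverage q (ζ ^ b * y) = 1 := by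
  have hqN : (q : N) ≠ 0 := Nat.cast_ne_zero.2 hq
  simp only [geomAverage]
  rw [← Finset.sum_div, Finset.sum_comm, Finset.sum_eq_single 0]
  · simp [hqN]
  · intro i hi hi0
    have hne : ζ ^ i ≠ 1 := hζ.pow_ne_one_of_pos_of_lt hi0 (Finset.mem_range.1 hi)
    have hgeom : ∑ b ∈ Finset.range q, (ζ ^ i) ^ b = 0 := by
      refine (mul_eq_zero.1 ?_).resolve_right (sub_ne_zero.2 hne)
      rw [geom_sum_mul, ← pow_mul, mul_comm, pow_mul, hζ.pow_eq_one, one_pow, sub_self]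
    calc ∑ b ∈ Finset.range q, (ζ ^ b * y) ^ i
        = (∑ b ∈ Finset.range q, (ζ ^ i) ^ b) * y ^ i := by
          rw [Finset.sum_mul]
          exact Finset.sum_congr rfl fun b _ ↦ by rw [mul_pow, ← pow_mul, ← pow_mul, mul_comm b]
      _ = 0 := by rw [hgeom, zero_mul]
  · simp [hq]

theorem mem_of_notMem_of_mul_sub_one {R : Type*} [CommRing R] [IsDomain R] {Q : Ideal R}
    [Q.IsPrime] (h3 : (3 : R) ∈ Q) (h30 : (3 : R) ≠ 0) {ω y e e' l : R} (hω : ω ^ 2 + ω + 1 = 0)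
    (he : e * (y - 1) = 3 * l) (he' : e' * (ω * y - 1) = 3 * l) (heQ : e ∉ Q) : e' ∈ Q := by
  have hthree : (3 : R) = (ω - 1) * (-ω ^ 2 * (ω - 1)) := by
    linear_combination (ω ^ 2 - 3 * ω + 3) * hω
  have hω1 : ω - 1 ≠ 0 := by
    intro h
    rw [h, zero_mul] at hthree
    exact h30 hthree
  have hunit : IsUnit (-ω ^ 2) :=
    IsUnit.of_mul_eq_one (-ω) (by linear_combination (ω - 1) * hω)
  have hωQ : ω - 1 ∈ Q := by
    rw [hthree] at h3
    rcases Ideal.IsPrime.mem_or_mem ‹_› h3 with h | h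
    · exact h
    · exact (Ideal.unit_mul_mem_iff_mem Q hunit).1 h
  have hrel : e' * e = (ω - 1) * (-ω ^ 2 * l * (e - e' * ω)) := by
    refine mul_left_cancel₀ hω1 ?_
    linear_combination e * he' - ω * e' * he + l * (e - e' * ω) * hthree
  exact (Ideal.IsPrime.mem_or_mem ‹_› (hrel ▸ Q.mul_mem_right _ hωQ)).resolve_right heQ

theorem mem_of_mem_of_mul_cube_sub_one {R : Type*} [CommRing R] [IsDomain R] {Q : Ideal R}
    [Q.IsPrime] (h30 : (3 : R) ≠ 0) {y e e' l : R} (hl : l ≠ 0)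
    (he : e * (y - 1) = 3 * l) (he' : e' * (y ^ 3 - 1) = 3 * (3 * l)) (heQ : e' ∈ Q) :
    e ∈ Q := by
  have hrel : e ^ 3 = e' * (e ^ 2 + 3 * l * e + 3 * l ^ 2) := by
    refine mul_left_cancel₀ (mul_ne_zero h30 (mul_ne_zero h30 hl)) ?_
    have hey : e * y = e + 3 * l := by linear_combination he
    have hcube : e ^ 3 * y ^ 3 = (e + 3 * l) ^ 3 := by rw [← hey, mul_pow]
    linear_combination -e ^ 3 * he' + e' * hcube
  exact Ideal.IsPrime.mem_of_pow_mem ‹_› 3 (hrel ▸ Q.mul_mem_right _ heQ)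

/-- Every root in `N` of the minimal polynomial of a generator `α` is the image of `α` under an
embedding. -/
theorem exists_ringHom_apply_eq {K N : Type*} [Field K] [NumberField K] [Field N] [CharZero N]
    {f : ℚ[X]} {α : K} (hgen : IntermediateField.adjoin ℚ {α} = ⊤) (hmin : minpoly ℚ α = f)
    (hsplit : (f.map (algebraMap ℚ N)).Splits) {w : N} (hw : aeval w f = 0) :
    ∃ τ : K →+* N, τ α = w := by
  obtain ⟨φ, hφ⟩ := IntermediateField.exists_algHom_of_adjoin_splits_of_aeval
    (F := ℚ) (E := K) (K := N) (S := {α})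
    (by
      rintro s rfl
      exact ⟨Algebra.IsIntegral.isIntegral s, hmin ▸ hsplit⟩)
    hgen (x := α) (y := w) (by rw [hmin, hw])
  exact ⟨φ, hφ⟩

theorem isIntegral_geomAverage_of_mem {N : Type*} [Field N] [CharZero N] {q : ℕ}
    (hq : q ∈ ({3, 9, 27} : Finset ℕ)) {y : N} {k : ℤ} (hk : k ≠ 0) (hy : y ^ q = 1 + 81 * k) :
    IsIntegral ℤ (geomAverage q y) := by
  have hq0 : q ≠ 0 := by
    rintro rfl
    simp at hq
  refine isIntegral_geomAverage hq0 (fun j hj ↦ ?_) hk hy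
  fin_cases hq <;> interval_cases j <;> norm_num [Nat.choose]

theorem map_geomAverage {K N : Type*} [Field K] [Field N] (τ : K →+* N) (q : ℕ) (y : K) :
    τ (geomAverage q y) = geomAverage q (τ y) := by
  simp [geomAverage, map_sum]

theorem exists_isGalois_of_isSplittingField (f : ℚ[X]) (M : Type) [Field M] [A : Algebra ℚ M]
    [hs : IsSplittingField ℚ M f] : ∃ (N : Type) (_ : Field N) (_ : NumberField N),
    IsGalois ℚ N ∧ (f.map (algebraMap ℚ N)).Splits ∧ Algebra.adjoin ℚ (f.rootSet N) = ⊤ := by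
  have : CharZero M := algebraRat.charZero M
  obtain rfl : A = DivisionRing.toRatAlgebra := Subsingleton.elim _ _
  have := Normal.of_isSplittingField (F := ℚ) (E := M) f
  have := IsSplittingField.finiteDimensional M f
  exact ⟨M, inferInstance, { to_charZero := inferInstance, to_finiteDimensional := this }, ⟨⟩,
    hs.splits, hs.adjoin_rootSet⟩

theorem exists_isSplittingField {F : Type} [Field F] (f : F[X]) :
    ∃ (M : Type) (_ : Field M) (_ : Algebra F M), IsSplittingField F M f :=
  ⟨f.SplittingField, inferInstance, inferInstance, IsSplittingField.splittingField f⟩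

theorem exists_isGalois_splits (f : ℚ[X]) : ∃ (N : Type) (_ : Field N) (_ : NumberField N),
    IsGalois ℚ N ∧ (f.map (algebraMap ℚ N)).Splits ∧ Algebra.adjoin ℚ (f.rootSet N) = ⊤ := by
  obtain ⟨M, _, A, hs⟩ := exists_isSplittingField f
  exact exists_isGalois_of_isSplittingField f M (A := A) (hs := hs)

theorem span_three_ne_top {N : Type*} [Field N] [NumberField N] :
    Ideal.span {(3 : 𝓞 N)} ≠ ⊤ := by
  intro h
  have := congrArg Ideal.absNorm h
  rw [Ideal.absNorm_top, Ideal.absNorm_span_singleton,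
    show (3 : 𝓞 N) = algebraMap ℤ _ 3 by simp, Algebra.norm_algebraMap] at this
  simp at this
  have := Module.finrank_pos (R := ℤ) (M := 𝓞 N)
  omega

/-- If `α` generates `K` with minimal polynomial `X ^ n - (1 + 81 * k)`, where `n` is a power of `3`
divisible by `27` and `k ≠ 0`, then `𝓞 K` has four distinct ring homomorphisms to `𝔽₃`, so `K` is
not monogenic. -/
theorem not_exists_adjoin_eq_top_of_minpoly {s : ℕ} {r : ℕ} (hs : 27 * s = 3 ^ (r + 1)) {k : ℤ}
    (hk : k ≠ 0) {K : Type*} [Field K] [NumberField K] {α : K}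
    (hgen : IntermediateField.adjoin ℚ {α} = ⊤)
    (hmin : minpoly ℚ α = X ^ 3 ^ (r + 1) - C (1 + 81 * k : ℚ)) :
    ¬ ∃ θ : 𝓞 K, Algebra.adjoin ℤ {θ} = ⊤ := by
  rintro ⟨θ, hθ⟩
  set n := 3 ^ (r + 1) with hn
  have hn0 : n ≠ 0 := by positivity
  have hmQ : (1 + 81 * k : ℚ) ≠ 0 := by
    have : (1 + 81 * k : ℤ) ≠ 0 := by omega
    exact_mod_cast this
  set f : ℚ[X] := X ^ n - C (1 + 81 * k : ℚ) with hf
  have hf0 : f ≠ 0 := X_pow_sub_C_ne_zero (Nat.pos_of_ne_zero hn0) _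
  obtain ⟨N, _, _, _, hsplit, hadj⟩ := exists_isGalois_splits f
  have haeval (w : N) : aeval w f = 0 ↔ w ^ n = 1 + 81 * k := by
    simp [hf, sub_eq_zero]
  obtain ⟨a, ha⟩ : ∃ a : N, a ^ n = 1 + 81 * k := by
    obtain ⟨a, ha⟩ := hsplit.exists_eval_eq_zero (by
      rw [degree_map, hf, degree_X_pow_sub_C (Nat.pos_of_ne_zero hn0)]
      exact_mod_cast hn0)
    exact ⟨a, (haeval a).1 (by rwa [eval_map_algebraMap] at ha)⟩
  obtain ⟨ζ, hζ⟩ : ∃ ζ : N, IsPrimitiveRoot ζ n := by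
    have h1 := splits_X_pow_sub_one_of_X_pow_sub_C (algebraMap ℚ N) n hmQ hsplit
    have h2 : ((cyclotomic n ℚ).map (algebraMap ℚ N)).Splits :=
      h1.of_dvd (by simpa using X_pow_sub_C_ne_zero (Nat.pos_of_ne_zero hn0) (1 : N))
        (Polynomial.map_dvd _ (cyclotomic.dvd_X_pow_sub_one n ℚ))
    obtain ⟨ζ, hζ⟩ := h2.exists_eval_eq_zero (by
      rw [degree_map]
      exact (degree_cyclotomic_pos n ℚ (Nat.pos_of_ne_zero hn0)).ne')
    have : NeZero (n : N) := ⟨Nat.cast_ne_zero.2 hn0⟩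
    exact ⟨ζ, isRoot_cyclotomic_iff.1 (by simpa using hζ)⟩
  have hrootadj : Algebra.adjoin ℚ {y : N | y ^ n = 1 + 81 * k} = ⊤ := by
    rw [← hadj]
    congr 1
    ext y
    rw [mem_rootSet, Set.mem_ofPred_eq, haeval]
    exact ⟨fun h ↦ ⟨hf0, h⟩, fun h ↦ h.2⟩
  have hmN : (1 + 81 * k : N) ≠ 0 := by
    intro h
    rw [h] at ha
    exact hmQ ((algebraMap ℚ N).injective (by simpa using h))
  obtain ⟨Q, hQmax, hQ⟩ := Ideal.exists_le_maximal _ (span_three_ne_top (N := N))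
  have h3 : (3 : 𝓞 N) ∈ Q := hQ (Ideal.mem_span_singleton_self _)
  have hcube := pow_three_sub_self_mem hζ hmN
    (fun g ↦ by exact_mod_cast map_intCast g (1 + 81 * k)) ha hrootadj Q h3
  have h30 : (3 : 𝓞 N) ≠ 0 := by norm_num
  choose T hT using fun w : {w : N // w ^ n = 1 + 81 * k} ↦
    exists_ringHom_apply_eq hgen hmin hsplit ((haeval w).2 w.2)
  have hα : α ^ n = 1 + 81 * k := by
    have := minpoly.aeval ℚ α
    rw [hmin] at this
    simpa [hf, sub_eq_zero] using this
  have hint {q : ℕ} (hq : q ∈ ({3, 9, 27} : Finset ℕ)) {t : ℕ} (ht : t * q = n) :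
      IsIntegral ℤ (geomAverage q (α ^ t)) :=
    isIntegral_geomAverage_of_mem hq hk (by rw [← pow_mul, ht, hα])
  let e27 : 𝓞 K := ⟨_, hint (q := 27) (by simp) (t := s) (by omega)⟩
  let e9 : 𝓞 K := ⟨_, hint (q := 9) (by simp) (t := 3 * s) (by omega)⟩
  let e3 : 𝓞 K := ⟨_, hint (q := 3) (by simp) (t := 9 * s) (by omega)⟩
  have hαint : IsIntegral ℤ α := by
    refine IsIntegral.of_pow (Nat.pos_of_ne_zero hn0) ?_
    rw [hα]
    exact_mod_cast isIntegral_algebraMap (R := ℤ) (A := K) (x := 1 + 81 * k)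
  let A : 𝓞 K := ⟨α, hαint⟩
  let S (w : {w : N // w ^ n = 1 + 81 * k}) : 𝓞 K →+* 𝓞 N := RingOfIntegers.mapRingHom (T w)
  have hSA (w) : (S w A : N) = w := hT w
  have hS27 (w) : (S w e27 : N) = geomAverage 27 ((w : N) ^ s) := by
    rw [← hT w, ← map_pow, ← map_geomAverage]
    rfl
  have hS9 (w) : (S w e9 : N) = geomAverage 9 ((w : N) ^ (3 * s)) := by
    rw [← hT w, ← map_pow, ← map_geomAverage]
    rfl
  have hS3 (w) : (S w e3 : N) = geomAverage 3 ((w : N) ^ (9 * s)) := by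
    rw [← hT w, ← map_pow, ← map_geomAverage]
    rfl
  have hζmul (i : ℕ) {w : N} (hw : w ^ n = 1 + 81 * k) : (ζ ^ i * w) ^ n = 1 + 81 * k := by
    rw [mul_pow, ← pow_mul, mul_comm i, pow_mul, hζ.pow_eq_one, one_pow, one_mul, hw]
  let act (i : ℕ) (w : {w : N // w ^ n = 1 + 81 * k}) : {w : N // w ^ n = 1 + 81 * k} :=
    ⟨ζ ^ i * w, hζmul i w.2⟩
  obtain ⟨w, hw27⟩ : ∃ w, S w e27 ∉ Q := by
    by_contra! hall
    have hsum : ∑ b ∈ Finset.range 27, S (act b ⟨a, ha⟩) e27 = 1 := by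
      apply RingOfIntegers.ext
      change algebraMap (𝓞 N) N _ = algebraMap (𝓞 N) N 1
      rw [map_sum, map_one]
      refine Eq.trans ?_ (sum_geomAverage (q := 27) (by norm_num)
        (hζ.pow (Nat.pos_of_ne_zero hn0) (by rw [mul_comm] at hs; exact hs.symm)) (a ^ s))
      refine Finset.sum_congr rfl fun b _ ↦ ?_
      refine (hS27 _).trans ?_
      rw [mul_pow, ← pow_mul, ← pow_mul, mul_comm b]
    exact hQmax.ne_top (Q.eq_top_of_isUnit_mem (hsum ▸ Q.sum_mem fun b _ ↦ hall _) isUnit_one)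
  have hζint : IsIntegral ℤ ζ := hζ.isIntegral (Nat.pos_of_ne_zero hn0)
  let Z : 𝓞 N := ⟨ζ, hζint⟩
  have hSact (i : ℕ) (w) : S (act i w) A = Z ^ i * S w A :=
    RingOfIntegers.ext (by
      change (S (act i w) A : N) = ζ ^ i * (S w A : N)
      rw [hSA, hSA])
  have hω : (Z ^ (9 * s)) ^ 2 + Z ^ (9 * s) + 1 = 0 := by
    have hprim : IsPrimitiveRoot (ζ ^ (9 * s)) 3 := hζ.pow (Nat.pos_of_ne_zero hn0) (by omega)
    have := hprim.geom_sum_eq_zero (by norm_num)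
    apply RingOfIntegers.ext
    change (ζ ^ (9 * s)) ^ 2 + ζ ^ (9 * s) + 1 = 0
    rw [← this]
    simp [Finset.sum_range_succ]
    ring
  have hrel27 : e27 * (A ^ s - 1) = 3 * k := by
    apply RingOfIntegers.ext
    change geomAverage 27 (α ^ s) * (α ^ s - 1) = 3 * k
    have := geomAverage_mul_sub_one (q := 27) (by norm_num) (y := α ^ s)
    rw [← pow_mul, show s * 27 = n by omega, hα] at this
    push_cast at this
    linear_combination this / 27
  have hrel9 : e9 * (A ^ (3 * s) - 1) = 3 * (3 * k) := by
    apply RingOfIntegers.ext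
    change geomAverage 9 (α ^ (3 * s)) * (α ^ (3 * s) - 1) = 3 * (3 * k)
    have := geomAverage_mul_sub_one (q := 9) (by norm_num) (y := α ^ (3 * s))
    rw [← pow_mul, show 3 * s * 9 = n by omega, hα] at this
    push_cast at this
    linear_combination this / 9
  have hrel3 : e3 * (A ^ (9 * s) - 1) = 3 * (3 * (3 * k)) := by
    apply RingOfIntegers.ext
    change geomAverage 3 (α ^ (9 * s)) * (α ^ (9 * s) - 1) = 3 * (3 * (3 * k))
    have := geomAverage_mul_sub_one (q := 3) (by norm_num) (y := α ^ (9 * s))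
    rw [← pow_mul, show 9 * s * 3 = n by omega, hα] at this
    push_cast at this
    linear_combination this / 3
  have hmem {ε : 𝓞 K} {i t : ℕ} {l : ℤ} (hε : ε * (A ^ t - 1) = 3 * l) (hi : i * t = 9 * s)
      (hw : S w ε ∉ Q) : S (act i w) ε ∈ Q := by
    have h1 := congrArg (S w) hε
    have h2 := congrArg (S (act i w)) hε
    simp only [map_mul, map_sub, map_pow, map_one, map_ofNat, map_intCast] at h1 h2
    rw [hSact, mul_pow, ← pow_mul, hi] at h2
    exact mem_of_notMem_of_mul_sub_one h3 h30 hω h1 h2 hw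
  have hfix {i t : ℕ} (hi : n ∣ i * t) :
      ((act i w : {w : N // w ^ n = 1 + 81 * k}) : N) ^ t = (w : N) ^ t := by
    obtain ⟨c, hc⟩ := hi
    change (ζ ^ i * (w : N)) ^ t = _
    rw [mul_pow, ← pow_mul, hc, pow_mul, hζ.pow_eq_one, one_pow, one_mul]
  have hkN : (k : 𝓞 N) ≠ 0 := Int.cast_ne_zero.2 hk
  have hw9 : S w e9 ∉ Q := by
    have h1 := congrArg (S w) hrel27
    have h2 := congrArg (S w) hrel9
    simp only [map_mul, map_sub, map_pow, map_one, map_ofNat, map_intCast] at h1 h2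
    rw [mul_comm 3 s, pow_mul] at h2
    exact fun h ↦ hw27 (mem_of_mem_of_mul_cube_sub_one h30 hkN h1 h2 h)
  have hw3 : S w e3 ∉ Q := by
    have h1 := congrArg (S w) hrel9
    have h2 := congrArg (S w) hrel3
    simp only [map_mul, map_sub, map_pow, map_one, map_ofNat, map_intCast] at h1 h2
    rw [show 9 * s = 3 * s * 3 by ring, pow_mul] at h2
    exact fun h ↦ hw9 (mem_of_mem_of_mul_cube_sub_one h30 (mul_ne_zero h30 hkN) h1 h2 h)
  let π := Ideal.Quotient.mk Q
  let ψ (w) : 𝓞 K →+* 𝓞 N ⧸ Q := π.comp (S w)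
  have hψ0 {v} {ε : 𝓞 K} : ψ v ε = 0 ↔ S v ε ∈ Q := Ideal.Quotient.eq_zero_iff_mem
  have hval (v) : ψ v θ = 0 ∨ ψ v θ = 1 ∨ ψ v θ = -1 := by
    have : ψ v θ * (ψ v θ - 1) * (ψ v θ + 1) = 0 := by
      have : ψ v θ ^ 3 = ψ v θ := Ideal.Quotient.eq.2 (hcube (S v θ))
      linear_combination this
    simpa [mul_eq_zero, sub_eq_zero, add_eq_zero_iff_eq_neg, or_assoc] using this
  have hext {u v} (h : ψ u θ = ψ v θ) (ε : 𝓞 K) : S u ε ∈ Q ↔ S v ε ∈ Q := by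
    have hz : (ψ u).toIntAlgHom = (ψ v).toIntAlgHom :=
      AlgHom.ext_of_adjoin_eq_top hθ (by rintro _ rfl; exact h)
    rw [← hψ0, ← hψ0, show ψ u ε = ψ v ε from DFunLike.congr_fun hz ε]
  have hfix9 : S (act 9 w) e9 = S w e9 :=
    RingOfIntegers.ext (by rw [hS9, hS9, hfix ⟨1, by omega⟩])
  have hfix93 : S (act 9 w) e3 = S w e3 :=
    RingOfIntegers.ext (by rw [hS3, hS3, hfix ⟨3, by omega⟩])
  have hfix33 : S (act 3 w) e3 = S w e3 :=
    RingOfIntegers.ext (by rw [hS3, hS3, hfix ⟨1, by omega⟩])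
  have h27 : S (act 9 w) e27 ∈ Q := hmem hrel27 (by ring) hw27
  have h9 : S (act 3 w) e9 ∈ Q :=
    hmem (l := 3 * k) (by push_cast; exact hrel9) (by ring) hw9
  have h3' : S (act 1 w) e3 ∈ Q :=
    hmem (l := 3 * (3 * k)) (by push_cast; exact hrel3) (by ring) hw3
  have n01 : ψ w θ ≠ ψ (act 9 w) θ := fun h ↦ hw27 ((hext h e27).2 h27)
  have n02 : ψ w θ ≠ ψ (act 3 w) θ := fun h ↦ hw9 ((hext h e9).2 h9)
  have n03 : ψ w θ ≠ ψ (act 1 w) θ := fun h ↦ hw3 ((hext h e3).2 h3')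
  have n12 : ψ (act 9 w) θ ≠ ψ (act 3 w) θ := fun h ↦ hw9 (hfix9 ▸ (hext h e9).2 h9)
  have n13 : ψ (act 9 w) θ ≠ ψ (act 1 w) θ := fun h ↦ hw3 (hfix93 ▸ (hext h e3).2 h3')
  have n23 : ψ (act 3 w) θ ≠ ψ (act 1 w) θ := fun h ↦ hw3 (hfix33 ▸ (hext h e3).2 h3')
  have v0 := hval w
  have v1 := hval (act 9 w)
  have v2 := hval (act 3 w)
  have v3 := hval (act 1 w)
  generalize ψ w θ = x0 at *
  generalize ψ (act 9 w) θ = x1 at *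
  generalize ψ (act 3 w) θ = x2 at *
  generalize ψ (act 1 w) θ = x3 at *
  clear_value π ψ
  rcases v0 with rfl | rfl | rfl <;> rcases v1 with rfl | rfl | rfl <;>
    rcases v2 with rfl | rfl | rfl <;> rcases v3 with rfl | rfl | rfl <;>
    first | exact n01 rfl | exact n02 rfl | exact n03 rfl | exact n12 rfl | exact n13 rfl |
      exact n23 rfl

/-- If `r ≥ 3` and `m ≠ 1` is squarefree with `m ≡ ±1 (mod 81)` and `x^(3^r) - m`
is irreducible over `ℚ`, then `K = ℚ(α)` is not monogenic, where `α` is a root. -/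
theorem pure_three_power_field_not_monogenic
    (r : ℕ) (hr : 3 ≤ r) (m : ℤ) (hm : Squarefree m) (hm1 : m ≠ 1)
    (hmod : m ≡ 1 [ZMOD 81] ∨ m ≡ -1 [ZMOD 81])
    (hF : Irreducible ((X : ℚ[X]) ^ 3 ^ r - C (m : ℚ)))
    (K : Type*) [Field K] [NumberField K] (α : K)
    (hgen : IntermediateField.adjoin ℚ {α} = ⊤)
    (hroot : α ^ 3 ^ r = (m : K)) :
    ¬ ∃ θ : 𝓞 K, Algebra.adjoin ℤ {θ} = ⊤ := by
  obtain ⟨t, rfl⟩ := Nat.exists_eq_add_of_le' hr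
  have hn : 3 ^ (t + 3) ≠ 0 := by positivity
  have hodd : Odd (3 ^ (t + 3)) := Odd.pow (by decide)
  have hs : 27 * 3 ^ t = 3 ^ (t + 2 + 1) := by ring
  have hmin : minpoly ℚ α = X ^ 3 ^ (t + 3) - C (m : ℚ) :=
    (minpoly.eq_of_irreducible_of_monic hF (by simp [hroot]) (monic_X_pow_sub_C _ hn)).symm
  rcases hmod with h | h
  · obtain ⟨k, hk⟩ := h.symm.dvd
    obtain rfl : m = 1 + 81 * k := by omega
    exact not_exists_adjoin_eq_top_of_minpoly hs (k := k) (by omega) hgen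
      (by rw [hmin]; push_cast; rfl)
  · obtain ⟨k, hk⟩ := h.symm.dvd
    obtain rfl : m = -1 + 81 * k := by omega
    have hk0 : k ≠ 0 := by
      rintro rfl
      have hdvd : (X - C (-1) : ℚ[X]) ∣ X ^ 3 ^ (t + 3) - C ((-1 + 81 * 0 : ℤ) : ℚ) := by
        rw [dvd_iff_isRoot]
        simp [hodd.neg_one_pow]
      have hdeg := degree_eq_degree_of_associated
        ((irreducible_X_sub_C _).associated_of_dvd hF hdvd)
      rw [degree_X_sub_C, degree_X_pow_sub_C (Nat.pos_of_ne_zero hn)] at hdeg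
      have : 1 = 3 ^ (t + 3) := by exact_mod_cast hdeg
      have : 1 < 3 ^ (t + 3) := Nat.one_lt_pow (by omega) (by norm_num)
      omega
    refine not_exists_adjoin_eq_top_of_minpoly hs (k := -k) (neg_ne_zero.2 hk0) (α := -α) ?_ ?_
    · rw [eq_top_iff, ← hgen, IntermediateField.adjoin_simple_le_iff]
      simpa using neg_mem (IntermediateField.mem_adjoin_simple_self ℚ (-α))
    · rw [minpoly.neg, hmin, natDegree_X_pow_sub_C, hodd.neg_one_pow]
      simp only [sub_comp, pow_comp, X_comp, C_comp, hodd.neg_pow]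
      simp
      ring
end

section
/- Let m ≠ 1 be a squarefree rational integer with m ≡ 1 (mod 16), such that F(x) = x^4 − m is irreducible over ℚ. Let α be a complex root of F and K = ℚ(α) be the corresponding pure quartic field. Then K is not monogenic. -/
open Polynomial NumberField

/-- An element of a commutative ring of characteristic two satisfying a monic cubic relation
generates a subring with at most eight elements. -/
lemma card_le_of_adjoin_eq_top_of_cubic {A : Type*} [CommRing A] (h2 : (2 : A) = 0) {t : A}
    (ht : Algebra.adjoin ℤ {t} = ⊤) {p q r : ℤ} (hcubic : t ^ 3 = p + q * t + r * t ^ 2) :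
    Nat.card A ≤ 8 := by
  have hspan : ∀ x : A, ∃ u v w : ℤ, x = u + v * t + w * t ^ 2 := by
    intro x
    have hx : x ∈ Algebra.adjoin ℤ {t} := ht ▸ Algebra.mem_top
    induction hx using Algebra.adjoin_induction with
    | mem x hx => exact ⟨0, 1, 0, by simp [Set.mem_singleton_iff.mp hx]⟩
    | algebraMap z => exact ⟨z, 0, 0, by simp⟩
    | add x y _ _ hx hy =>
      obtain ⟨u, v, w, rfl⟩ := hx
      obtain ⟨u', v', w', rfl⟩ := hy
      exact ⟨u + u', v + v', w + w', by push_cast; ring⟩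
    | mul x y _ _ hx hy =>
      obtain ⟨u, v, w, rfl⟩ := hx
      obtain ⟨u', v', w', rfl⟩ := hy
      refine ⟨u * u' + (v * w' + w * v') * p + w * w' * r * p,
        u * v' + v * u' + (v * w' + w * v') * q + w * w' * (p + r * q),
        u * w' + v * v' + w * u' + (v * w' + w * v') * r + w * w' * (q + r * r), ?_⟩
      push_cast
      linear_combination ((v * w' + w * v' : A) + w * w' * t + w * w' * r) * hcubic
  have hbit : ∀ z : ℤ, ∃ i : Fin 2, (z : A) = (i : ℕ) := by
    intro z
    obtain ⟨c, hc⟩ := Int.even_or_odd' z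
    rcases hc with rfl | rfl
    · exact ⟨0, by simp [h2]⟩
    · exact ⟨1, by simp [h2]⟩
  let f : Fin 2 × Fin 2 × Fin 2 → A := fun i ↦
    ((i.1 : ℕ) : A) + (i.2.1 : ℕ) * t + (i.2.2 : ℕ) * t ^ 2
  have hf : Function.Surjective f := by
    intro x
    obtain ⟨u, v, w, rfl⟩ := hspan x
    obtain ⟨i, hi⟩ := hbit u
    obtain ⟨j, hj⟩ := hbit v
    obtain ⟨k, hk⟩ := hbit w
    exact ⟨(i, j, k), by simp only [f, hi, hj, hk]⟩
  simpa using Nat.card_le_card_of_surjective f hf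

lemma adjoin_singleton_map_eq_top {R S : Type*} [Ring R] [Ring S] [Algebra ℤ R] [Algebra ℤ S]
    {f : R →+* S} (hf : Function.Surjective f) {x : R} (hx : Algebra.adjoin ℤ {x} = ⊤) :
    Algebra.adjoin ℤ {f x} = ⊤ := by
  let F : R →ₐ[ℤ] S := { f with commutes' := fun z ↦ by simp }
  have h := AlgHom.map_adjoin F {x}
  rw [hx, Algebra.map_top, Set.image_singleton, (AlgHom.range_eq_top F).mpr hf] at h
  exact h.symm

/-- A ring with sixteen elements isomorphic to `𝔽₂ × 𝔽₂ × 𝔽₂[ε]` is not generated by a single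
element. -/
lemma adjoin_singleton_ne_top_of_card_eq_sixteen {A : Type*} [CommRing A] (h2 : (2 : A) = 0)
    (hcard : Nat.card A = 16) {g b n : A} (hg : g ^ 2 = g) (hb : b ^ 2 = b) (hgb : g * b = g)
    (hn : n ^ 2 = 0) (hnb : n * b = 0) (hg0 : g ≠ 0) (hbg0 : b - g ≠ 0) (hn0 : n ≠ 0) (t : A) :
    Algebra.adjoin ℤ {t} ≠ ⊤ := by
  intro ht
  have hng : n * g = 0 := by linear_combination (-n) * hgb + g * hnb
  let f : Fin 2 × Fin 2 × Fin 2 × Fin 2 → A := fun i ↦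
    ((i.1 : ℕ) : A) * g + (i.2.1 : ℕ) * (b - g) + (i.2.2.1 : ℕ) * (1 - b) + (i.2.2.2 : ℕ) * n
  have hbit : ∀ (i j : Fin 2) (x : A), x ≠ 0 → ((i : ℕ) : A) * x = (j : ℕ) * x → i = j := by
    intro i j x hx h
    fin_cases i <;> fin_cases j <;> simp_all [hx.symm]
  have hf : Function.Injective f := by
    rintro ⟨i, j, k, l⟩ ⟨i', j', k', l'⟩ h
    simp only [f] at h
    obtain rfl : i = i' := hbit _ _ g hg0 (by
      linear_combination g * h - (i - i' - j + j' : A) * hg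
        - (j - j' - k + k' : A) * hgb - (l - l' : A) * hng)
    obtain rfl : j = j' := hbit _ _ (b - g) hbg0 (by
      linear_combination (b - g) * h - (j - j' : A) * (hg + hb - 2 * hgb)
        - (k - k' : A) * (hgb - hb) - (l - l' : A) * (hnb - hng))
    obtain rfl : k = k' := hbit _ _ n hn0 (by
      linear_combination n * h + (k - k' : A) * hnb - (l - l' : A) * hn)
    obtain rfl : l = l' := hbit _ _ n hn0 (by linear_combination h)
    rfl
  have : Finite A := Nat.finite_of_card_ne_zero (by omega)
  have hsurj : Function.Surjective f :=
    ((Nat.bijective_iff_injective_and_card f).mpr ⟨hf, by simp [hcard]⟩).2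
  obtain ⟨⟨i, j, k, l⟩, rfl⟩ := hsurj t
  have hle : Nat.card A ≤ 8 := by
    have hrel : ∀ i : Fin 2, ((i : ℕ) : A) ^ 2 = (i : ℕ) := by
      intro i
      fin_cases i <;> simp
    have hi := hrel i
    have hj := hrel j
    have hl := hrel l
    simp only [f] at ht
    generalize ((i : ℕ) : A) = x at *
    generalize ((j : ℕ) : A) = y at *
    generalize ((l : ℕ) : A) = z at *
    fin_cases k
    · refine card_le_of_adjoin_eq_top_of_cubic h2 ht (p := 0) (q := 0) (r := 1) ?_
      have hsq : (x * g + y * (b - g) + z * n) ^ 2 = x * g + y * (b - g) := by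
        linear_combination x ^ 2 * hg + g * hi + y ^ 2 * (hg + hb - 2 * hgb) + (b - g) * hj
          + z ^ 2 * hn + 2 * x * y * (hgb - hg) + 2 * x * z * hng + 2 * y * z * (hnb - hng)
      have hmul : (x * g + y * (b - g) + z * n) * (x * g + y * (b - g)) =
          x * g + y * (b - g) := by
        linear_combination x ^ 2 * hg + g * hi + y ^ 2 * (hg + hb - 2 * hgb) + (b - g) * hj
          + 2 * x * y * (hgb - hg) + x * z * hng + y * z * (hnb - hng)
      simp only [Nat.cast_zero, zero_mul, add_zero, Int.cast_zero, Int.cast_one, one_mul,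
        zero_add]
      linear_combination (x * g + y * (b - g) + z * n - 1) * hsq + hmul
    · refine card_le_of_adjoin_eq_top_of_cubic h2 ht (p := 0) (q := -1) (r := 2) ?_
      have hsq : (x * g + y * (b - g) + (1 - b) + z * n - 1) ^ 2 =
          b - x * g - y * (b - g) := by
        linear_combination x ^ 2 * hg + g * hi + y ^ 2 * (hg + hb - 2 * hgb) + (b - g) * hj
          + z ^ 2 * hn + 2 * x * y * (hgb - hg) + 2 * x * z * hng + 2 * y * z * (hnb - hng)
          + hb - 2 * x * hgb - 2 * y * (hb - hgb) - 2 * z * hnb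
      have hmul : (x * g + y * (b - g) + (1 - b) + z * n) * (b - x * g - y * (b - g)) = 0 := by
        linear_combination -(x ^ 2 * hg + g * hi + y ^ 2 * (hg + hb - 2 * hgb) + (b - g) * hj
          + 2 * x * y * (hgb - hg) + x * z * hng + y * z * (hnb - hng))
          - hb + 2 * x * hgb + 2 * y * (hb - hgb) + z * hnb
      simp only [Nat.cast_one, one_mul, Int.cast_zero, Int.cast_neg, Int.cast_one,
        Int.cast_ofNat]
      linear_combination (x * g + y * (b - g) + (1 - b) + z * n) * hsq + hmul
  omega

/-- The power basis of a number field generated by a root of an irreducible binomial of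
degree four. -/
lemma exists_basis_pow_of_irreducible_quartic {K : Type*} [Field K] [NumberField K] {m : ℤ}
    (hF : Irreducible ((X : ℚ[X]) ^ 4 - C (m : ℚ))) {α : K}
    (hgen : IntermediateField.adjoin ℚ {α} = ⊤) (hroot : α ^ 4 = (m : K)) :
    ∃ b : Module.Basis (Fin 4) ℚ K, ∀ i, b i = α ^ (i : ℕ) := by
  have hmin : minpoly ℚ α = X ^ 4 - C (m : ℚ) :=
    (minpoly.eq_of_irreducible_of_monic hF (by simp [hroot])
      (monic_X_pow_sub_C _ (by norm_num))).symm
  have hint : IsIntegral ℚ α := Algebra.IsIntegral.isIntegral α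
  have hadj : Algebra.adjoin ℚ {α} = ⊤ := by
    rw [← IntermediateField.adjoin_simple_toSubalgebra_of_isAlgebraic hint.isAlgebraic, hgen,
      IntermediateField.top_toSubalgebra]
  let pb := PowerBasis.ofAdjoinEqTop' hint hadj
  have hpbgen : pb.gen = α := PowerBasis.ofAdjoinEqTop'_gen hint hadj
  have hdim : pb.dim = 4 := by
    rw [← pb.natDegree_minpoly, hpbgen, hmin, natDegree_X_pow_sub_C]
  exact ⟨pb.basis.reindex (finCongr hdim), fun i ↦ by simp [hpbgen]⟩

lemma trace_pow_eq_zero_of_basis_pow {K : Type*} [Field K] [NumberField K] {m : ℤ} {α : K}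
    (hroot : α ^ 4 = (m : K)) (b : Module.Basis (Fin 4) ℚ K) (hb : ∀ i, b i = α ^ (i : ℕ))
    {k : ℕ} (hk0 : 0 < k) (hk : k < 4) : Algebra.trace ℚ K (α ^ k) = 0 := by
  rw [Algebra.trace_eq_matrix_trace b, Matrix.trace]
  refine Finset.sum_eq_zero fun i _ ↦ ?_
  rw [Matrix.diag_apply, Algebra.leftMulMatrix_eq_repr_mul, hb, ← pow_add]
  by_cases h : k + i < 4
  · have : α ^ (k + i : ℕ) = b ⟨k + i, h⟩ := (hb ⟨k + i, h⟩).symm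
    rw [this, b.repr_self, Finsupp.single_eq_of_ne]
    intro h'
    have := congrArg Fin.val h'
    simp only at this
    omega
  · have hi := i.2
    have : α ^ (k + i : ℕ) = (m : ℚ) • b ⟨k + i - 4, by omega⟩ := by
      rw [hb, Algebra.smul_def]
      simp only [map_intCast]
      rw [← hroot, ← pow_add]
      congr 1
      omega
    rw [this, map_smul, b.repr_self, Finsupp.smul_apply, Finsupp.single_eq_of_ne, smul_zero]
    intro h'
    have := congrArg Fin.val h'
    simp only at this
    omega

lemma not_two_dvd_of_trace_eq_one {K : Type*} [Field K] [NumberField K] {x : 𝓞 K}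
    (hx : Algebra.trace ℚ K (algebraMap (𝓞 K) K x) = 1) : ¬ 2 ∣ x := by
  rintro ⟨y, rfl⟩
  have h : Algebra.trace ℤ (𝓞 K) (2 * y) = 1 := by
    exact_mod_cast (Algebra.coe_trace_int (2 * y)).trans hx
  rw [two_mul, map_add] at h
  omega

lemma card_quotient_span_two {K : Type*} [Field K] [NumberField K] :
    Nat.card (𝓞 K ⧸ Ideal.span {(2 : 𝓞 K)}) = 2 ^ Module.finrank ℚ K := by
  rw [← Submodule.cardQuot_apply, ← Ideal.absNorm_apply, Ideal.absNorm_span_singleton]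
  have : (2 : 𝓞 K) = algebraMap ℤ (𝓞 K) 2 := by simp
  rw [this, Algebra.norm_algebraMap, RingOfIntegers.rank, Int.natAbs_pow]
  rfl

lemma isIntegral_of_isIntegral_sq_sub_self {K : Type*} [Field K] {x : K}
    (h : IsIntegral ℤ (x ^ 2 - x)) : IsIntegral ℤ x := by
  have hdeg : (X : ℤ[X]).degree < ((2 : ℕ) : WithBot ℕ) := by
    rw [degree_X]
    norm_num
  refine IsIntegral.of_aeval_monic (p := (X ^ 2 - X : ℤ[X])) (monic_X_pow_sub hdeg) ?_
    (by simpa using h)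
  rw [natDegree_sub_eq_left_of_natDegree_lt] <;> simp

/-- If `m ≠ 1` is squarefree with `m ≡ 1 (mod 16)` and `x^4 - m` is irreducible
over `ℚ`, then the pure quartic field `K = ℚ(α)` is not monogenic. -/
theorem pure_quartic_field_not_monogenic
    (m : ℤ) (hm : Squarefree m) (hm1 : m ≠ 1)
    (hmod : m ≡ 1 [ZMOD 16])
    (hF : Irreducible ((X : ℚ[X]) ^ 4 - C (m : ℚ)))
    (K : Type*) [Field K] [NumberField K] (α : K)
    (hgen : IntermediateField.adjoin ℚ {α} = ⊤)
    (hroot : α ^ 4 = (m : K)) :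
    ¬ ∃ θ : 𝓞 K, Algebra.adjoin ℤ {θ} = ⊤ := by
  rintro ⟨θ, hθ⟩
  obtain ⟨k, hk⟩ := hmod.symm.dvd
  obtain rfl : m = 1 + 16 * k := by omega
  obtain ⟨B, hB⟩ := exists_basis_pow_of_irreducible_quartic hF hgen hroot
  have htr {j : ℕ} (hj0 : 0 < j) (hj : j < 4) : Algebra.trace ℚ K (α ^ j) = 0 :=
    trace_pow_eq_zero_of_basis_pow hroot B hB hj0 hj
  have hrank : Module.finrank ℚ K = 4 := by simp [Module.finrank_eq_card_basis B]
  have htr_one : Algebra.trace ℚ K 1 = 4 := by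
    simpa [hrank] using Algebra.trace_algebraMap (S := K) (1 : ℚ)
  have htr1 : Algebra.trace ℚ K α = 0 := by simpa using htr (j := 1) (by norm_num) (by norm_num)
  have htr2 := htr (j := 2) (by norm_num) (by norm_num)
  have htr3 := htr (j := 3) (by norm_num) (by norm_num)
  have trace_eq {x y : K} {c : ℚ} (hxy : 4 * x = y) (hy : Algebra.trace ℚ K y = c) :
      Algebra.trace ℚ K x = c / 4 := by
    have h4 : (4 : ℚ) • x = y := by rw [← hxy, Algebra.smul_def]; simp
    rw [← h4, map_smul, smul_eq_mul] at hy
    linarith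
  push_cast at hroot
  have hαint : IsIntegral ℤ α := by
    refine IsIntegral.of_pow (n := 4) (by norm_num) ?_
    rw [hroot]
    simpa using isIntegral_algebraMap (R := ℤ) (A := K) (x := 1 + 16 * k)
  have hβint : IsIntegral ℤ ((1 + α ^ 2) / 2) := by
    refine isIntegral_of_isIntegral_sq_sub_self ?_
    have : ((1 + α ^ 2) / 2) ^ 2 - (1 + α ^ 2) / 2 = algebraMap ℤ K (4 * k) := by
      simp only [eq_intCast]
      push_cast
      linear_combination hroot / 4
    rw [this]
    exact isIntegral_algebraMap
  obtain ⟨a, ha⟩ : ∃ a : 𝓞 K, algebraMap (𝓞 K) K a = α := ⟨⟨α, hαint⟩, rfl⟩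
  obtain ⟨b, hb⟩ : ∃ b : 𝓞 K, algebraMap (𝓞 K) K b = (1 + α ^ 2) / 2 := ⟨⟨_, hβint⟩, rfl⟩
  have hγint : IsIntegral ℤ ((1 + α + α ^ 2 + α ^ 3) / 4) := by
    refine isIntegral_of_isIntegral_sq_sub_self ?_
    have : ((1 + α + α ^ 2 + α ^ 3) / 4) ^ 2 - (1 + α + α ^ 2 + α ^ 3) / 4 =
        algebraMap (𝓞 K) K (2 * k + 2 * k * b + 2 * k * a) := by
      simp only [map_mul, map_add, map_ofNat, map_intCast, ha, hb]
      linear_combination ((α + 1) ^ 2 / 16 + 1 / 8) * hroot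
    rw [this]
    exact RingOfIntegers.isIntegral_coe _
  obtain ⟨g, hg⟩ : ∃ g : 𝓞 K, algebraMap (𝓞 K) K g = (1 + α + α ^ 2 + α ^ 3) / 4 := ⟨⟨_, hγint⟩, rfl⟩
  have ha2 : a ^ 2 = 2 * b - 1 := by
    apply RingOfIntegers.coe_injective
    simp only [map_pow, map_mul, map_sub, map_one, map_ofNat, ha, hb]
    ring
  have hb2 : b ^ 2 = b + 2 * (2 * k) := by
    apply RingOfIntegers.coe_injective
    simp only [map_pow, map_mul, map_add, map_ofNat, map_intCast, hb]
    linear_combination hroot / 4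
  have hab : (1 + a) * b = 2 * g := by
    apply RingOfIntegers.coe_injective
    simp only [map_mul, map_add, map_one, map_ofNat, ha, hb, hg]
    ring
  have hg2 : g ^ 2 = g + 2 * (k + k * b + k * a) := by
    apply RingOfIntegers.coe_injective
    simp only [map_pow, map_mul, map_add, map_ofNat, map_intCast, ha, hb, hg]
    linear_combination ((α + 1) ^ 2 / 16 + 1 / 8) * hroot
  have hgb : g * b = g + 2 * (k * (1 + a)) := by
    apply RingOfIntegers.coe_injective
    simp only [map_mul, map_add, map_one, map_ofNat, map_intCast, ha, hb, hg]
    linear_combination ((α + 1) / 8) * hroot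
  have hg0 : ¬ 2 ∣ g := by
    refine not_two_dvd_of_trace_eq_one ?_
    rw [trace_eq (y := 1 + α + α ^ 2 + α ^ 3) (c := 4) (by rw [hg]; ring)
      (by simp only [map_add, htr_one, htr1, htr2, htr3]; norm_num)]
    norm_num
  have hbg0 : ¬ 2 ∣ b - g := by
    refine not_two_dvd_of_trace_eq_one ?_
    rw [trace_eq (y := 1 - α + α ^ 2 - α ^ 3) (c := 4) (by rw [map_sub, hb, hg]; ring)
      (by simp only [map_add, map_sub, htr_one, htr1, htr2, htr3]; norm_num)]
    norm_num
  have hn0 : ¬ 2 ∣ (1 + a) * (1 - b) := by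
    rintro ⟨y, hy⟩
    have hw4 : (4 * ((g + y) * (1 - (g + y))) : 𝓞 K) = 1 - a ^ 2 := by
      have hδ : 2 * (g + y) = 1 + a := by linear_combination -hab - hy
      linear_combination (1 - 2 * (g + y) - a) * hδ
    generalize (g + y) * (1 - (g + y)) = w at hw4
    refine not_two_dvd_of_trace_eq_one (x := w) ?_ ⟨w ^ 2 - k, ?_⟩
    · rw [trace_eq (x := algebraMap (𝓞 K) K w) (y := 1 - α ^ 2) (c := 4)
        (by simpa only [map_mul, map_sub, map_pow, map_one, map_ofNat, ha] using
          congrArg (algebraMap (𝓞 K) K) hw4)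
        (by simp only [map_sub, htr_one, htr2]; norm_num)]
      norm_num
    · have h8 : (8 : 𝓞 K) ≠ 0 := by norm_num
      refine mul_left_cancel₀ h8 ?_
      linear_combination (-(4 * w) + 1 + a ^ 2) * hw4 - (a ^ 2 + 2 * b - 1) * ha2 - 4 * hb2
  let I : Ideal (𝓞 K) := Ideal.span {2}
  let π := Ideal.Quotient.mk I
  have hπ (x : 𝓞 K) : π x = 0 ↔ 2 ∣ x :=
    Ideal.Quotient.eq_zero_iff_mem.trans Ideal.mem_span_singleton
  have hπeq {x y : 𝓞 K} (z : 𝓞 K) (h : x = y + 2 * z) : π x = π y := by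
    rw [← sub_eq_zero, ← map_sub, hπ]
    exact ⟨z, by linear_combination h⟩
  have hπ2 : (2 : 𝓞 K ⧸ I) = 0 := by
    simpa only [map_ofNat] using (hπ 2).mpr dvd_rfl
  refine adjoin_singleton_ne_top_of_card_eq_sixteen hπ2
    (by rw [card_quotient_span_two, hrank]; norm_num)
    (g := π g) (b := π b) (n := π ((1 + a) * (1 - b)))
    (by simpa only [map_pow] using hπeq _ hg2) (by simpa only [map_pow] using hπeq _ hb2)
    (by simpa only [map_mul] using hπeq _ hgb) ?_ ?_ (by rwa [Ne, hπ])
    (by rwa [← map_sub, Ne, hπ]) (by rwa [Ne, hπ]) (π θ)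
    (adjoin_singleton_map_eq_top Ideal.Quotient.mk_surjective hθ)
  · rw [← map_pow, hπ]
    exact ⟨(a + b) * (1 - b) ^ 2, by linear_combination (1 - b) ^ 2 * ha2⟩
  · rw [← map_mul, hπ]
    exact ⟨-((1 + a) * (2 * k)), by linear_combination (-(1 + a)) * hb2⟩
end

section
/- Let r ≥ 3 be an integer and m ≠ 1 a squarefree rational integer with m ≡ 1 (mod 32), such that F(x) = x^(2^r) − m is irreducible over ℚ. Let α be a complex root of F and K = ℚ(α). Then K is not monogenic. -/
open Polynomial NumberField

/-- In `ℤ_[2]`, every element congruent to `1` modulo `8` is a square, with control on the root. -/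
lemma PadicInt.exists_one_add_eight_mul_eq_sq (c : ℤ_[2]) :
    ∃ v : ℤ_[2], 1 + 8 * c = (1 + 4 * (c * v)) ^ 2 := by
  have h2 : ‖(2 : ℤ_[2])‖ < 1 := by
    simpa using PadicInt.norm_p (p := 2) |>.trans_lt (by norm_num)
  have hsmall (x : ℤ_[2]) : ‖2 * x‖ < 1 := by
    rw [norm_mul]
    exact mul_lt_one_of_nonneg_of_lt_one_left (norm_nonneg _) h2 (PadicInt.norm_le_one _)
  have hunit : ‖1 + 2 * (2 * c)‖ = 1 := by
    rw [IsUltrametricDist.norm_add_eq_max_of_norm_ne_norm] <;> simp only [norm_one]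
    · exact max_eq_left (hsmall _).le
    · exact (hsmall _).ne'
  obtain ⟨v, hv, -⟩ := hensels_lemma (R := ℤ_[2]) (p := 2)
    (F := C (2 * c) * X ^ 2 + X - 1) (a := 1) (by
      have h : ‖2 * c * 2 + 1‖ = 1 := by rw [← hunit]; ring_nf
      simpa [one_add_one_eq_two, h] using hsmall c)
  refine ⟨v, ?_⟩
  have hv' : 2 * c * v ^ 2 + v - 1 = 0 := by simpa using hv
  linear_combination -8 * c * hv'

/-- An integer congruent to `1` modulo `32` is the eighth power of a `2`-adic integer congruent
to `1` modulo `4`. -/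
lemma PadicInt.exists_pow_eight_eq_intCast {m : ℤ} (hm : m ≡ 1 [ZMOD 32]) :
    ∃ d : ℤ_[2], (1 + 4 * d) ^ 8 = (m : ℤ_[2]) := by
  obtain ⟨k, hk⟩ := hm.symm.dvd
  obtain ⟨v₁, h₁⟩ := exists_one_add_eight_mul_eq_sq (4 * (k : ℤ_[2]))
  obtain ⟨v₂, h₂⟩ := exists_one_add_eight_mul_eq_sq (2 * (k * v₁))
  obtain ⟨v₃, h₃⟩ := exists_one_add_eight_mul_eq_sq (k * v₁ * v₂)
  have hm' : (m : ℤ_[2]) = 1 + 8 * (4 * k) := by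
    rw [show m = 1 + 32 * k by linarith]; push_cast; ring
  refine ⟨k * v₁ * v₂ * v₃, ?_⟩
  rw [hm', h₁, show 1 + 4 * (4 * (k : ℤ_[2]) * v₁) = 1 + 8 * (2 * (k * v₁)) by ring, h₂,
    show 1 + 4 * (2 * ((k : ℤ_[2]) * v₁) * v₂) = 1 + 8 * (k * v₁ * v₂) by ring, h₃]
  ring

lemma degree_C_lt_degree_X_add_one_pow {R : Type*} [CommRing R] [IsDomain R] (n : ℕ) (w : R) :
    (C w).degree < ((X + 1 : R[X]) ^ 2 ^ n).degree := by
  rw [← C_1, degree_pow, degree_X_add_C]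
  exact degree_C_le.trans_lt (by simp)

lemma monic_X_add_one_pow_add_C {R : Type*} [CommRing R] [IsDomain R] (n : ℕ) (w : R) :
    ((X + 1 : R[X]) ^ 2 ^ n + C w).Monic :=
  Monic.add_of_left ((monic_X_add_C (1 : R)).pow _) (degree_C_lt_degree_X_add_one_pow n w)

lemma natDegree_X_add_one_pow_add_C {R : Type*} [CommRing R] [IsDomain R] (n : ℕ) (w : R) :
    ((X + 1 : R[X]) ^ 2 ^ n + C w).natDegree = 2 ^ n := by
  rw [natDegree_add_eq_left_of_degree_lt (degree_C_lt_degree_X_add_one_pow n w), ← C_1,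
    natDegree_pow, natDegree_X_add_C, mul_one]

/-- The polynomial `(X + 1) ^ 2 ^ n + w` over `ℤ_[2]` is Eisenstein at `2` if `w ≡ 1 mod 4`. -/
lemma isEisensteinAt_X_add_one_pow_add (n : ℕ) (d : ℤ_[2]) :
    ((X + 1 : ℤ_[2][X]) ^ 2 ^ n + C (1 + 4 * d)).IsEisensteinAt (Ideal.span {2}) := by
  have hprime : Prime (2 : ℤ_[2]) := by simpa using PadicInt.prime_p (p := 2)
  have hdeg := natDegree_X_add_one_pow_add_C n (1 + 4 * d)
  refine (monic_X_add_one_pow_add_C n _).isEisensteinAt_of_mem_of_notMem ?_ (fun {i} hi ↦ ?_) ?_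
  · rw [Ne, Ideal.span_singleton_eq_top]
    exact hprime.not_isUnit
  · have hker : Ideal.span {(2 : ℤ_[2])} = RingHom.ker (PadicInt.toZMod (p := 2)) := by
      rw [PadicInt.ker_toZMod, PadicInt.maximalIdeal_eq_span_p, Nat.cast_ofNat]
    have h4 : (4 : ZMod 2) = 0 := rfl
    have hmap : ((X + 1 : ℤ_[2][X]) ^ 2 ^ n + C (1 + 4 * d)).map PadicInt.toZMod = X ^ 2 ^ n := by
      have hC : PadicInt.toZMod (1 + 4 * d) = 1 := by
        simp only [map_add, map_one, map_mul, map_ofNat, h4, zero_mul, add_zero]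
      rw [Polynomial.map_add, map_C, hC, Polynomial.map_pow, Polynomial.map_add, map_X,
        Polynomial.map_one, add_pow_char_pow, one_pow, add_assoc, C_1, CharTwo.add_self_eq_zero,
        add_zero]
    rw [hker, RingHom.mem_ker, ← coeff_map, hmap, coeff_X_pow, if_neg (by omega)]
  · rw [Ideal.span_singleton_pow, Ideal.mem_span_singleton]
    rintro ⟨q, hq⟩
    simp only [coeff_zero_eq_eval_zero, eval_add, eval_pow, eval_X, eval_one, zero_add, one_pow,
      eval_C] at hq
    have h : (2 : ℤ_[2]) * (1 + 2 * d - 2 * q) = 2 * 0 := by linear_combination hq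
    have h' := mul_left_cancel₀ hprime.ne_zero h
    exact hprime.not_isUnit (IsUnit.of_mul_eq_one (q - d) (by linear_combination -h'))

/-- If the minimal polynomial over `ℤ_[2]` of a generator `x` of an extension `L` of `ℚ_[2]` is
Eisenstein at `2`, then `ℤ_[2][x]` contains every element of `L` integral over `ℤ_[2]`. -/
lemma mem_adjoin_of_isIntegral_of_minpoly_isEisensteinAt {L : Type*} [Field L] [Algebra ℚ_[2] L]
    [Algebra ℤ_[2] L] [IsScalarTower ℤ_[2] ℚ_[2] L] (B : PowerBasis ℚ_[2] L)
    (hB : IsIntegral ℤ_[2] B.gen)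
    (hE : (minpoly ℤ_[2] B.gen).IsEisensteinAt (Ideal.span {2})) {z : L}
    (hz : IsIntegral ℤ_[2] z) : z ∈ Algebra.adjoin ℤ_[2] {B.gen} := by
  have hprime : Prime (2 : ℤ_[2]) := by simpa using PadicInt.prime_p (p := 2)
  obtain ⟨q, rfl⟩ := B.exists_eq_aeval' z
  obtain ⟨b, hb, hbq⟩ := IsLocalization.integerNormalization_spec (nonZeroDivisors ℤ_[2]) q
  have hmem : b • aeval B.gen q ∈ Algebra.adjoin ℤ_[2] {B.gen} := by
    have : b • aeval B.gen q =
        aeval B.gen (IsLocalization.integerNormalization (nonZeroDivisors ℤ_[2]) q) := by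
      rw [← aeval_map_algebraMap ℚ_[2] B.gen (IsLocalization.integerNormalization _ q), hbq,
        AlgHom.map_smul_of_tower]
    rw [this]
    exact aeval_mem_adjoin_singleton _ _
  have hb0 := nonZeroDivisors.ne_zero hb
  refine mem_adjoin_of_smul_prime_pow_smul_of_minpoly_isEisensteinAt (n := b.valuation) hprime hB
    hz ?_ hE
  have hspec := PadicInt.unitCoeff_spec hb0
  have : (2 : ℤ_[2]) ^ b.valuation = ↑(PadicInt.unitCoeff hb0)⁻¹ * b := by
    nth_rw 3 [hspec]
    simp
  rw [this, mul_smul]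
  exact Subalgebra.smul_mem _ hmem _

/-- If `α ^ N = m` generates a number field `K` of degree `N`, then a root of an Eisenstein
polynomial `(X + 1) ^ 2 ^ n + w` with `w ≡ 1 mod 4`, dividing `X ^ N - m` after a shift, yields a
ring homomorphism from `𝓞 K` to `𝔽₂` through a `2`-adic integer ring. -/
lemma exists_ringHom_zmod_two {N n l : ℕ} (hN : N = 2 ^ n * l) {m : ℤ} {K : Type*} [Field K]
    [NumberField K] (hF : Irreducible ((X : ℚ[X]) ^ N - C (m : ℚ))) {α : 𝓞 K}
    (hgen : IntermediateField.adjoin ℚ {(α : K)} = ⊤) (hroot : α ^ N = (m : 𝓞 K))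
    (w d : ℤ_[2]) (hw : w = 1 + 4 * d) (hm : (-w) ^ l = (m : ℤ_[2])) :
    ∃ (S : Type) (_ : CommRing S) (_ : IsDomain S) (_ : CharZero S) (_ : Algebra ℤ_[2] S)
      (f : 𝓞 K →+* S) (_ : S →+* ZMod 2), f α ^ 2 ^ n = -algebraMap ℤ_[2] S w := by
  have hprime : Prime (2 : ℤ_[2]) := by simpa using PadicInt.prime_p (p := 2)
  let P : ℤ_[2][X] := (X + 1) ^ 2 ^ n + C w
  have hE : P.IsEisensteinAt (Ideal.span {2}) := by
    simpa only [P, hw] using isEisensteinAt_X_add_one_pow_add n d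
  have hdeg : P.natDegree = 2 ^ n := natDegree_X_add_one_pow_add_C n w
  have hmonic : P.Monic := monic_X_add_one_pow_add_C n w
  have hirr : Irreducible P := hE.irreducible ((Ideal.span_singleton_prime hprime.ne_zero).2 hprime)
    hmonic.isPrimitive (by rw [hdeg]; positivity)
  have hirr' : Irreducible (P.map (algebraMap ℤ_[2] ℚ_[2])) :=
    (hmonic.irreducible_iff_irreducible_map_fraction_map).1 hirr
  have : Fact (Irreducible (P.map (algebraMap ℤ_[2] ℚ_[2]))) := ⟨hirr'⟩
  let L := AdjoinRoot (P.map (algebraMap ℤ_[2] ℚ_[2]))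
  let B : PowerBasis ℚ_[2] L := AdjoinRoot.powerBasis hirr'.ne_zero
  have hBroot : aeval B.gen P = 0 := by
    rw [← aeval_map_algebraMap ℚ_[2] B.gen]
    exact AdjoinRoot.eval₂_root _
  have hB : IsIntegral ℤ_[2] B.gen := ⟨P, hmonic, hBroot⟩
  have hmin : minpoly ℤ_[2] B.gen = P := by
    apply map_injective _ (FaithfulSMul.algebraMap_injective ℤ_[2] ℚ_[2])
    rw [← minpoly.isIntegrallyClosed_eq_field_fractions' ℚ_[2] hB]
    exact (minpoly.eq_of_irreducible_of_monic hirr' (by rw [aeval_map_algebraMap, hBroot])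
      (hmonic.map _)).symm
  have : Module.IsTorsionFree ℤ_[2] L := .trans_faithfulSMul ℤ_[2] ℚ_[2] L
  let S := Algebra.adjoin ℤ_[2] {B.gen}
  have hS {z : L} (hz : IsIntegral ℤ_[2] z) : z ∈ S :=
    mem_adjoin_of_isIntegral_of_minpoly_isEisensteinAt B hB (by rwa [hmin]) hz
  have : CharZero L := algebraRat.charZero L
  have hpow : (B.gen + 1) ^ 2 ^ n = -algebraMap ℤ_[2] L w := by
    rw [eq_neg_iff_add_eq_zero]
    simpa [P] using hBroot
  have hα : IsIntegral ℚ (α : K) := Algebra.IsIntegral.isIntegral _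
  have hmonicF : ((X : ℚ[X]) ^ N - C (m : ℚ)).Monic :=
    monic_X_pow_sub_C _ (by
      rintro rfl
      have := hF.natDegree_pos
      rw [pow_zero, ← C_1, ← C_sub, natDegree_C] at this
      exact this.false)
  have hminα : minpoly ℚ (α : K) = X ^ N - C (m : ℚ) :=
    (minpoly.eq_of_irreducible_of_monic hF (by
      have := congrArg (algebraMap (𝓞 K) K) hroot
      simp only [map_pow, map_intCast] at this
      simp [this]) hmonicF).symm
  let g : IntermediateField.adjoin ℚ {(α : K)} →ₐ[ℚ] L :=
    (IntermediateField.algHomAdjoinIntegralEquiv ℚ hα).symm ⟨B.gen + 1, by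
      rw [mem_aroots, hminα]
      refine ⟨hF.ne_zero, ?_⟩
      simp only [map_sub, map_pow, aeval_X, map_intCast]
      rw [hN, pow_mul, hpow, ← map_neg, ← map_pow, hm, map_intCast, sub_self]⟩
  have hg : g (IntermediateField.AdjoinSimple.gen ℚ (α : K)) = B.gen + 1 :=
    IntermediateField.algHomAdjoinIntegralEquiv_symm_apply_gen ℚ hα _
  let e : K →+* L := (g : _ →+* L).comp
    ((IntermediateField.equivOfEq hgen).trans
      IntermediateField.topEquiv).symm.toRingEquiv.toRingHom
  have he : e α = B.gen + 1 := by
    rw [← hg]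
    simp only [e, RingHom.comp_apply, RingHom.coe_coe]
    congr 1
  let f : 𝓞 K →+* S := (e.comp (algebraMap (𝓞 K) K)).codRestrict S fun z ↦ hS <| by
    have h : IsIntegral ℤ (e (algebraMap (𝓞 K) K z)) :=
      (RingOfIntegers.isIntegral_coe z).map (e : K →+* L).toIntAlgHom
    exact h.tower_top
  let ψ : S →+* ZMod 2 := (AdjoinRoot.lift PadicInt.toZMod 0 (by
    rw [hmin, eval₂_at_zero, ← RingHom.mem_ker, PadicInt.ker_toZMod,
      PadicInt.maximalIdeal_eq_span_p, Nat.cast_ofNat]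
    exact hE.mem (by rw [hdeg]; positivity))).comp
      ((minpoly.equivAdjoin hB).symm : S →+* AdjoinRoot (minpoly ℤ_[2] B.gen))
  have : CharZero S := ⟨fun a b h ↦ by
    have := congrArg (Subtype.val : S → L) h
    simpa using this⟩
  refine ⟨S, inferInstance, inferInstance, this, inferInstance, f, ψ, Subtype.ext ?_⟩
  have hf : (f α : L) = B.gen + 1 := he
  simp only [SubmonoidClass.coe_pow, hf, hpow]
  rfl

/-- If `r ≥ 3` and `m ≠ 1` is squarefree with `m ≡ 1 (mod 32)` and `x^(2^r) - m`
is irreducible over `ℚ`, then `K = ℚ(α)` is not monogenic. -/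
theorem pure_two_power_field_not_monogenic
    (r : ℕ) (hr : 3 ≤ r) (m : ℤ) (hm : Squarefree m) (hm1 : m ≠ 1)
    (hmod : m ≡ 1 [ZMOD 32])
    (hF : Irreducible ((X : ℚ[X]) ^ 2 ^ r - C (m : ℚ)))
    (K : Type*) [Field K] [NumberField K] (α : K)
    (hgen : IntermediateField.adjoin ℚ {α} = ⊤)
    (hroot : α ^ 2 ^ r = (m : K)) :
    ¬ ∃ θ : 𝓞 K, Algebra.adjoin ℤ {θ} = ⊤ := by
  rintro ⟨θ, hθ⟩
  obtain ⟨k, rfl⟩ := Nat.exists_eq_add_of_le' hr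
  obtain ⟨d, hd⟩ := PadicInt.exists_pow_eight_eq_intCast hmod
  obtain ⟨c, hc⟩ := hmod.symm.dvd
  have hαint : IsIntegral ℤ α := ⟨X ^ 2 ^ (k + 3) - C m, monic_X_pow_sub_C _ (by positivity), by
    rw [eval₂_sub, eval₂_X_pow, eval₂_C, hroot, algebraMap_int_eq, eq_intCast, sub_self]⟩
  obtain ⟨α, rfl⟩ : ∃ a : 𝓞 K, (a : K) = α := ⟨⟨α, hαint⟩, rfl⟩
  replace hroot : α ^ 2 ^ (k + 3) = (m : 𝓞 K) := RingOfIntegers.ext (by simpa using hroot)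
  let y : 𝓞 K := α ^ 2 ^ k
  have hy : y ^ 8 = 1 + 32 * (c : 𝓞 K) := by
    have : m = 1 + 32 * c := by linarith
    rw [← pow_mul, show 2 ^ k * 8 = 2 ^ (k + 3) by ring, hroot, this]
    push_cast
    ring
  have hyK : (y : K) ^ 8 = 1 + 32 * (c : K) := by
    simpa [map_ofNat] using congrArg (algebraMap (𝓞 K) K) hy
  obtain ⟨η, hηK⟩ : ∃ η : 𝓞 K, (η : K) = (1 + (y : K) ^ 4) / 2 := by
    have : IsIntegral ℤ ((1 + (y : K) ^ 4) / 2) := by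
      refine ⟨X ^ 2 - X - C (8 * c), by monicity!, ?_⟩
      rw [eval₂_sub, eval₂_sub, eval₂_X_pow, eval₂_X, eval₂_C, algebraMap_int_eq, eq_intCast]
      push_cast
      linear_combination hyK / 4
    exact ⟨⟨_, this⟩, rfl⟩
  have hη : 2 * η = 1 + y ^ 4 := RingOfIntegers.ext (by
    simpa [map_ofNat, hηK] using mul_div_cancel₀ _ two_ne_zero)
  have hη2 : (η : K) ^ 2 - η = 8 * c := by
    rw [hηK]
    linear_combination hyK / 4
  obtain ⟨γ, hγK⟩ : ∃ γ : 𝓞 K, (γ : K) = (1 + (y : K) ^ 2) * η / 2 := by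
    have : IsIntegral (𝓞 K) ((1 + (y : K) ^ 2) * η / 2) := by
      refine ⟨X ^ 2 - C η * X - C (η * (4 * c)), by monicity!, ?_⟩
      rw [eval₂_sub, eval₂_sub, eval₂_X_pow, eval₂_mul, eval₂_X, eval₂_C, eval₂_C]
      simp only [map_mul, map_ofNat, map_intCast]
      linear_combination (η : K) / 2 * hη2 - (η : K) ^ 2 / 2 * hηK
    exact ⟨⟨_, isIntegral_trans (R := ℤ) _ this⟩, rfl⟩
  have hγ : 2 * γ = (1 + y ^ 2) * η := RingOfIntegers.ext (by
    simpa [map_ofNat, hγK] using mul_div_cancel₀ _ two_ne_zero)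
  have two_zero : (2 : ZMod 2) = 0 := rfl
  obtain ⟨φ₁, h₁η, h₁γ⟩ : ∃ φ : 𝓞 K →+* ZMod 2, φ η = 1 ∧ φ γ = 1 := by
    obtain ⟨S, _, _, _, _, f, ψ, hf⟩ := exists_ringHom_zmod_two (n := k) (l := 8) (by ring) hF
      hgen hroot (1 + 4 * d) d rfl (by rw [← hd]; ring)
    rw [← map_pow] at hf
    change f y = _ at hf
    have h2 : (2 : S) ≠ 0 := two_ne_zero
    set D := algebraMap ℤ_[2] S d with hD
    simp only [map_add, map_one, map_mul, map_ofNat, ← hD] at hf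
    have e₁ : f η = 1 + 2 * (4 * D + 24 * D ^ 2 + 64 * D ^ 3 + 64 * D ^ 4) := by
      have := congrArg f hη
      simp only [map_add, map_one, map_mul, map_ofNat, map_pow, hf] at this
      exact mul_left_cancel₀ h2 (by linear_combination this)
    have e₂ : f γ = (1 + 2 * (2 * D + 4 * D ^ 2)) * f η := by
      have := congrArg f hγ
      simp only [map_add, map_one, map_mul, map_ofNat, map_pow, hf] at this
      exact mul_left_cancel₀ h2 (by linear_combination this)
    exact ⟨ψ.comp f, by simp [e₁, map_ofNat, two_zero], by simp [e₂, e₁, map_ofNat, two_zero]⟩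
  obtain ⟨φ₂, h₂η, h₂γ⟩ : ∃ φ : 𝓞 K →+* ZMod 2, φ η = 1 ∧ φ γ = 0 := by
    obtain ⟨S, _, _, _, _, f, ψ, hf⟩ := exists_ringHom_zmod_two (n := k + 1) (l := 4) (by ring) hF
      hgen hroot ((1 + 4 * d) ^ 2) (2 * d + 4 * d ^ 2) (by ring) (by rw [← hd]; ring)
    rw [pow_succ, pow_mul, ← map_pow] at hf
    change f y ^ 2 = _ at hf
    have h2 : (2 : S) ≠ 0 := two_ne_zero
    set D := algebraMap ℤ_[2] S d with hD
    simp only [map_add, map_one, map_mul, map_ofNat, map_pow, ← hD] at hf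
    have e₁ : f η = 1 + 2 * (4 * D + 24 * D ^ 2 + 64 * D ^ 3 + 64 * D ^ 4) := by
      have := congrArg f hη
      simp only [map_add, map_one, map_mul, map_ofNat, map_pow] at this
      rw [show f y ^ 4 = (f y ^ 2) ^ 2 by ring, hf] at this
      exact mul_left_cancel₀ h2 (by linear_combination this)
    have e₂ : f γ = 2 * ((-2 * D - 4 * D ^ 2) * f η) := by
      have := congrArg f hγ
      simp only [map_add, map_one, map_mul, map_ofNat, map_pow, hf] at this
      exact mul_left_cancel₀ h2 (by linear_combination this)
    exact ⟨ψ.comp f, by simp [e₁, map_ofNat, two_zero], by simp [e₂, map_ofNat, two_zero]⟩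
  obtain ⟨φ₃, h₃η⟩ : ∃ φ : 𝓞 K →+* ZMod 2, φ η = 0 := by
    obtain ⟨S, _, _, _, _, f, ψ, hf⟩ := exists_ringHom_zmod_two (n := k + 2) (l := 2) (by ring) hF
      hgen hroot ((1 + 4 * d) ^ 4) (4 * d + 24 * d ^ 2 + 64 * d ^ 3 + 64 * d ^ 4) (by ring)
      (by rw [← hd]; ring)
    rw [pow_add, pow_mul, ← map_pow] at hf
    change f y ^ 4 = _ at hf
    have h2 : (2 : S) ≠ 0 := two_ne_zero
    set D := algebraMap ℤ_[2] S d with hD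
    simp only [map_add, map_one, map_mul, map_ofNat, map_pow, ← hD] at hf
    have e₁ : f η = 2 * (-4 * D - 24 * D ^ 2 - 64 * D ^ 3 - 64 * D ^ 4) := by
      have := congrArg f hη
      simp only [map_add, map_one, map_mul, map_ofNat, map_pow, hf] at this
      exact mul_left_cancel₀ h2 (by linear_combination this)
    exact ⟨ψ.comp f, by simp [e₁, map_ofNat, two_zero]⟩
  have hext (φ φ' : 𝓞 K →+* ZMod 2) (h : φ θ = φ' θ) : φ = φ' := by
    have : φ.toIntAlgHom = φ'.toIntAlgHom := AlgHom.ext_of_adjoin_eq_top hθ (by simpa using h)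
    exact RingHom.ext fun z ↦ DFunLike.congr_fun this z
  have pigeonhole : ∀ a b c : ZMod 2, a = b ∨ a = c ∨ b = c := by decide
  rcases pigeonhole (φ₁ θ) (φ₂ θ) (φ₃ θ) with h | h | h <;> have h' := hext _ _ h
  · rw [h', h₂γ] at h₁γ
    exact zero_ne_one h₁γ
  · rw [h', h₃η] at h₁η
    exact zero_ne_one h₁η
  · rw [h', h₃η] at h₂η
    exact zero_ne_one h₂η
end

section
/- Let p be an odd rational prime, r ≥ p an integer, and m ≠ 1 a squarefree rational integer not divisible by p with ν_p(m^(p−1) − 1) > p, such that F(x) = x^(p^r) − m is irreducible over ℚ. Let α be a complex root of F and K = ℚ(α) with ring of integers Z_K. Then there are at least p + 1 distinct nonzero prime ideals of Z_K lying above p, each with residue degree 1 over p. -/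
open Polynomial NumberField

section Dedekind

variable {R : Type*} [CommRing R] [IsDedekindDomain R] {P : Ideal R}

/-- An element of exact `P`-adic order `n` has absolute value `N π ^ n`. -/
theorem map_eq_pow_of_mem_pow (hP : P.IsPrime) (N : R →*₀ ℝ) (hN : ∀ x ∉ P, N x = 1)
    {π x : R} (hπ : π ∈ P) (hπ' : π ∉ P ^ 2) {n : ℕ} (hx : x ∈ P ^ n) (hx' : x ∉ P ^ (n + 1)) :
    N x = N π ^ n := by
  obtain ⟨J, hJ⟩ := Ideal.dvd_span_singleton.mpr hπ
  have hJP : ¬ J ≤ P := fun h ↦ hπ' <| by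
    rw [← Ideal.span_singleton_le_iff_mem, hJ, sq]
    exact Ideal.mul_mono_right h
  have hJn : ¬ J ^ n ≤ P := fun h ↦ hJP (hP.le_of_pow_le h)
  obtain ⟨s, hs, hsP⟩ := Set.not_subset.mp hJn
  have hmem : x * s ∈ Ideal.span {π ^ n} := by
    rw [← Ideal.span_singleton_pow, hJ, mul_pow]
    exact Ideal.mul_mem_mul hx hs
  obtain ⟨a, ha⟩ := Ideal.mem_span_singleton'.mp hmem
  have haP : a ∉ P := fun h ↦ by
    have h1 : x * s ∈ P ^ (n + 1) := by
      rw [← ha, pow_succ']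
      exact Ideal.mul_mem_mul h (Ideal.pow_mem_pow hπ n)
    exact hx' ((hP.mem_pow_mul _ h1).resolve_right hsP)
  have := congrArg N ha
  rw [map_mul, map_mul, map_pow, hN a haP, hN s hsP] at this
  linarith

theorem exists_mem_pow_notMem_pow_succ_of_ne_zero (hP : P.IsPrime) {x : R} (hx : x ≠ 0) :
    ∃ n, x ∈ P ^ n ∧ x ∉ P ^ (n + 1) := by
  by_contra! h
  have hall : ∀ n, x ∈ P ^ n := fun n ↦ by
    induction n with
    | zero => simp
    | succ n ih => exact h n ih
  have := Ideal.iInf_pow_eq_bot_of_isDomain P hP.ne_top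
  exact hx ((Submodule.mem_bot R).mp (this ▸ (Ideal.mem_iInf.mpr hall)))

/-- An absolute value that is trivial off `P` is determined by its value at one element. -/
theorem map_eq_map_of_eq_one_off_prime (hP : P.IsPrime) (hP0 : P ≠ ⊥) (N₁ N₂ : R →*₀ ℝ)
    (h₁ : ∀ x ∉ P, N₁ x = 1) (h₂ : ∀ x ∉ P, N₂ x = 1)
    (h₁0 : ∀ x, 0 ≤ N₁ x) (h₂0 : ∀ x, 0 ≤ N₂ x) {a : R} (ha0 : a ≠ 0) (ha : N₁ a = N₂ a)
    (ha1 : N₁ a ≠ 1) {x : R} (hx : x ≠ 0) : N₁ x = N₂ x := by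
  obtain ⟨π, hπ, hπ'⟩ := Ideal.exists_mem_pow_notMem_pow_succ P hP0 hP.ne_top 1
  rw [pow_one] at hπ
  obtain ⟨e, he, he'⟩ := exists_mem_pow_notMem_pow_succ_of_ne_zero hP ha0
  obtain ⟨n, hn, hn'⟩ := exists_mem_pow_notMem_pow_succ_of_ne_zero hP hx
  have e₁ := map_eq_pow_of_mem_pow hP N₁ h₁ hπ hπ' he he'
  have e₂ := map_eq_pow_of_mem_pow hP N₂ h₂ hπ hπ' he he'
  have he0 : e ≠ 0 := by
    rintro rfl
    exact ha1 (by simpa using e₁)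
  rw [map_eq_pow_of_mem_pow hP N₁ h₁ hπ hπ' hn hn', map_eq_pow_of_mem_pow hP N₂ h₂ hπ hπ' hn hn',
    (pow_left_inj₀ (h₁0 π) (h₂0 π) he0).mp (e₁ ▸ e₂ ▸ ha)]

theorem mem_pow_of_map_pow_eq (hP : P.IsPrime) (hP0 : P ≠ ⊥) (N : R →*₀ ℝ)
    (hN : ∀ x ∉ P, N x = 1) (hN0 : ∀ x, 0 ≤ N x) {a x : R} (ha1 : N a ≠ 1) (ha0 : N a ≠ 0)
    {l : ℕ} (hxa : N x ^ l = N a) : a ∈ P ^ l := by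
  obtain ⟨π, hπ, hπ'⟩ := Ideal.exists_mem_pow_notMem_pow_succ P hP0 hP.ne_top 1
  rw [pow_one] at hπ
  have hl : l ≠ 0 := by
    rintro rfl
    exact ha1 (by simpa using hxa.symm)
  have hx0 : x ≠ 0 := by
    rintro rfl
    exact ha0 (by simpa [hl] using hxa.symm)
  have ha : a ≠ 0 := by
    rintro rfl
    exact ha0 (map_zero N)
  obtain ⟨e, he, he'⟩ := exists_mem_pow_notMem_pow_succ_of_ne_zero hP ha
  obtain ⟨n, hn, hn'⟩ := exists_mem_pow_notMem_pow_succ_of_ne_zero hP hx0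
  have e₁ := map_eq_pow_of_mem_pow hP N hN hπ hπ' he he'
  have e₂ := map_eq_pow_of_mem_pow hP N hN hπ hπ' hn hn'
  have he0 : e ≠ 0 := by
    rintro rfl
    exact ha1 (by simpa using e₁)
  have hπ0 : N π ≠ 0 := fun h ↦ ha0 (by rw [e₁, h, zero_pow he0])
  have hπ1 : N π ≠ 1 := fun h ↦ ha1 (by rw [e₁, h, one_pow])
  have hen : n * l = e := by
    rw [e₁, e₂, ← pow_mul] at hxa
    exact pow_right_injective₀ (lt_of_le_of_ne (hN0 π) hπ0.symm) hπ1 hxa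
  have hn0 : n ≠ 0 := by
    rintro rfl
    exact he0 (by simp [← hen])
  refine Ideal.pow_le_pow_right ?_ he
  rw [← hen]
  exact Nat.le_mul_of_pos_left l (Nat.pos_of_ne_zero hn0)

end Dedekind

section Local

variable {E : Type*} [NormedField E]

theorem exists_prod_norm_sub_one_eq [IsAlgClosed E] {p : ℕ} (hp : p ≠ 0) (u : E) :
    ∃ S : Multiset E, S.card = p ∧ (∀ y ∈ S, y ^ p = u) ∧
      (S.map fun y ↦ ‖y - 1‖).prod = ‖u - 1‖ := by
  have hmonic : (X ^ p - C u : E[X]).Monic := monic_X_pow_sub_C u hp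
  have hsplit : (X ^ p - C u : E[X]).Splits := IsAlgClosed.splits _
  refine ⟨(X ^ p - C u).roots, ?_, fun y hy ↦ ?_, ?_⟩
  · rw [← hsplit.natDegree_eq_card_roots, natDegree_X_pow_sub_C]
  · simpa [sub_eq_zero] using (mem_roots'.mp hy).2
  · have h := congrArg norm (hsplit.eval_eq_prod_roots_of_monic hmonic 1)
    simp only [eval_sub, eval_pow, eval_X, one_pow, eval_C] at h
    rw [norm_sub_rev, h]
    change _ = normHom (α := E) _
    rw [map_multiset_prod, Multiset.map_map]
    congr 1
    refine Multiset.map_congr rfl fun y _ ↦ ?_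
    simp [norm_sub_rev]

variable [IsUltrametricDist E]

theorem norm_le_one_of_isIntegral_int {x : E} (hx : IsIntegral ℤ x) : ‖x‖ ≤ 1 := by
  have h := (Valuation.integer.integers (NormedField.valuation (K := E))).mem_of_integral
    (hx.tower_top (A := (NormedField.valuation (K := E)).integer))
  exact_mod_cast h

theorem norm_aeval_int_le_one {z : E} (hz : ‖z‖ ≤ 1) (f : ℤ[X]) : ‖aeval z f‖ ≤ 1 := by
  rw [aeval_eq_sum_range]
  refine IsUltrametricDist.norm_sum_le_of_forall_le_of_nonneg zero_le_one fun i _ ↦ ?_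
  rw [zsmul_eq_mul, norm_mul, norm_pow]
  exact mul_le_one₀ (IsUltrametricDist.norm_intCast_le_one E _) (by positivity)
    (pow_le_one₀ (norm_nonneg z) hz)

variable {p : ℕ}

theorem exists_one_add_pow_sub_one_eq (hp : p.Prime) (z : E) (hz : ‖z‖ < 1) :
    ∃ c : E, ‖c‖ = 1 ∧ (1 + z) ^ p - 1 = z ^ p + p * z * c := by
  obtain ⟨r, hr⟩ := exists_add_pow_prime_eq hp (1 : ℤ[X]) X
  have hr0 : r.coeff 0 = 1 := by
    have h := congrArg (fun f : ℤ[X] ↦ (derivative f).eval 0) hr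
    have hp1 : p - 1 ≠ 0 := by have := hp.two_le; omega
    simp [derivative_pow, hp1] at h
    rw [← coeff_zero_eq_eval_zero] at h
    have : (p : ℤ) ≠ 0 := by exact_mod_cast hp.ne_zero
    exact (mul_left_cancel₀ this (by linarith))
  obtain ⟨q, hq⟩ : X ∣ r - 1 := by rw [X_dvd_iff]; simp [hr0]
  refine ⟨aeval z r, ?_, ?_⟩
  · rw [eq_add_of_sub_eq hq]
    have hqz : ‖aeval z q‖ ≤ 1 := norm_aeval_int_le_one hz.le q
    have : ‖z * aeval z q‖ < 1 := by
      rw [norm_mul]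
      nlinarith [norm_nonneg z, norm_nonneg (aeval z q)]
    simp only [map_add, map_mul, aeval_X, map_one]
    rw [IsUltrametricDist.norm_add_eq_max_of_norm_ne_norm (by simpa using this.ne)]
    simpa using this.le
  · have := congrArg (aeval z) hr
    simp at this
    rw [this]; ring

theorem norm_pow_prime_sub_one_of_lt (hp : p.Prime) (hpE : ‖(p : E)‖ = (p : ℝ)⁻¹) {y : E}
    (hy : ‖y - 1‖ < 1) (h : ‖y - 1‖ ^ (p - 1) < (p : ℝ)⁻¹) :
    ‖y ^ p - 1‖ = ‖y - 1‖ * (p : ℝ)⁻¹ := by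
  obtain ⟨c, hc, hyc⟩ := exists_one_add_pow_sub_one_eq hp (y - 1) hy
  rw [add_sub_cancel] at hyc
  have hmul : ‖p * (y - 1) * c‖ = ‖y - 1‖ * (p : ℝ)⁻¹ := by
    rw [norm_mul, norm_mul, hc, hpE]; ring
  rcases eq_or_ne (y - 1) 0 with h0 | h0
  · simp [hyc, h0, hp.ne_zero]
  have hlt : ‖(y - 1) ^ p‖ < ‖p * (y - 1) * c‖ := by
    rw [hmul, norm_pow, ← mul_pow_sub_one hp.ne_zero]
    exact mul_lt_mul_of_pos_left h (norm_pos_iff.mpr h0)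
  rw [hyc, IsUltrametricDist.norm_add_eq_max_of_norm_ne_norm hlt.ne, max_eq_right hlt.le, hmul]

theorem norm_pow_prime_sub_one_of_gt (hp : p.Prime) (hpE : ‖(p : E)‖ = (p : ℝ)⁻¹) {y : E}
    (hy : ‖y - 1‖ < 1) (h : (p : ℝ)⁻¹ < ‖y - 1‖ ^ (p - 1)) :
    ‖y ^ p - 1‖ = ‖y - 1‖ ^ p := by
  obtain ⟨c, hc, hyc⟩ := exists_one_add_pow_sub_one_eq hp (y - 1) hy
  rw [add_sub_cancel] at hyc
  have hmul : ‖p * (y - 1) * c‖ = ‖y - 1‖ * (p : ℝ)⁻¹ := by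
    rw [norm_mul, norm_mul, hc, hpE]; ring
  have h0 : y - 1 ≠ 0 := by
    intro h0
    have hp1 : p - 1 ≠ 0 := by have := hp.two_le; omega
    rw [h0, norm_zero, zero_pow hp1] at h
    exact absurd h (not_lt.mpr (by positivity))
  have hlt : ‖p * (y - 1) * c‖ < ‖(y - 1) ^ p‖ := by
    rw [hmul, norm_pow, ← mul_pow_sub_one hp.ne_zero]
    exact mul_lt_mul_of_pos_left h (norm_pos_iff.mpr h0)
  rw [hyc, IsUltrametricDist.norm_add_eq_max_of_norm_ne_norm hlt.ne', max_eq_left hlt.le, norm_pow]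

theorem norm_pow_prime_sub_one_le_of_le (hp : p.Prime) (hpE : ‖(p : E)‖ = (p : ℝ)⁻¹) {y : E}
    (hy : ‖y - 1‖ < 1) (h : ‖y - 1‖ ^ (p - 1) ≤ (p : ℝ)⁻¹) :
    ‖y ^ p - 1‖ ≤ ‖y - 1‖ * (p : ℝ)⁻¹ := by
  obtain ⟨c, hc, hyc⟩ := exists_one_add_pow_sub_one_eq hp (y - 1) hy
  rw [add_sub_cancel] at hyc
  rw [hyc]
  refine (IsUltrametricDist.norm_add_le_max _ _).trans (max_le ?_ ?_)
  · rw [norm_pow, ← mul_pow_sub_one hp.ne_zero]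
    exact mul_le_mul_of_nonneg_left h (norm_nonneg _)
  · rw [norm_mul, norm_mul, hc, hpE]
    exact le_of_eq (by ring)

theorem norm_sub_one_lt_one_of_pow_prime (hp : p.Prime) (hpE : ‖(p : E)‖ = (p : ℝ)⁻¹) {y : E}
    (hy : ‖y ^ p - 1‖ < 1) : ‖y - 1‖ < 1 := by
  have hyp : ‖y ^ p‖ = 1 := by
    have h := IsUltrametricDist.norm_add_eq_max_of_norm_ne_norm (x := y ^ p - 1) (y := (1 : E))
      (by simpa using hy.ne)
    rwa [sub_add_cancel, norm_one, max_eq_right hy.le] at h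
  have hy1 : ‖y‖ = 1 := by
    rw [norm_pow] at hyp
    exact (pow_eq_one_iff_of_nonneg (norm_nonneg y) hp.ne_zero).mp hyp
  have hz : ‖y - 1‖ ≤ 1 := by
    simpa [hy1, sub_eq_add_neg] using IsUltrametricDist.norm_add_le_max y (-1)
  obtain ⟨r, hr⟩ := exists_add_pow_prime_eq hp (1 : ℤ[X]) X
  have hyr := congrArg (aeval (y - 1)) hr
  simp only [map_add, map_pow, map_mul, map_one, aeval_X, add_sub_cancel, one_pow, mul_one,
    map_natCast] at hyr
  have hp1 : (p : ℝ)⁻¹ < 1 := inv_lt_one_of_one_lt₀ (by exact_mod_cast hp.one_lt)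
  have hlt : ‖(y - 1) ^ p‖ < 1 := by
    rw [show (y - 1) ^ p = (y ^ p - 1) - p * (y - 1) * aeval (y - 1) r by rw [hyr]; ring]
    rw [sub_eq_add_neg]
    refine (IsUltrametricDist.norm_add_le_max _ _).trans_lt (max_lt hy ?_)
    rw [norm_neg, norm_mul, norm_mul, hpE]
    refine lt_of_le_of_lt ?_ hp1
    rw [mul_assoc]
    exact mul_le_of_le_one_right (by positivity)
      (mul_le_one₀ hz (norm_nonneg _) (norm_aeval_int_le_one hz r))
  rw [norm_pow] at hlt
  exact (pow_lt_one_iff_of_nonneg (norm_nonneg _) hp.ne_zero).mp hlt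

theorem norm_sub_one_eq_or_of_norm_pow_prime_sub_one (hp : p.Prime)
    (hpE : ‖(p : E)‖ = (p : ℝ)⁻¹) {y : E} {s : ℕ} (hs : 1 ≤ s)
    (hy : ‖y ^ p - 1‖ = (p : ℝ)⁻¹ ^ (s + 1)) :
    ‖y - 1‖ = (p : ℝ)⁻¹ ^ s ∨ ‖y - 1‖ ^ (p - 1) = (p : ℝ)⁻¹ := by
  have hq0 : 0 < (p : ℝ)⁻¹ := inv_pos.mpr (by exact_mod_cast hp.pos)
  have hq1 : (p : ℝ)⁻¹ < 1 := inv_lt_one_of_one_lt₀ (by exact_mod_cast hp.one_lt)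
  have hy1 := norm_sub_one_lt_one_of_pow_prime hp hpE
    (hy ▸ pow_lt_one₀ hq0.le hq1 (Nat.succ_ne_zero s))
  rcases lt_trichotomy (‖y - 1‖ ^ (p - 1)) (p : ℝ)⁻¹ with h | h | h
  · left
    rw [norm_pow_prime_sub_one_of_lt hp hpE hy1 h, pow_succ] at hy
    exact mul_right_cancel₀ hq0.ne' hy
  · exact .inr h
  · rw [norm_pow_prime_sub_one_of_gt hp hpE hy1 h] at hy
    have h1 : (p : ℝ)⁻¹ ^ p < (‖y - 1‖ ^ (p - 1)) ^ p := pow_lt_pow_left₀ h hq0.le hp.ne_zero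
    rw [pow_right_comm, hy, ← pow_mul, pow_lt_pow_iff_right_of_lt_one₀ hq0 hq1] at h1
    obtain ⟨k, rfl⟩ := Nat.exists_eq_add_of_le hp.two_le
    obtain ⟨l, rfl⟩ := Nat.exists_eq_add_of_le hs
    exfalso
    rw [show 2 + k - 1 = k + 1 by omega] at h1
    nlinarith [Nat.zero_le (l * k)]

variable [IsAlgClosed E]

theorem exists_pow_prime_eq_norm_sub_one_eq (hp : p.Prime) (hp3 : 3 ≤ p)
    (hpE : ‖(p : E)‖ = (p : ℝ)⁻¹) {u : E} {s : ℕ} (hs : 1 ≤ s)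
    (hu : ‖u - 1‖ = (p : ℝ)⁻¹ ^ (s + 1)) : ∃ y : E, y ^ p = u ∧ ‖y - 1‖ = (p : ℝ)⁻¹ ^ s := by
  have hq0 : 0 < (p : ℝ)⁻¹ := inv_pos.mpr (by exact_mod_cast hp.pos)
  have hq1 : (p : ℝ)⁻¹ < 1 := inv_lt_one_of_one_lt₀ (by exact_mod_cast hp.one_lt)
  obtain ⟨S, hcard, hS, hprod⟩ := exists_prod_norm_sub_one_eq hp.ne_zero u
  by_contra! h
  have hfar : ∀ y ∈ S, ‖y - 1‖ ^ (p - 1) = (p : ℝ)⁻¹ := fun y hy ↦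
    (norm_sub_one_eq_or_of_norm_pow_prime_sub_one hp hpE hs (by rw [hS y hy, hu])).resolve_left
      (h y (hS y hy))
  have h1 : (p : ℝ)⁻¹ ^ ((s + 1) * (p - 1)) = (p : ℝ)⁻¹ ^ p := by
    rw [pow_mul, ← hu, ← hprod, ← Multiset.prod_map_pow, Multiset.map_congr rfl hfar,
      Multiset.map_const', Multiset.prod_replicate, hcard]
  have h2 := pow_right_injective₀ hq0 hq1.ne h1
  obtain ⟨k, rfl⟩ := Nat.exists_eq_add_of_le hp3
  obtain ⟨l, rfl⟩ := Nat.exists_eq_add_of_le hs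
  rw [show 3 + k - 1 = k + 2 by omega] at h2
  nlinarith [Nat.zero_le (l * k)]

theorem exists_pow_prime_eq_norm_sub_one_pow_eq (hp : p.Prime) (hp3 : 3 ≤ p)
    (hpE : ‖(p : E)‖ = (p : ℝ)⁻¹) {u : E} {s : ℕ} (hs : 1 ≤ s)
    (hu : ‖u - 1‖ = (p : ℝ)⁻¹ ^ (s + 1)) :
    ∃ y : E, y ^ p = u ∧ ‖y - 1‖ ^ (p - 1) = (p : ℝ)⁻¹ := by
  have hq0 : 0 < (p : ℝ)⁻¹ := inv_pos.mpr (by exact_mod_cast hp.pos)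
  have hq1 : (p : ℝ)⁻¹ < 1 := inv_lt_one_of_one_lt₀ (by exact_mod_cast hp.one_lt)
  obtain ⟨S, hcard, hS, hprod⟩ := exists_prod_norm_sub_one_eq hp.ne_zero u
  by_contra! h
  have hnear : ∀ y ∈ S, ‖y - 1‖ = (p : ℝ)⁻¹ ^ s := fun y hy ↦
    (norm_sub_one_eq_or_of_norm_pow_prime_sub_one hp hpE hs (by rw [hS y hy, hu])).resolve_right
      (h y (hS y hy))
  have h1 : (p : ℝ)⁻¹ ^ (s + 1) = (p : ℝ)⁻¹ ^ (s * p) := by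
    rw [← hu, ← hprod, Multiset.map_congr rfl hnear, Multiset.map_const',
      Multiset.prod_replicate, hcard, pow_mul]
  have h2 := pow_right_injective₀ hq0 hq1.ne h1
  obtain ⟨k, rfl⟩ := Nat.exists_eq_add_of_le hp3
  nlinarith [Nat.zero_le (s * k)]

theorem exists_pow_prime_pow_eq_norm_sub_one_eq (hp : p.Prime) (hp3 : 3 ≤ p)
    (hpE : ‖(p : E)‖ = (p : ℝ)⁻¹) {s : ℕ} (hs : 1 ≤ s) (j : ℕ) {u : E}
    (hu : ‖u - 1‖ = (p : ℝ)⁻¹ ^ (s + j)) :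
    ∃ y : E, y ^ p ^ j = u ∧ ‖y - 1‖ = (p : ℝ)⁻¹ ^ s := by
  induction j generalizing u with
  | zero => exact ⟨u, by simp, by simpa using hu⟩
  | succ j ih =>
    obtain ⟨v, hv, hv'⟩ := exists_pow_prime_eq_norm_sub_one_eq hp hp3 hpE
      (show 1 ≤ s + j by omega) (by rw [hu, add_assoc])
    obtain ⟨y, hy, hy'⟩ := ih hv'
    exact ⟨y, by rw [pow_succ, pow_mul, hy, hv], hy'⟩

theorem exists_pow_prime_pow_eq_of_shallow (hp : p.Prime) (hpE : ‖(p : E)‖ = (p : ℝ)⁻¹) {u : E}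
    (hu : ‖u - 1‖ < 1) (hu' : (p : ℝ)⁻¹ ^ p < ‖u - 1‖ ^ (p - 1)) (j : ℕ) :
    ∃ y : E, y ^ p ^ j = u ∧ ‖y - 1‖ < 1 ∧ ‖y - 1‖ ^ p ^ j = ‖u - 1‖ := by
  have hq0 : 0 < (p : ℝ)⁻¹ := inv_pos.mpr (by exact_mod_cast hp.pos)
  have hq1 : (p : ℝ)⁻¹ < 1 := inv_lt_one_of_one_lt₀ (by exact_mod_cast hp.one_lt)
  induction j generalizing u with
  | zero => exact ⟨u, by simp, hu, by simp⟩
  | succ j ih =>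
    obtain ⟨v, rfl⟩ := IsAlgClosed.exists_pow_nat_eq u hp.pos
    have hv := norm_sub_one_lt_one_of_pow_prime hp hpE hu
    have hv' : (p : ℝ)⁻¹ < ‖v - 1‖ ^ (p - 1) := by
      by_contra! h
      refine absurd (pow_le_pow_left₀ (norm_nonneg _)
        (norm_pow_prime_sub_one_le_of_le hp hpE hv h) (p - 1)) (not_le.mpr ?_)
      refine lt_of_le_of_lt ?_ hu'
      rw [mul_pow, ← mul_pow_sub_one hp.ne_zero]
      exact mul_le_mul_of_nonneg_right h (by positivity)
    obtain ⟨y, hy, hy1, hy'⟩ := ih hv (lt_of_le_of_lt (pow_le_of_le_one hq0.le hq1.le hp.ne_zero) hv')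
    refine ⟨y, by rw [pow_succ, pow_mul, hy], hy1, ?_⟩
    rw [pow_succ, pow_mul, hy', norm_pow_prime_sub_one_of_gt hp hpE hv hv']

theorem exists_pow_prime_pow_eq_norm_sub_one_pow (hp : p.Prime) (hp3 : 3 ≤ p)
    (hpE : ‖(p : E)‖ = (p : ℝ)⁻¹) {u : E} {n t r : ℕ} (htr : t ≤ r) (htn : t < n)
    (h : t = r ∨ n = t + 1) (hu : ‖u - 1‖ = (p : ℝ)⁻¹ ^ n) {i : ℕ} (hi : i ≤ t) :
    ∃ y : E, y ^ p ^ r = u ∧ ‖y - 1‖ < 1 ∧ ‖y - 1‖ ^ (p ^ (r - t) * (p ^ i).totient) ≤ (p : ℝ)⁻¹ ∧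
      (p ^ (r - t) * (p ^ i).totient ≠ 1 →
        ‖y - 1‖ ^ (p ^ (r - t) * (p ^ i).totient) = (p : ℝ)⁻¹) := by
  have hq0 : 0 < (p : ℝ)⁻¹ := inv_pos.mpr (by exact_mod_cast hp.pos)
  have hq1 : (p : ℝ)⁻¹ < 1 := inv_lt_one_of_one_lt₀ (by exact_mod_cast hp.one_lt)
  rcases i with _ | i
  · obtain ⟨v, hv, hv'⟩ := exists_pow_prime_pow_eq_norm_sub_one_eq hp hp3 hpE
      (show 1 ≤ n - t by omega) t (u := u) (by rw [hu]; congr 1; omega)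
    rcases eq_or_ne t r with rfl | htr'
    · have h1 : ‖v - 1‖ ≤ (p : ℝ)⁻¹ := hv' ▸ pow_le_of_le_one hq0.le hq1.le (by omega)
      exact ⟨v, hv, h1.trans_lt hq1, by simpa using h1, by simp⟩
    · rw [show n - t = 1 by omega, pow_one] at hv'
      obtain ⟨y, hy, hy1, hy'⟩ := exists_pow_prime_pow_eq_of_shallow hp hpE (hv' ▸ hq1)
        (by rw [hv']; exact pow_lt_pow_right_of_lt_one₀ hq0 hq1 (Nat.sub_lt hp.pos one_pos))
        (r - t)
      refine ⟨y, ?_, hy1, by simp [hy', hv'], by simp [hy', hv']⟩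
      rw [← hv, ← hy, ← pow_mul, ← pow_add, Nat.sub_add_cancel htr]
  · obtain ⟨v, hv, hv'⟩ := exists_pow_prime_pow_eq_norm_sub_one_eq hp hp3 hpE
      (show 1 ≤ n - (t - (i + 1)) by omega) (t - (i + 1)) (u := u) (by rw [hu]; congr 1; omega)
    obtain ⟨w, hw, hw'⟩ := exists_pow_prime_eq_norm_sub_one_pow_eq hp hp3 hpE
      (show 1 ≤ n - (t - (i + 1)) - 1 by omega) (u := v) (by rw [hv']; congr 1; omega)
    have hw1 := norm_sub_one_lt_one_of_pow_prime hp hpE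
      (hw ▸ hv' ▸ pow_lt_one₀ hq0.le hq1 (by omega))
    obtain ⟨y, hy, hy1, hy'⟩ := exists_pow_prime_pow_eq_of_shallow hp hpE hw1
      (by rw [hw']; exact pow_lt_self_of_lt_one₀ hq0 hq1 hp.one_lt) (r - t + i)
    have key : ‖y - 1‖ ^ (p ^ (r - t) * (p ^ (i + 1)).totient) = (p : ℝ)⁻¹ := by
      rw [Nat.totient_prime_pow_succ hp, ← mul_assoc, ← pow_add, pow_mul, hy', hw']
    refine ⟨y, ?_, hy1, key.le, fun _ ↦ key⟩
    rw [← hv, ← hw, ← hy, ← pow_mul, ← pow_mul, ← pow_succ', ← pow_add]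
    congr 2
    omega

end Local

section Global

variable {K : Type*} [Field K] {p : ℕ}

/-- If the exponents `l i` add up to the degree, then prime ideals `P i` with `p ∈ P i ^ l i`
have residue degree one. -/
theorem absNorm_eq_of_mem_pow_of_sum_eq_finrank [NumberField K] (hp : p.Prime) {ι : Type*}
    (s : Finset ι) (P : ι → Ideal (𝓞 K)) (hP : ∀ i ∈ s, (P i).IsPrime) (hP0 : ∀ i ∈ s, P i ≠ ⊥)
    (hinj : Set.InjOn P s) (l : ι → ℕ) (hl : ∀ i ∈ s, l i ≠ 0)
    (hmem : ∀ i ∈ s, (p : 𝓞 K) ∈ P i ^ l i) (hsum : ∑ i ∈ s, l i = Module.finrank ℚ K)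
    {i : ι} (hi : i ∈ s) : Ideal.absNorm (P i) = p := by
  have hdvd : ∀ i ∈ s, p ∣ Ideal.absNorm (P i) := fun i hi ↦ by
    by_contra h
    have hco : IsCoprime ((p : ℤ) : 𝓞 K) ((Ideal.absNorm (P i) : ℤ) : 𝓞 K) :=
      (Nat.isCoprime_iff_coprime.mpr ((hp.coprime_iff_not_dvd).mpr h)).intCast
    obtain ⟨a, b, hab⟩ := hco
    refine (hP i hi).ne_top ((Ideal.eq_top_iff_one _).mpr (hab ▸ ?_))
    refine add_mem (Ideal.mul_mem_left _ _ ?_) (Ideal.mul_mem_left _ _ ?_)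
    · exact_mod_cast Ideal.pow_le_self (hl i hi) (hmem i hi)
    · exact_mod_cast Ideal.absNorm_mem (P i)
  have hprod : ∏ i ∈ s, P i ^ l i ∣ Ideal.span {(p : 𝓞 K)} := by
    refine Finset.prod_dvd_of_coprime (fun i hi j hj hij ↦ ?_)
      fun i hi ↦ Ideal.dvd_span_singleton.mpr (hmem i hi)
    have := (hP i hi).isMaximal (hP0 i hi)
    have := (hP j hj).isMaximal (hP0 j hj)
    exact (Ideal.isCoprime_of_isMaximal (fun h ↦ hij (hinj hi hj h))).pow
  have hnorm := map_dvd Ideal.absNorm hprod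
  rw [map_prod, Ideal.absNorm_span_natCast, RingOfIntegers.rank, ← hsum,
    ← Finset.prod_pow_eq_pow_sum] at hnorm
  have heq : ∏ i ∈ s, p ^ l i = ∏ i ∈ s, Ideal.absNorm (P i ^ l i) := by
    refine Nat.dvd_antisymm (Finset.prod_dvd_prod_of_dvd _ _ fun i hi ↦ ?_) hnorm
    rw [map_pow]
    exact pow_dvd_pow_of_dvd (hdvd i hi) _
  have hle : ∀ j ∈ s, p ^ l j ≤ Ideal.absNorm (P j ^ l j) := fun j hj ↦ by
    rw [map_pow]
    refine Nat.pow_le_pow_left (Nat.le_of_dvd (Nat.pos_of_ne_zero ?_) (hdvd j hj)) _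
    exact fun h ↦ hP0 j hj (Ideal.absNorm_eq_zero_iff.mp h)
  have h : p ^ l i = Ideal.absNorm (P i ^ l i) := (hle i hi).eq_of_not_lt fun hlt ↦
    (Finset.prod_lt_prod (fun j _ ↦ pow_pos hp.pos _) hle ⟨i, hi, hlt⟩).ne heq
  rw [map_pow] at h
  exact (Nat.pow_left_injective (hl i hi) h).symm

variable {E : Type*} [NormedField E]

/-- The absolute value on `𝓞 K` induced by an embedding of `K`. -/
def normOfEmbedding (φ : K →+* E) : 𝓞 K →*₀ ℝ :=
  normHom.comp (φ.comp (algebraMap (𝓞 K) K)).toMonoidWithZeroHom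

theorem normOfEmbedding_apply (φ : K →+* E) (x : 𝓞 K) : normOfEmbedding φ x = ‖φ x‖ := rfl

theorem normOfEmbedding_nonneg (φ : K →+* E) (x : 𝓞 K) : 0 ≤ normOfEmbedding φ x :=
  norm_nonneg (φ x)

variable [IsUltrametricDist E]

theorem norm_ringHom_ringOfIntegers_le_one (φ : K →+* E) (x : 𝓞 K) : ‖φ x‖ ≤ 1 :=
  norm_le_one_of_isIntegral_int (map_isIntegral_int φ x.isIntegral_coe)

/-- The prime ideal of `𝓞 K` cut out by an embedding of `K` in an ultrametric field. -/
def primeOfEmbedding (φ : K →+* E) : Ideal (𝓞 K) where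
  carrier := {x | ‖φ x‖ < 1}
  zero_mem' := by simp
  add_mem' {x y} hx hy := by
    simp only [Set.mem_ofPred_eq, map_add] at *
    exact (IsUltrametricDist.norm_add_le_max _ _).trans_lt (max_lt hx hy)
  smul_mem' c x hx := by
    simp only [Set.mem_ofPred_eq, smul_eq_mul, map_mul, norm_mul] at *
    exact (mul_le_of_le_one_left (norm_nonneg _)
      (norm_ringHom_ringOfIntegers_le_one φ c)).trans_lt hx

theorem mem_primeOfEmbedding {φ : K →+* E} {x : 𝓞 K} : x ∈ primeOfEmbedding φ ↔ ‖φ x‖ < 1 :=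
  Iff.rfl

theorem norm_eq_one_of_notMem_primeOfEmbedding {φ : K →+* E} {x : 𝓞 K}
    (hx : x ∉ primeOfEmbedding φ) : ‖φ x‖ = 1 :=
  (norm_ringHom_ringOfIntegers_le_one φ x).antisymm (not_lt.mp hx)

theorem isPrime_primeOfEmbedding (φ : K →+* E) : (primeOfEmbedding φ).IsPrime := by
  refine Ideal.isPrime_iff.mpr ⟨fun h ↦ ?_, fun {x y} hxy ↦ ?_⟩
  · have := mem_primeOfEmbedding.mp ((Ideal.eq_top_iff_one _).mp h)
    simp at this
  · by_contra! h
    have := mem_primeOfEmbedding.mp hxy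
    simp [norm_eq_one_of_notMem_primeOfEmbedding h.1,
      norm_eq_one_of_notMem_primeOfEmbedding h.2] at this

variable [NumberField K]

theorem primeOfEmbedding_ne_bot (hp : p.Prime) (hpE : ‖(p : E)‖ = (p : ℝ)⁻¹) (φ : K →+* E) :
    (p : 𝓞 K) ∈ primeOfEmbedding φ ∧ primeOfEmbedding φ ≠ ⊥ := by
  have h : (p : 𝓞 K) ∈ primeOfEmbedding φ := by
    simpa [mem_primeOfEmbedding, hpE] using
      inv_lt_one_of_one_lt₀ (show (1 : ℝ) < p by exact_mod_cast hp.one_lt)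
  refine ⟨h, fun hbot ↦ ?_⟩
  rw [hbot, Ideal.mem_bot, Nat.cast_eq_zero] at h
  exact hp.ne_zero h

theorem norm_eq_norm_of_primeOfEmbedding_eq (hp : p.Prime) (hpE : ‖(p : E)‖ = (p : ℝ)⁻¹)
    {φ ψ : K →+* E} (h : primeOfEmbedding φ = primeOfEmbedding ψ) (x : 𝓞 K) :
    ‖φ x‖ = ‖ψ x‖ := by
  rcases eq_or_ne x 0 with rfl | hx
  · simp
  refine map_eq_map_of_eq_one_off_prime (isPrime_primeOfEmbedding φ)
    (primeOfEmbedding_ne_bot hp hpE φ).2 (normOfEmbedding φ) (normOfEmbedding ψ)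
    (fun x hx ↦ norm_eq_one_of_notMem_primeOfEmbedding hx)
    (fun x hx ↦ norm_eq_one_of_notMem_primeOfEmbedding (h ▸ hx))
    (normOfEmbedding_nonneg φ) (normOfEmbedding_nonneg ψ) (a := (p : 𝓞 K))
    (by exact_mod_cast hp.ne_zero) ?_ ?_ hx
  · simp [normOfEmbedding_apply]
  · simp [normOfEmbedding_apply, hpE, hp.ne_one]

theorem natCast_mem_primeOfEmbedding_pow (hp : p.Prime) (hpE : ‖(p : E)‖ = (p : ℝ)⁻¹)
    (φ : K →+* E) {x : 𝓞 K} {l : ℕ} (hx : l ≠ 1 → ‖φ x‖ ^ l = (p : ℝ)⁻¹) :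
    (p : 𝓞 K) ∈ primeOfEmbedding φ ^ l := by
  rcases eq_or_ne l 1 with rfl | hl
  · simpa using (primeOfEmbedding_ne_bot hp hpE φ).1
  refine mem_pow_of_map_pow_eq (isPrime_primeOfEmbedding φ) (primeOfEmbedding_ne_bot hp hpE φ).2
    (normOfEmbedding φ) (fun x hx ↦ norm_eq_one_of_notMem_primeOfEmbedding hx)
    (normOfEmbedding_nonneg φ) (x := x) ?_ ?_ ?_
  · simp [normOfEmbedding_apply, hpE, hp.ne_one]
  · simp [normOfEmbedding_apply, hpE, hp.ne_zero]
  · simp [normOfEmbedding_apply, hpE, hx hl]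

end Global

theorem exists_pow_mul_eq_pow_prime_pow_sub_one {p : ℕ} (hp : p.Prime) {m : ℤ}
    (hval : padicValInt p (m ^ (p - 1) - 1) ≠ 0) {r : ℕ} (hr : r ≠ 0) :
    ∃ g : ℤ, ¬ (p : ℤ) ∣ g ∧
      m ^ (p ^ r - 1) - 1 = (p : ℤ) ^ padicValInt p (m ^ (p - 1) - 1) * g := by
  have := Fact.mk hp
  have hpZ : Prime (p : ℤ) := Nat.prime_iff_prime_int.mp hp
  set ν := padicValInt p (m ^ (p - 1) - 1) with hν
  have h0 : m ^ (p - 1) - 1 ≠ 0 := by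
    intro h
    simp [hν, h] at hval
  obtain ⟨w, hw⟩ : (p : ℤ) ^ ν ∣ m ^ (p - 1) - 1 := padicValInt_dvd _
  have hpw : ¬ (p : ℤ) ∣ w := by
    rintro ⟨w', rfl⟩
    have h1 : (p : ℤ) ^ (ν + 1) ∣ m ^ (p - 1) - 1 := ⟨w', by rw [hw]; ring⟩
    rw [padicValInt_dvd_iff] at h1
    rcases h1 with h1 | h1
    · exact h0 h1
    · omega
  have hpA : (p : ℤ) ∣ m ^ (p - 1) - 1 := (dvd_pow_self _ hval).trans ⟨w, hw⟩
  have hpA' : ¬ (p : ℤ) ∣ m ^ (p - 1) := fun h ↦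
    hpZ.not_dvd_one (by simpa using dvd_sub h hpA)
  obtain ⟨n, hn⟩ : p - 1 ∣ p ^ r - 1 := by simpa using Nat.sub_dvd_pow_sub_pow p 1 r
  have hpn : ¬ (p : ℤ) ∣ (n : ℤ) := by
    intro h
    have h1 : p ∣ p ^ r - 1 := hn ▸ (Int.natCast_dvd_natCast.mp h).mul_left _
    have h2 : p ∣ 1 := by
      have := Nat.dvd_sub (dvd_pow_self p hr) h1
      rwa [Nat.sub_sub_self (Nat.one_le_pow _ _ hp.pos)] at this
    exact hp.one_lt.ne' (Nat.dvd_one.mp h2)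
  refine ⟨w * ∑ i ∈ Finset.range n, (m ^ (p - 1)) ^ i * 1 ^ (n - 1 - i), ?_, ?_⟩
  · exact hpZ.not_dvd_mul hpw (not_dvd_geom_sum₂ hpZ hpA hpA' hpn)
  · rw [← mul_assoc, ← hw, mul_comm, (Commute.one_right _).geom_sum₂_mul, one_pow, hn, pow_mul]

theorem sum_totient_prime_pow {p : ℕ} (hp : p.Prime) (t : ℕ) :
    ∑ i ∈ Finset.range (t + 1), (p ^ i).totient = p ^ t := by
  rw [← Nat.sum_totient (p ^ t), Nat.sum_divisors_prime_pow hp]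

theorem strictMono_totient_prime_pow {p : ℕ} (hp : p.Prime) (hp3 : 3 ≤ p) :
    StrictMono fun i ↦ (p ^ i).totient := by
  refine strictMono_nat_of_lt_succ fun i ↦ ?_
  refine lt_of_le_of_lt (Nat.totient_le _) ?_
  rw [Nat.totient_prime_pow_succ hp]
  exact lt_mul_of_one_lt_right (pow_pos hp.pos i) (by omega)

/-- Let `p` be an odd prime, `r ≥ p`, and `m ≠ 1` a squarefree integer not divisible
by `p` with `ν_p(m^(p-1) - 1) > p`, such that `x^(p^r) - m` is irreducible over `ℚ`.
Then there are at least `p + 1` distinct nonzero prime ideals of `Z_K` lying above `p`,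
each with residue degree `1` (i.e. residue field of cardinality `p`). -/
theorem exists_many_primes_above_p_of_padicValInt_gt
    (p r : ℕ) (hp : p.Prime) (hodd : Odd p) (hrp : p ≤ r)
    (m : ℤ) (hm : Squarefree m) (hm1 : m ≠ 1) (hpm : ¬ (p : ℤ) ∣ m)
    (hval : p < padicValInt p (m ^ (p - 1) - 1))
    (hF : Irreducible ((X : ℚ[X]) ^ p ^ r - C (m : ℚ)))
    (K : Type*) [Field K] [NumberField K] (α : 𝓞 K)
    (hgen : IntermediateField.adjoin ℚ {(α : K)} = ⊤)
    (hroot : (α : K) ^ p ^ r = (m : K)) :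
    ∃ S : Finset (Ideal (𝓞 K)), p + 1 ≤ S.card ∧
      ∀ P ∈ S, P.IsPrime ∧ P ≠ ⊥ ∧ (p : 𝓞 K) ∈ P ∧ Nat.card (𝓞 K ⧸ P) = p := by
  classical
  have := Fact.mk hp
  have hp3 : 3 ≤ p := by
    have := hp.two_le
    rcases hodd with ⟨k, rfl⟩
    omega
  have hr0 : r ≠ 0 := by omega
  have hnormZ : ∀ k : ℤ, ‖(k : PadicAlgCl p)‖ = ‖(k : ℚ_[p])‖ := fun k ↦ by
    rw [← PadicAlgCl.norm_extends p (k : ℚ_[p]), map_intCast]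
  have hpE : ‖(p : PadicAlgCl p)‖ = (p : ℝ)⁻¹ := by
    rw [← Padic.norm_p, ← Int.cast_natCast (R := PadicAlgCl p), hnormZ, Int.cast_natCast]
  have hunit : ∀ k : ℤ, ¬ (p : ℤ) ∣ k → ‖(k : PadicAlgCl p)‖ = 1 := fun k hk ↦ by
    rw [hnormZ]
    refine (Padic.norm_int_le_one k).antisymm (not_lt.mp fun h ↦ hk ?_)
    exact Padic.norm_intCast_lt_one_iff.mp h
  set ν := padicValInt p (m ^ (p - 1) - 1) with hν
  obtain ⟨g, hg, hmg⟩ := exists_pow_mul_eq_pow_prime_pow_sub_one hp (m := m)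
    (by omega) hr0
  rw [← hν] at hmg
  have hm0 : (m : PadicAlgCl p) ≠ 0 := by
    intro h
    have := hunit m hpm
    rw [h, norm_zero] at this
    exact zero_ne_one this
  have hr1 : p ^ r ≠ 0 := pow_ne_zero _ hp.ne_zero
  have hu : ‖(m : PadicAlgCl p) / (m : PadicAlgCl p) ^ p ^ r - 1‖ = (p : ℝ)⁻¹ ^ ν := by
    have h1 : (m : PadicAlgCl p) / (m : PadicAlgCl p) ^ p ^ r - 1 =
        -(((p : PadicAlgCl p) ^ ν * g) * m / (m : PadicAlgCl p) ^ p ^ r) := by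
      have h2 : (m : PadicAlgCl p) ^ (p ^ r - 1) - 1 = (p : PadicAlgCl p) ^ ν * g := by
        exact_mod_cast congrArg (Int.cast : ℤ → PadicAlgCl p) hmg
      rw [← h2, sub_mul, pow_sub_one_mul hr1, div_sub_one (pow_ne_zero _ hm0)]
      ring
    rw [h1, norm_neg, norm_div, norm_mul, norm_mul, norm_pow, norm_pow, hunit m hpm, hunit g hg,
      hpE]
    simp
  obtain ⟨t, hpt, htr, htν, ht⟩ : ∃ t, p ≤ t ∧ t ≤ r ∧ t < ν ∧ (t = r ∨ ν = t + 1) := by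
    rcases le_or_gt ν r with h | h
    · exact ⟨ν - 1, by omega, by omega, by omega, by omega⟩
    · exact ⟨r, hrp, le_rfl, h, .inl rfl⟩
  have hmonic : ((X : ℚ[X]) ^ p ^ r - C (m : ℚ)).Monic := monic_X_pow_sub_C _ hr1
  have hmin : minpoly ℚ (α : K) = X ^ p ^ r - C (m : ℚ) := by
    refine (minpoly.eq_of_irreducible_of_monic hF ?_ hmonic).symm
    simp [hroot]
  have hdeg : Module.finrank ℚ K = p ^ r := by
    rw [← IntermediateField.finrank_top', ← hgen,
      IntermediateField.adjoin.finrank (Algebra.IsIntegral.isIntegral _), hmin,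
      natDegree_X_pow_sub_C]
  let l : ℕ → ℕ := fun i ↦ p ^ (r - t) * (p ^ i).totient
  have hlmono : StrictMono l := fun i j hij ↦
    Nat.mul_lt_mul_of_pos_left (strictMono_totient_prime_pow hp hp3 hij) (pow_pos hp.pos _)
  have hl0 : ∀ i, l i ≠ 0 := fun i ↦ mul_ne_zero (pow_ne_zero _ hp.ne_zero)
    (Nat.totient_pos.mpr (pow_pos hp.pos i)).ne'
  have hlsum : ∑ i ∈ Finset.range (t + 1), l i = Module.finrank ℚ K := by
    rw [← Finset.mul_sum, sum_totient_prime_pow hp, ← pow_add, Nat.sub_add_cancel htr, hdeg]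
  let x : 𝓞 K := α - m
  have hφ : ∀ i, ∃ φ : K →+* PadicAlgCl p, i ≤ t → ‖φ x‖ < 1 ∧ ‖φ x‖ ^ l i ≤ (p : ℝ)⁻¹ ∧
      (l i ≠ 1 → ‖φ x‖ ^ l i = (p : ℝ)⁻¹) := fun i ↦ by
    by_cases hi : i ≤ t
    · obtain ⟨y, hy, hy1, hy2, hy3⟩ :=
        exists_pow_prime_pow_eq_norm_sub_one_pow hp hp3 hpE htr htν ht hu hi
      obtain ⟨φ, hφ⟩ := IntermediateField.exists_algHom_of_splits_of_aeval (F := ℚ) (E := K)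
        (K := PadicAlgCl p) (x := (α : K)) (y := (m : PadicAlgCl p) * y)
        (fun s ↦ ⟨Algebra.IsIntegral.isIntegral s, IsAlgClosed.splits _⟩) (by
          rw [hmin]
          simp [mul_pow, hy, mul_div_cancel₀ _ (pow_ne_zero (p ^ r) hm0)])
      have hx : ‖φ x‖ = ‖y - 1‖ := by
        have : φ x = (m : PadicAlgCl p) * (y - 1) := by
          simp [x, hφ, mul_sub]
        rw [this, norm_mul, hunit m hpm, one_mul]
      exact ⟨φ, fun _ ↦ by simpa [hx] using ⟨hy1, hy2, hy3⟩⟩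
    · obtain ⟨φ⟩ : Nonempty (K →ₐ[ℚ] PadicAlgCl p) := ⟨IsAlgClosed.lift⟩
      exact ⟨φ, fun h ↦ absurd h hi⟩
  choose φ hφ using hφ
  have hlt : ∀ i j, i ≤ t → j ≤ t → i < j → primeOfEmbedding (φ i) ≠ primeOfEmbedding (φ j) := by
    intro i j hi hj hij h
    have hl1 : l j ≠ 1 := by
      have := hlmono hij
      have := hl0 i
      omega
    have hxeq := norm_eq_norm_of_primeOfEmbedding_eq hp hpE h x
    have hq0 : 0 < (p : ℝ)⁻¹ := inv_pos.mpr (by exact_mod_cast hp.pos)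
    obtain ⟨hj1, -, hj3⟩ := hφ j hj
    have hpos : 0 < ‖φ j x‖ := by
      refine (norm_nonneg _).lt_of_ne fun h0 ↦ ?_
      have := hj3 hl1
      rw [← h0, zero_pow (hl0 j)] at this
      exact hq0.ne this
    have h1 := (hφ i hi).2.1
    rw [hxeq, ← hj3 hl1] at h1
    exact absurd h1 (not_le.mpr (pow_lt_pow_right_of_lt_one₀ hpos hj1 (hlmono hij)))
  have hinj : Set.InjOn (fun i ↦ primeOfEmbedding (φ i)) (Finset.range (t + 1)) := by
    intro i hi j hj h
    simp only [Finset.coe_range, Set.mem_Iio, Nat.lt_succ_iff] at hi hj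
    rcases lt_trichotomy i j with hij | hij | hij
    · exact absurd h (hlt i j hi hj hij)
    · exact hij
    · exact absurd h.symm (hlt j i hj hi hij)
  refine ⟨(Finset.range (t + 1)).image fun i ↦ primeOfEmbedding (φ i), ?_, ?_⟩
  · rw [Finset.card_image_of_injOn hinj, Finset.card_range]
    omega
  · intro P hP
    obtain ⟨i, hi, rfl⟩ := Finset.mem_image.mp hP
    refine ⟨isPrime_primeOfEmbedding _, (primeOfEmbedding_ne_bot hp hpE _).2,
      (primeOfEmbedding_ne_bot hp hpE _).1, ?_⟩
    exact absNorm_eq_of_mem_pow_of_sum_eq_finrank hp (Finset.range (t + 1))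
      (fun i ↦ primeOfEmbedding (φ i)) (fun i _ ↦ isPrime_primeOfEmbedding _)
      (fun i _ ↦ (primeOfEmbedding_ne_bot hp hpE _).2) hinj l (fun i _ ↦ hl0 i)
      (fun i hi ↦ natCast_mem_primeOfEmbedding_pow hp hpE _
        (hφ i (Nat.lt_succ_iff.mp (Finset.mem_range.mp hi))).2.2) hlsum hi
end

section
/- Let m ≠ 1 be a squarefree rational integer with m ≡ 1 (mod 16), such that F(x) = x^4 − m is irreducible over ℚ. Let α be a complex root of F and K = ℚ(α) with ring of integers Z_K. Then there are at least 3 distinct nonzero prime ideals of Z_K lying above 2, each with residue degree 1 over 2. -/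
open Polynomial NumberField

/-- The ring `ℤ₂[i]`. -/
abbrev TwoAdicGaussianInt : Type := QuadraticAlgebra ℤ_[2] (-1) 0

/-- The `ℚ₂`-algebra `ℚ₂(i)`. -/
abbrev TwoAdicGaussian : Type := QuadraticAlgebra ℚ_[2] (-1) 0

namespace TwoAdicGaussianInt

/-- The inclusion of `ℤ₂[i]` into `ℚ₂(i)`. -/
noncomputable def toField : TwoAdicGaussianInt →+* TwoAdicGaussian where
  toFun z := ⟨z.re, z.im⟩
  map_one' := by ext <;> simp [QuadraticAlgebra.re_one, QuadraticAlgebra.im_one]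
  map_zero' := by ext <;> simp
  map_add' z w := by ext <;> simp
  map_mul' z w := by ext <;> simp

theorem toField_injective : Function.Injective toField := by
  intro z w h
  obtain ⟨hre, him⟩ := QuadraticAlgebra.ext_iff.1 h
  exact QuadraticAlgebra.ext (Subtype.coe_injective hre) (Subtype.coe_injective him)

/-- Reduction of `ℤ₂[i]` modulo its maximal ideal `(1 + i)`. -/
noncomputable def residue : TwoAdicGaussianInt →+* ZMod 2 where
  toFun z := PadicInt.toZMod (z.re + z.im)
  map_one' := by simp [QuadraticAlgebra.re_one, QuadraticAlgebra.im_one]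
  map_zero' := by simp
  map_add' z w := by simp; ring
  map_mul' z w := by
    simp only [QuadraticAlgebra.re_mul, QuadraticAlgebra.im_mul, map_add, map_mul, map_neg,
      map_one, map_zero]
    generalize PadicInt.toZMod z.re = a
    generalize PadicInt.toZMod z.im = b
    generalize PadicInt.toZMod w.re = c
    generalize PadicInt.toZMod w.im = d
    revert a b c d
    decide

theorem residue_eq_of_algebraMap_mul_eq {z : TwoAdicGaussianInt} {n u : ℤ_[2]} (hn : n ≠ 0)
    (h : algebraMap ℤ_[2] TwoAdicGaussianInt n * z = algebraMap _ _ (n * u)) :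
    residue z = PadicInt.toZMod u := by
  have hre : z.re = u := by
    simpa [QuadraticAlgebra.algebraMap_eq, hn] using congrArg QuadraticAlgebra.re h
  have him : z.im = 0 := by
    simpa [QuadraticAlgebra.algebraMap_eq, hn] using congrArg QuadraticAlgebra.im h
  change PadicInt.toZMod (z.re + z.im) = _
  rw [hre, him, add_zero]

end TwoAdicGaussianInt

theorem PadicInt.exists_coe_eq_of_isIntegral {p : ℕ} [Fact p.Prime] {x : ℚ_[p]}
    (hx : IsIntegral ℤ x) : ∃ y : ℤ_[p], (y : ℚ_[p]) = x :=
  IsIntegrallyClosed.isIntegral_iff.1 (hx.tower_top (A := ℤ_[p]))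

theorem PadicInt.two_dvd_iff_toZMod_eq_zero (x : ℤ_[2]) :
    2 ∣ x ↔ PadicInt.toZMod x = 0 := by
  rw [← RingHom.mem_ker, PadicInt.ker_toZMod, PadicInt.maximalIdeal_eq_span_p,
    Ideal.mem_span_singleton]
  norm_num

theorem PadicInt.two_dvd_of_four_dvd_sq_add_sq {x y : ℤ_[2]} (h : 4 ∣ x ^ 2 + y ^ 2) :
    2 ∣ x ∧ 2 ∣ y := by
  obtain ⟨n, hn⟩ := h
  have h2 : (2 : ℤ_[2]) ≠ 0 := two_ne_zero
  have hdiff : 2 ∣ y - x := by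
    rw [two_dvd_iff_toZMod_eq_zero]
    have := congrArg (PadicInt.toZMod (p := 2)) hn
    simp only [map_add, map_mul, map_pow, map_sub, map_ofNat] at this ⊢
    generalize PadicInt.toZMod x = a at *
    generalize PadicInt.toZMod y = b at *
    generalize PadicInt.toZMod n = c at *
    revert a b c
    decide
  obtain ⟨d, hd⟩ := hdiff
  obtain rfl : y = x + 2 * d := by linear_combination hd
  have hx : x ^ 2 = 2 * (n - x * d - d ^ 2) := by
    apply mul_left_cancel₀ h2
    linear_combination hn
  have hprime : Prime (2 : ℤ_[2]) := by exact_mod_cast PadicInt.prime_p (p := 2)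
  have hx2 : 2 ∣ x := hprime.dvd_of_dvd_pow ⟨_, hx⟩
  exact ⟨hx2, dvd_add hx2 (dvd_mul_right _ _)⟩

theorem TwoAdicGaussianInt.exists_toField_eq_of_isIntegral {z : TwoAdicGaussian}
    (hz : IsIntegral ℤ z) : ∃ w, TwoAdicGaussianInt.toField w = z := by
  have hstar : IsIntegral ℤ (star z) := hz.map (starRingEnd TwoAdicGaussian).toIntAlgHom
  have hinj : Function.Injective (algebraMap ℚ_[2] TwoAdicGaussian).toIntAlgHom :=
    QuadraticAlgebra.algebraMap_injective
  have htrace : IsIntegral ℤ (2 * z.re) := by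
    rw [← isIntegral_algHom_iff _ hinj]
    convert! hz.add hstar using 1
    ext <;> simp [two_mul, QuadraticAlgebra.algebraMap_eq]
  have hnorm : IsIntegral ℤ (z.re ^ 2 + z.im ^ 2) := by
    rw [← isIntegral_algHom_iff _ hinj]
    convert! hz.mul hstar using 1
    ext <;> simp [QuadraticAlgebra.algebraMap_eq] <;> ring
  obtain ⟨t, ht⟩ := PadicInt.exists_coe_eq_of_isIntegral htrace
  obtain ⟨n, hn⟩ := PadicInt.exists_coe_eq_of_isIntegral hnorm
  have him : IsIntegral ℤ_[2] (2 * z.im) := by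
    refine IsIntegral.of_pow two_pos ?_
    have : (2 * z.im) ^ 2 = algebraMap ℤ_[2] ℚ_[2] (4 * n - t ^ 2) := by
      change _ = ((4 * n - t ^ 2 : ℤ_[2]) : ℚ_[2])
      push_cast
      rw [ht, hn]
      change _ = 4 * _ - _
      ring
    rw [this]
    exact isIntegral_algebraMap
  obtain ⟨s, hs⟩ := IsIntegrallyClosed.isIntegral_iff.1 him
  change (s : ℚ_[2]) = _ at hs
  have hsum : t ^ 2 + s ^ 2 = 4 * n := by
    apply Subtype.coe_injective
    push_cast
    rw [ht, hn, hs]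
    change _ = 4 * _
    ring
  obtain ⟨⟨x, rfl⟩, ⟨y, rfl⟩⟩ := PadicInt.two_dvd_of_four_dvd_sq_add_sq ⟨n, hsum⟩
  push_cast at ht hs
  refine ⟨⟨x, y⟩, ?_⟩
  ext
  · exact mul_left_cancel₀ two_ne_zero ht
  · exact mul_left_cancel₀ two_ne_zero hs

/-- Ring homomorphisms `K → ℚ₂(i)` restrict to `𝓞 K → ℤ₂[i]`. -/
theorem NumberField.exists_ringHom_twoAdicGaussianInt {K : Type*} [Field K]
    (f : K →+* TwoAdicGaussian) :
    ∃ g : 𝓞 K →+* TwoAdicGaussianInt, ∀ z : 𝓞 K, TwoAdicGaussianInt.toField (g z) = f z := by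
  have hint (z : 𝓞 K) : ∃ w, TwoAdicGaussianInt.toField w = f z :=
    TwoAdicGaussianInt.exists_toField_eq_of_isIntegral
      ((RingOfIntegers.isIntegral_coe z).map f.toIntAlgHom)
  choose g hg using hint
  refine ⟨{ toFun := g, map_one' := ?_, map_zero' := ?_, map_add' := ?_, map_mul' := ?_ }, hg⟩
  all_goals
    intros
    apply TwoAdicGaussianInt.toField_injective
    simp [hg]

/-- Units of `ℤ₂` congruent to `1` modulo `16` are fourth powers. -/
theorem PadicInt.exists_one_add_four_mul_pow_four_eq (k : ℤ_[2]) :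
    ∃ t : ℤ_[2], (1 + 4 * t) ^ 4 = 1 + 16 * k := by
  let F : ℤ_[2][X] := 16 * X ^ 4 + 16 * X ^ 3 + 6 * X ^ 2 + X - C k
  have hF (t : ℤ_[2]) : aeval t F = 16 * t ^ 4 + 16 * t ^ 3 + 6 * t ^ 2 + t - k := by simp [F]
  have hF' : aeval k (derivative F) = 1 + 2 * (32 * k ^ 3 + 24 * k ^ 2 + 6 * k) := by
    simp [F]
    ring
  have hunit : ‖aeval k (derivative F)‖ = 1 := by
    rw [← PadicInt.isUnit_iff]
    by_contra h
    rw [← mem_nonunits_iff, ← IsLocalRing.mem_maximalIdeal, ← PadicInt.ker_toZMod,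
      RingHom.mem_ker, ← two_dvd_iff_toZMod_eq_zero, hF', dvd_add_left (dvd_mul_right _ _),
      two_dvd_iff_toZMod_eq_zero, map_one] at h
    exact one_ne_zero h
  have hnorm : ‖aeval k F‖ < ‖aeval k (derivative F)‖ ^ 2 := by
    rw [hunit, one_pow, PadicInt.norm_lt_one_iff_dvd, hF]
    exact ⟨8 * k ^ 4 + 8 * k ^ 3 + 3 * k ^ 2, by push_cast; ring⟩
  obtain ⟨t, ht, -⟩ := hensels_lemma hnorm
  rw [hF] at ht
  exact ⟨t, by linear_combination 16 * ht⟩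

theorem exists_algHom_apply_eq_of_adjoin_eq_top {F K A : Type*} [Field F] [Field K] [Algebra F K]
    [CommRing A] [Algebra F A] {x : K} {f : F[X]} (hf : Irreducible f) (hmonic : f.Monic)
    (hx : aeval x f = 0) (hgen : IntermediateField.adjoin F {x} = ⊤) {y : A}
    (hy : aeval y f = 0) : ∃ φ : K →ₐ[F] A, φ x = y := by
  have hint : IsIntegral F x := ⟨f, hmonic, hx⟩
  have htop : Algebra.adjoin F {x} = ⊤ := by
    rw [← IntermediateField.adjoin_simple_toSubalgebra_of_isAlgebraic hint.isAlgebraic, hgen,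
      IntermediateField.top_toSubalgebra]
  let pb := PowerBasis.ofAdjoinEqTop' hint htop
  have hpb : pb.gen = x := PowerBasis.ofAdjoinEqTop'_gen hint htop
  have hmin : aeval y (minpoly F pb.gen) = 0 := by
    rw [hpb, ← minpoly.eq_of_irreducible_of_monic hf hx hmonic, hy]
  exact ⟨pb.lift y hmin, by rw [← hpb, pb.lift_gen]⟩

theorem RingHom.ker_isPrime_and_card_quotient_eq_two {R : Type*} [CommRing R] [CharZero R]
    (φ : R →+* ZMod 2) : (RingHom.ker φ).IsPrime ∧ RingHom.ker φ ≠ ⊥ ∧ (2 : R) ∈ RingHom.ker φ ∧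
      Nat.card (R ⧸ RingHom.ker φ) = 2 := by
  have htwo : (2 : R) ∈ RingHom.ker φ := by
    rw [RingHom.mem_ker, map_ofNat]
    rfl
  refine ⟨RingHom.ker_isPrime φ, ?_, htwo, ?_⟩
  · intro h
    rw [h, Ideal.mem_bot] at htwo
    exact two_ne_zero htwo
  · rw [Nat.card_congr (RingHom.quotientKerEquivOfSurjective
      (ZMod.ringHom_surjective φ)).toEquiv, Nat.card_zmod]

/-- Let `m ≠ 1` be a squarefree integer with `m ≡ 1 (mod 16)` such that `x^4 - m`
is irreducible over `ℚ`, and let `K = ℚ(α)` for a root `α`. Then there are at least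
`3` distinct nonzero prime ideals of `Z_K` lying above `2`, each with residue degree
`1` (i.e. residue field of cardinality `2`). -/
theorem exists_three_primes_above_two_quartic
    (m : ℤ) (hm : Squarefree m) (hm1 : m ≠ 1) (hmod : m ≡ 1 [ZMOD 16])
    (hF : Irreducible ((X : ℚ[X]) ^ 4 - C (m : ℚ)))
    (K : Type*) [Field K] [NumberField K] (α : 𝓞 K)
    (hgen : IntermediateField.adjoin ℚ {(α : K)} = ⊤)
    (hroot : (α : K) ^ 4 = (m : K)) :
    ∃ S : Finset (Ideal (𝓞 K)), 3 ≤ S.card ∧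
      ∀ P ∈ S, P.IsPrime ∧ P ≠ ⊥ ∧ (2 : 𝓞 K) ∈ P ∧ Nat.card (𝓞 K ⧸ P) = 2 := by
  obtain ⟨k, hk⟩ := hmod.symm.dvd
  obtain ⟨t, ht⟩ := PadicInt.exists_one_add_four_mul_pow_four_eq (k : ℤ_[2])
  have hmk : m = 1 + 16 * k := by linear_combination hk
  have hmK : (α : K) ^ 4 = 1 + 16 * (k : K) := by rw [hroot, hmk]; push_cast; ring
  obtain ⟨β, hβ⟩ : ∃ β : 𝓞 K, 2 * β = 1 + α ^ 2 := by
    have hint : IsIntegral ℤ ((1 + (α : K) ^ 2) / 2) := by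
      refine ⟨X ^ 2 - X - C (4 * k), by monicity!, ?_⟩
      rw [← aeval_def]
      simp only [map_sub, map_mul, map_pow, aeval_X, aeval_C, algebraMap_int_eq,
        Int.coe_castRingHom, map_ofNat]
      linear_combination hmK / 4
    obtain ⟨b, hb⟩ : ∃ b : 𝓞 K, (b : K) = (1 + (α : K) ^ 2) / 2 := ⟨⟨_, hint⟩, rfl⟩
    refine ⟨b, RingOfIntegers.coe_injective ?_⟩
    simp only [map_mul, map_add, map_pow, map_one, map_ofNat, hb]
    ring
  obtain ⟨γ, hγ⟩ : ∃ γ : 𝓞 K, 4 * γ = (1 + α) * (1 + α ^ 2) := by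
    have hint : IsIntegral ℤ ((1 + (α : K)) * (1 + (α : K) ^ 2) / 4) := by
      refine ⟨X ^ 4 - X ^ 3 - C (2 * k) * X ^ 2 - C (4 * k) * (X + C (2 * k)) ^ 2,
        by monicity!, ?_⟩
      have hk' : (k : K) = ((α : K) ^ 4 - 1) / 16 := by rw [hmK]; ring
      rw [← aeval_def]
      simp only [map_sub, map_add, map_mul, map_pow, aeval_X, aeval_C, algebraMap_int_eq,
        Int.coe_castRingHom, map_ofNat, hk']
      ring
    obtain ⟨c, hc⟩ : ∃ c : 𝓞 K, (c : K) = (1 + (α : K)) * (1 + (α : K) ^ 2) / 4 :=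
      ⟨⟨_, hint⟩, rfl⟩
    refine ⟨c, RingOfIntegers.coe_injective ?_⟩
    simp only [map_mul, map_add, map_pow, map_one, map_ofNat, hc]
    ring
  have key (y : TwoAdicGaussianInt) (hy : y ^ 4 = (m : TwoAdicGaussianInt)) :
      ∃ g : 𝓞 K →+* TwoAdicGaussianInt, g α = y := by
    obtain ⟨f, hf⟩ := exists_algHom_apply_eq_of_adjoin_eq_top (x := (α : K))
      (y := TwoAdicGaussianInt.toField y) hF (by monicity!) (by simp [hroot]) hgen
      (by rw [map_sub, map_pow, aeval_X, aeval_C, ← map_pow, hy]; simp)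
    obtain ⟨g, hg⟩ := NumberField.exists_ringHom_twoAdicGaussianInt (f : K →+* TwoAdicGaussian)
    exact ⟨g, TwoAdicGaussianInt.toField_injective ((hg α).trans hf)⟩
  let ι : ℤ_[2] →+* TwoAdicGaussianInt := algebraMap _ _
  have hpow : ι (1 + 4 * t) ^ 4 = (m : TwoAdicGaussianInt) := by
    rw [← map_pow, ht, hmk, map_add, map_mul, map_intCast, map_one, map_ofNat]
    push_cast
    rfl
  have hsq : (⟨0, 1 + 4 * t⟩ : TwoAdicGaussianInt) ^ 2 = ι (-(1 + 4 * t) ^ 2) := by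
    ext <;> simp [ι, QuadraticAlgebra.algebraMap_eq, sq]
    ring
  obtain ⟨g₁, hg₁⟩ := key (ι (1 + 4 * t)) hpow
  obtain ⟨g₂, hg₂⟩ := key (ι (-(1 + 4 * t))) (by rw [map_neg, Even.neg_pow (by decide), hpow])
  obtain ⟨g₃, hg₃⟩ := key ⟨0, 1 + 4 * t⟩ (by
    rw [pow_mul _ 2 2, hsq, ← hpow, ← map_pow, ← map_pow]
    ring_nf)
  have hβ_residue (g : 𝓞 K →+* TwoAdicGaussianInt) (s u : ℤ_[2]) (hs : g α ^ 2 = ι s)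
      (hu : 1 + s = 2 * u) : TwoAdicGaussianInt.residue (g β) = PadicInt.toZMod u := by
    apply TwoAdicGaussianInt.residue_eq_of_algebraMap_mul_eq two_ne_zero
    change ι 2 * g β = ι (2 * u)
    rw [← hu, map_add, ← hs, map_ofNat, ← map_ofNat g, ← map_mul, hβ]
    simp
  have hγ_residue (g : 𝓞 K →+* TwoAdicGaussianInt) (y u : ℤ_[2]) (hy : g α = ι y)
      (hu : (1 + y) * (1 + y ^ 2) = 4 * u) :
      TwoAdicGaussianInt.residue (g γ) = PadicInt.toZMod u := by
    apply TwoAdicGaussianInt.residue_eq_of_algebraMap_mul_eq (n := 4) (by norm_num)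
    change ι 4 * g γ = ι (4 * u)
    rw [← hu, map_ofNat, ← map_ofNat g, ← map_mul, hγ]
    simp [hy]
  have h2 : (2 : ZMod 2) = 0 := rfl
  have h₁β := hβ_residue g₁ _ (1 + 2 * (2 * t + 4 * t ^ 2)) (by rw [hg₁, map_pow]) (by ring)
  have h₂β := hβ_residue g₂ _ (1 + 2 * (2 * t + 4 * t ^ 2)) (by rw [hg₂, ← map_pow]) (by ring)
  have h₃β := hβ_residue g₃ _ (2 * (-2 * t - 4 * t ^ 2)) (by rw [hg₃, hsq]) (by ring)
  have h₁γ := hγ_residue g₁ _ (1 + 2 * (3 * t + 8 * t ^ 2 + 8 * t ^ 3)) hg₁ (by ring)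
  have h₂γ := hγ_residue g₂ _ (2 * (-t * (1 + 4 * t + 8 * t ^ 2))) hg₂ (by ring)
  rw [map_add, map_mul, map_ofNat, h2, zero_mul, map_one, add_zero] at h₁β h₂β h₁γ
  rw [map_mul, map_ofNat, h2, zero_mul] at h₃β h₂γ
  let 𝔭 (g : 𝓞 K →+* TwoAdicGaussianInt) : Ideal (𝓞 K) :=
    RingHom.ker (TwoAdicGaussianInt.residue.comp g)
  have hne (g g' : 𝓞 K →+* TwoAdicGaussianInt) (z : 𝓞 K)
      (hz : TwoAdicGaussianInt.residue (g z) = 1) (hz' : TwoAdicGaussianInt.residue (g' z) = 0) :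
      𝔭 g ≠ 𝔭 g' := by
    intro h
    have hmem : z ∈ 𝔭 g := h ▸ hz'
    exact one_ne_zero (hz.symm.trans hmem)
  classical
  refine ⟨{𝔭 g₁, 𝔭 g₂, 𝔭 g₃}, ?_, ?_⟩
  · rw [Finset.card_eq_three.2 ⟨_, _, _, hne g₁ g₂ γ h₁γ h₂γ, hne g₁ g₃ β h₁β h₃β,
      hne g₂ g₃ β h₂β h₃β, rfl⟩]
  · intro P hP
    simp only [Finset.mem_insert, Finset.mem_singleton] at hP
    rcases hP with rfl | rfl | rfl <;> exact RingHom.ker_isPrime_and_card_quotient_eq_two _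
end

section
/- Let r ≥ 3 be an integer and m ≠ 1 a squarefree rational integer with m ≡ 1 (mod 32), such that F(x) = x^(2^r) − m is irreducible over ℚ. Let α be a complex root of F and K = ℚ(α) with ring of integers Z_K. Then there are at least 3 distinct nonzero prime ideals of Z_K lying above 2, each with residue degree 1 over 2. -/
open Polynomial NumberField

theorem isTorsionFree_of_padic_algebra {p : ℕ} [Fact p.Prime] {L : Type*} [Field L]
    [Algebra ℚ_[p] L] [Algebra ℤ_[p] L] [IsScalarTower ℤ_[p] ℚ_[p] L] :
    Module.IsTorsionFree ℤ_[p] L := by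
  rw [Module.isTorsionFree_iff_algebraMap_injective, IsScalarTower.algebraMap_eq ℤ_[p] ℚ_[p] L]
  exact (algebraMap ℚ_[p] L).injective.comp (IsFractionRing.injective ℤ_[p] ℚ_[p])

/-- A ring of integers generated by a root of an Eisenstein polynomial over `ℤ_[p]` is totally
ramified, so it has a residue map to `ZMod p`. -/
theorem nonempty_integralClosure_ringHom_zmod_of_isEisensteinAt {p : ℕ} [Fact p.Prime]
    {L : Type*} [Field L] [Algebra ℚ_[p] L] [Algebra ℤ_[p] L] [IsScalarTower ℤ_[p] ℚ_[p] L]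
    (B : PowerBasis ℚ_[p] L) (hint : IsIntegral ℤ_[p] B.gen)
    (hE : (minpoly ℤ_[p] B.gen).IsEisensteinAt (Ideal.span {(p : ℤ_[p])})) :
    Nonempty (integralClosure ℤ_[p] L →+* ZMod p) := by
  have hle : integralClosure ℤ_[p] L ≤ Algebra.adjoin ℤ_[p] {B.gen} := by
    intro z hz
    obtain ⟨q, hq⟩ := B.exists_eq_aeval' z
    obtain ⟨d, hdmem, hd⟩ := IsLocalization.integerNormalization_spec (nonZeroDivisors ℤ_[p]) q
    have hd0 : d ≠ 0 := nonZeroDivisors.ne_zero hdmem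
    have hdz : d • z ∈ Algebra.adjoin ℤ_[p] {B.gen} := by
      have h := congrArg (aeval B.gen) hd
      rw [aeval_map_algebraMap, ← algebraMap_smul ℚ_[p], map_smul,
        algebraMap_smul, ← hq] at h
      rw [← h]
      exact aeval_mem_adjoin_singleton _ _
    refine mem_adjoin_of_smul_prime_pow_smul_of_minpoly_isEisensteinAt (K := ℚ_[p])
      (n := d.valuation) PadicInt.prime_p hint hz ?_ hE
    have h := (Algebra.adjoin ℤ_[p] {B.gen}).smul_mem hdz
      ((PadicInt.unitCoeff hd0)⁻¹ : ℤ_[p]ˣ)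
    rwa [smul_smul, (Units.inv_mul_eq_iff_eq_mul _).2 (PadicInt.unitCoeff_spec hd0)] at h
  have := isTorsionFree_of_padic_algebra (p := p) (L := L)
  have hroot : (minpoly ℤ_[p] B.gen).eval₂ PadicInt.toZMod 0 = 0 := by
    have h0 : (minpoly ℤ_[p] B.gen).coeff 0 ∈ Ideal.span {(p : ℤ_[p])} :=
      hE.mem (minpoly.natDegree_pos hint)
    rw [eval₂_at_zero, ← RingHom.mem_ker, PadicInt.ker_toZMod, PadicInt.maximalIdeal_eq_span_p]
    exact h0
  exact ⟨(AdjoinRoot.lift PadicInt.toZMod 0 hroot).comp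
    ((minpoly.equivAdjoin hint).symm.toAlgHom.comp (Subalgebra.inclusion hle)).toRingHom⟩

theorem X_add_one_pow_two_pow_add_C_monic {R : Type*} [CommRing R] [Nontrivial R]
    (t : ℕ) (c : R) : ((X + 1 : R[X]) ^ 2 ^ t + C c).Monic := by
  have h : ((X : R[X]) ^ 2 ^ t + C c).Monic := monic_X_pow_add_C c (by positivity)
  simpa using h.comp_X_add_C 1

theorem X_add_one_pow_two_pow_add_C_natDegree {R : Type*} [CommRing R] [Nontrivial R]
    (t : ℕ) (c : R) : ((X + 1 : R[X]) ^ 2 ^ t + C c).natDegree = 2 ^ t := by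
  rw [natDegree_add_C, ← C_1, natDegree_pow_X_add_C]

theorem X_add_one_pow_two_pow_add_C_isEisensteinAt (t : ℕ) (d : ℤ_[2]) :
    ((X + 1 : ℤ_[2][X]) ^ 2 ^ t + C (1 + 4 * d)).IsEisensteinAt
      (Ideal.span {((2 : ℕ) : ℤ_[2])}) := by
  have hp : Prime ((2 : ℕ) : ℤ_[2]) := PadicInt.prime_p
  refine ⟨?_, ?_, ?_⟩
  · rw [(X_add_one_pow_two_pow_add_C_monic t _).leadingCoeff, Ideal.mem_span_singleton]
    exact fun h => hp.not_isUnit (isUnit_of_dvd_one h)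
  · intro n hn
    rw [X_add_one_pow_two_pow_add_C_natDegree] at hn
    rw [Ideal.mem_span_singleton, coeff_add, coeff_X_add_one_pow]
    rcases eq_or_ne n 0 with rfl | h0
    · rw [coeff_C_zero]
      exact ⟨1 + 2 * d, by push_cast; simp; ring⟩
    · rw [coeff_C_of_ne_zero h0, add_zero]
      exact_mod_cast Nat.cast_dvd_cast (Nat.prime_two.dvd_choose_pow h0 hn.ne)
  · rw [Ideal.span_singleton_pow, Ideal.mem_span_singleton, coeff_add, coeff_X_add_one_pow,
      coeff_C_zero]
    rintro ⟨e, he⟩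
    refine hp.not_isUnit (isUnit_of_dvd_one ⟨e - d, ?_⟩)
    have h2 : (2 : ℤ_[2]) ≠ 0 := two_ne_zero
    apply mul_left_cancel₀ h2
    push_cast at he ⊢
    simp at he
    linear_combination he

/-- For `c ≡ 1 (mod 4)`, a root of `x ^ 2 ^ t + c` generates a totally ramified extension
of `ℚ_[2]`. -/
theorem exists_root_of_two_pow_and_residue_map (t : ℕ) (d : ℤ_[2]) :
    ∃ (L : Type) (_ : Field L) (_ : CharZero L) (_ : Algebra ℤ_[2] L) (ξ : L),
      ξ ^ 2 ^ t = -algebraMap ℤ_[2] L (1 + 4 * d) ∧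
        Nonempty (integralClosure ℤ_[2] L →+* ZMod 2) := by
  set f : ℤ_[2][X] := (X + 1) ^ 2 ^ t + C (1 + 4 * d) with hf
  have hmonic : f.Monic := X_add_one_pow_two_pow_add_C_monic t _
  have hE := X_add_one_pow_two_pow_add_C_isEisensteinAt t d
  have hirr : Irreducible f := hE.irreducible
    ((Ideal.span_singleton_prime PadicInt.prime_p.ne_zero).2 PadicInt.prime_p)
    hmonic.isPrimitive (by rw [X_add_one_pow_two_pow_add_C_natDegree]; positivity)
  have hirr' : Irreducible (f.map (algebraMap ℤ_[2] ℚ_[2])) :=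
    (hmonic.irreducible_iff_irreducible_map_fraction_map).1 hirr
  have : Fact (Irreducible (f.map (algebraMap ℤ_[2] ℚ_[2]))) := ⟨hirr'⟩
  let L := AdjoinRoot (f.map (algebraMap ℤ_[2] ℚ_[2]))
  let x : L := AdjoinRoot.root _
  have hx : aeval x f = 0 := by
    rw [← aeval_map_algebraMap ℚ_[2]]
    exact (AdjoinRoot.aeval_eq _).trans AdjoinRoot.mk_self
  have hint : IsIntegral ℤ_[2] x := ⟨f, hmonic, hx⟩
  have := isTorsionFree_of_padic_algebra (p := 2) (L := L)
  have hmin : minpoly ℤ_[2] x = f :=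
    eq_of_monic_of_associated (minpoly.monic hint) hmonic
      ((minpoly.prime_of_isIntegrallyClosed hint).irreducible.associated_of_dvd hirr
        (minpoly.isIntegrallyClosed_dvd hint hx))
  refine ⟨L, inferInstance, algebraRat.charZero L, inferInstance, x + 1, ?_, ?_⟩
  · have h := hx
    simp only [hf, map_add, map_pow, aeval_X, map_one, aeval_C] at h
    simpa using eq_neg_of_add_eq_zero_left h
  · refine nonempty_integralClosure_ringHom_zmod_of_isEisensteinAt
      (AdjoinRoot.powerBasis hirr'.ne_zero) ?_ ?_
    · simpa using hint
    · rw [AdjoinRoot.powerBasis_gen]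
      change (minpoly ℤ_[2] x).IsEisensteinAt _
      rw [hmin]
      exact hE

theorem PadicInt.exists_add_two_mul_sq_eq (c t : ℤ_[2]) : ∃ y : ℤ_[2], y + 2 * c * y ^ 2 = t := by
  have h2 : ‖(2 : ℤ_[2])‖ < 1 := by
    have h : ‖((2 : ℕ) : ℤ_[2])‖ < 1 := by rw [PadicInt.norm_p]; norm_num
    exact_mod_cast h
  have hlt : ∀ z : ℤ_[2], ‖2 * z‖ < 1 := fun z => by
    rw [norm_mul]
    exact mul_lt_one_of_nonneg_of_lt_one_left (norm_nonneg _) h2 (PadicInt.norm_le_one _)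
  let F : ℤ_[2][X] := X + C (2 * c) * X ^ 2 - C t
  have hder : ‖F.derivative.aeval t‖ = 1 := by
    have : F.derivative.aeval t = 1 + 2 * (2 * c * t) := by
      simp [F]; ring
    rw [this, ← PadicInt.isUnit_iff]
    by_contra hu
    have h1 : ‖(1 : ℤ_[2]) + 2 * (2 * c * t)‖ < 1 := by
      rw [← PadicInt.not_isUnit_iff]; exact hu
    have := PadicInt.norm_add_eq_max_of_ne (p := 2) (q := (1 : ℤ_[2])) (r := 2 * (2 * c * t))
      (by rw [norm_one]; exact (hlt _).ne')
    rw [this, norm_one] at h1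
    exact absurd (le_max_left _ _) h1.not_ge
  obtain ⟨y, hy, -⟩ := hensels_lemma (F := F) (a := t) (by
    rw [hder, one_pow]
    have : F.aeval t = 2 * (c * t ^ 2) := by simp [F]; ring
    rw [this]; exact hlt _)
  refine ⟨y, ?_⟩
  simp [F] at hy
  linear_combination hy

/-- A `2`-adic integer congruent to `1` modulo `32` is an eighth power. -/
theorem PadicInt.exists_pow_eight_eq (t : ℤ_[2]) : ∃ d : ℤ_[2], (1 + 4 * d) ^ 8 = 1 + 32 * t := by
  obtain ⟨u, hu⟩ := PadicInt.exists_add_two_mul_sq_eq 4 t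
  obtain ⟨v, hv⟩ := PadicInt.exists_add_two_mul_sq_eq 2 u
  obtain ⟨w, hw⟩ := PadicInt.exists_add_two_mul_sq_eq 1 v
  refine ⟨w, ?_⟩
  have h1 : (1 + 4 * w) ^ 2 = 1 + 8 * v := by linear_combination 8 * hw
  have h2 : (1 + 8 * v) ^ 2 = 1 + 16 * u := by linear_combination 16 * hv
  have h3 : (1 + 16 * u) ^ 2 = 1 + 32 * t := by linear_combination 32 * hu
  rw [← h3, ← h2, ← h1]; ring

/-- If `m = c ^ 2 ^ (r - t)` with `c ≡ 1 (mod 4)` in `ℤ_[2]` and `t < r`, then `𝓞 K` maps to a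
domain over `ℤ_[2]` in which `α ^ 2 ^ t` becomes `-c` and which has a residue map to `ZMod 2`. -/
theorem exists_ringHom_to_padic_domain {r : ℕ} {m : ℤ}
    (hF : Irreducible ((X : ℚ[X]) ^ 2 ^ r - C (m : ℚ)))
    {K : Type*} [Field K] [NumberField K] {α : 𝓞 K}
    (hgen : IntermediateField.adjoin ℚ {(α : K)} = ⊤)
    (hroot : (α : K) ^ 2 ^ r = (m : K)) (t k : ℕ) (htk : r = t + (k + 1)) (d : ℤ_[2])
    (hd : (1 + 4 * d) ^ 2 ^ (k + 1) = (m : ℤ_[2])) :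
    ∃ (A : Type) (_ : CommRing A) (_ : IsDomain A) (_ : CharZero A) (_ : Algebra ℤ_[2] A)
      (φ : 𝓞 K →+* A) (_ : A →+* ZMod 2),
      φ α ^ 2 ^ t = -algebraMap ℤ_[2] A (1 + 4 * d) := by
  obtain ⟨L, _, _, _, ξ, hξ, ⟨ψ⟩⟩ := exists_root_of_two_pow_and_residue_map t d
  have hαint : IsIntegral ℚ (α : K) := Algebra.IsIntegral.isIntegral _
  have hmin : minpoly ℚ (α : K) = X ^ 2 ^ r - C (m : ℚ) :=
    (minpoly.eq_of_irreducible_of_monic hF (by simp [hroot])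
      (monic_X_pow_sub_C _ (by positivity))).symm
  have hξr : ξ ^ 2 ^ r = (m : L) := by
    rw [htk, pow_add, pow_mul, hξ, Even.neg_pow (by simp [pow_succ]), ← map_pow, hd, map_intCast]
  let B : PowerBasis ℚ K := PowerBasis.ofAdjoinEqTop hαint (by
    rw [← IntermediateField.adjoin_simple_toSubalgebra_of_isAlgebraic hαint.isAlgebraic, hgen,
      IntermediateField.top_toSubalgebra])
  have hBgen : B.gen = (α : K) := PowerBasis.ofAdjoinEqTop_gen _ _
  let φK : K →ₐ[ℚ] L := B.lift ξ (by rw [hBgen, hmin]; simp [hξr])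
  have hφα : φK α = ξ := by rw [← hBgen]; exact B.lift_gen _ _
  have hmem : ∀ y : 𝓞 K, φK y ∈ integralClosure ℤ_[2] L := fun y =>
    ((RingOfIntegers.isIntegral_coe y).map (φK.restrictScalars ℤ)).tower_top
  let φ : 𝓞 K →+* integralClosure ℤ_[2] L :=
    ((φK : K →+* L).comp (algebraMap (𝓞 K) K)).codRestrict _ hmem
  refine ⟨integralClosure ℤ_[2] L, inferInstance, inferInstance, inferInstance, inferInstance,
    φ, ψ, ?_⟩
  apply Subtype.ext
  change φK α ^ 2 ^ t = -algebraMap ℤ_[2] L (1 + 4 * d)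
  rw [hφα, hξ]

/-- If `θ ^ 4 = 1 + 32 * n`, then `(θ ^ 2 + 1) / 2` is integral. -/
theorem exists_two_mul_eq_sq_add_one {K : Type*} [Field K] [NumberField K] {θ : 𝓞 K} {n : ℤ}
    (h : θ ^ 4 = 1 + 32 * (n : 𝓞 K)) : ∃ γ : 𝓞 K, 2 * γ = θ ^ 2 + 1 := by
  have hK : (θ : K) ^ 4 = 1 + 32 * (n : K) := by
    simpa only [map_pow, map_add, map_one, map_mul, map_ofNat, map_intCast] using
      congrArg (algebraMap (𝓞 K) K) h
  have hint : IsIntegral ℤ (((θ : K) ^ 2 + 1) / 2) := by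
    refine ⟨X ^ 2 - X - C (8 * n), by monicity!, ?_⟩
    simp only [eval₂_sub, eval₂_X_pow, eval₂_X, eval₂_C]
    simp only [eq_intCast, Int.cast_mul, Int.cast_ofNat]
    linear_combination hK / 4
  obtain ⟨y, hy⟩ : ∃ y : 𝓞 K, (y : K) = ((θ : K) ^ 2 + 1) / 2 := ⟨⟨_, hint⟩, rfl⟩
  refine ⟨y, RingOfIntegers.ext ?_⟩
  simp only [map_mul, map_ofNat, hy, map_add, map_pow, map_one]
  ring

/-- If `θ ^ 4 = 1 + 32 * n`, then `(θ + 1) * (θ ^ 2 + 1) / 4` is integral. -/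
theorem exists_four_mul_eq_add_one_mul_sq_add_one {K : Type*} [Field K] [NumberField K]
    {θ : 𝓞 K} {n : ℤ} (h : θ ^ 4 = 1 + 32 * (n : 𝓞 K)) :
    ∃ δ : 𝓞 K, 4 * δ = (θ + 1) * (θ ^ 2 + 1) := by
  have hK : (θ : K) ^ 4 = 1 + 32 * (n : K) := by
    simpa only [map_pow, map_add, map_one, map_mul, map_ofNat, map_intCast] using
      congrArg (algebraMap (𝓞 K) K) h
  have hn : (n : K) = ((θ : K) ^ 4 - 1) / 32 := by linear_combination -hK / 32
  have hint : IsIntegral ℤ (((θ : K) + 1) * ((θ : K) ^ 2 + 1) / 4) := by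
    refine ⟨X ^ 4 - X ^ 3 - C (12 * n) * X ^ 2 - C (64 * n ^ 2) * X - C (128 * n ^ 3),
      by monicity!, ?_⟩
    simp only [eval₂_sub, eval₂_mul, eval₂_X_pow, eval₂_X, eval₂_C]
    simp only [eq_intCast, Int.cast_mul, Int.cast_ofNat, Int.cast_pow, hn]
    ring
  obtain ⟨y, hy⟩ : ∃ y : 𝓞 K, (y : K) = ((θ : K) + 1) * ((θ : K) ^ 2 + 1) / 4 :=
    ⟨⟨_, hint⟩, rfl⟩
  refine ⟨y, RingOfIntegers.ext ?_⟩
  simp only [map_mul, map_ofNat, hy, map_add, map_pow, map_one]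
  ring

/-- The kernel of a map to `ZMod 2` is a prime above `2` of residue degree `1`. -/
theorem ker_ringHom_zmod_two {K : Type*} [Field K] [NumberField K] (χ : 𝓞 K →+* ZMod 2) :
    (RingHom.ker χ).IsPrime ∧ RingHom.ker χ ≠ ⊥ ∧ (2 : 𝓞 K) ∈ RingHom.ker χ ∧
      Nat.card (𝓞 K ⧸ RingHom.ker χ) = 2 := by
  have h2 : (2 : 𝓞 K) ∈ RingHom.ker χ := by
    rw [RingHom.mem_ker, map_ofNat]; rfl
  refine ⟨RingHom.ker_isPrime χ, fun h => ?_, h2, ?_⟩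
  · rw [h, Ideal.mem_bot] at h2
    exact two_ne_zero h2
  · rw [Nat.card_congr
      (RingHom.quotientKerEquivOfSurjective (ZMod.ringHom_surjective χ)).toEquiv, Nat.card_zmod]

theorem exists_three_primes_above_two_two_power
    (r : ℕ) (hr : 3 ≤ r) (m : ℤ) (hm : Squarefree m) (hm1 : m ≠ 1)
    (hmod : m ≡ 1 [ZMOD 32])
    (hF : Irreducible ((X : ℚ[X]) ^ 2 ^ r - C (m : ℚ)))
    (K : Type*) [Field K] [NumberField K] (α : 𝓞 K)
    (hgen : IntermediateField.adjoin ℚ {(α : K)} = ⊤)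
    (hroot : (α : K) ^ 2 ^ r = (m : K)) :
    ∃ S : Finset (Ideal (𝓞 K)), 3 ≤ S.card ∧
      ∀ P ∈ S, P.IsPrime ∧ P ≠ ⊥ ∧ (2 : 𝓞 K) ∈ P ∧ Nat.card (𝓞 K ⧸ P) = 2 := by
  classical
  obtain ⟨s, rfl⟩ := Nat.exists_eq_add_of_le' hr
  obtain ⟨n, hn⟩ := hmod.symm.dvd
  obtain rfl : m = 1 + 32 * n := by linarith
  obtain ⟨d, hd⟩ := PadicInt.exists_pow_eight_eq n
  have hθ : (α ^ 2 ^ (s + 1)) ^ 4 = 1 + 32 * (n : 𝓞 K) := by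
    apply RingOfIntegers.ext
    simp only [map_add, map_mul, map_ofNat, map_pow, map_one, map_intCast]
    rw [← pow_mul, show 2 ^ (s + 1) * 4 = 2 ^ (s + 3) by ring, hroot]
    push_cast; ring
  obtain ⟨γ, hγ⟩ := exists_two_mul_eq_sq_add_one hθ
  obtain ⟨δ, hδ⟩ := exists_four_mul_eq_add_one_mul_sq_add_one hθ
  have two : (2 : ZMod 2) = 0 := rfl
  obtain ⟨χ₁, hγ₁, hδ₁⟩ : ∃ χ : 𝓞 K →+* ZMod 2, χ γ = 1 ∧ χ δ = 1 := by
    obtain ⟨A, _, _, _, _, φ, ψ, h⟩ := exists_ringHom_to_padic_domain hF hgen hroot s 2 rfl d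
      (by push_cast; linear_combination hd)
    simp only [map_add, map_mul, map_one, map_ofNat] at h
    set D := algebraMap ℤ_[2] A d
    have hθφ : φ (α ^ 2 ^ (s + 1)) = (1 + 4 * D) ^ 2 := by
      rw [pow_succ, pow_mul, map_pow, map_pow, h]; ring
    have hφγ : φ γ = 1 + 2 * (4 * (D + 2 * D ^ 2 + 4 * (D + 2 * D ^ 2) ^ 2)) := by
      apply mul_left_cancel₀ (two_ne_zero (α := A))
      have := congrArg φ hγ
      rw [map_mul, map_ofNat, map_add, map_pow, hθφ, map_one] at this
      rw [this]; ring
    have hφδ : φ δ = (1 + 2 * (2 * (D + 2 * D ^ 2))) * φ γ := by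
      apply mul_left_cancel₀ (show (4 : A) ≠ 0 by norm_num)
      have := congrArg φ hδ
      rw [map_mul, map_ofNat, map_mul, map_add, map_add, map_pow φ (α ^ 2 ^ (s + 1)), hθφ,
        map_one] at this
      rw [this, hφγ]; ring
    have hψγ : ψ (φ γ) = 1 := by
      rw [hφγ, map_add, map_mul, map_ofNat, two, zero_mul, add_zero, map_one]
    refine ⟨ψ.comp φ, hψγ, ?_⟩
    rw [RingHom.comp_apply, hφδ, map_mul, hψγ, map_add, map_mul, map_ofNat, two, zero_mul,
      add_zero, map_one, one_mul]
  obtain ⟨χ₂, hγ₂, hδ₂⟩ : ∃ χ : 𝓞 K →+* ZMod 2, χ γ = 1 ∧ χ δ = 0 := by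
    obtain ⟨A, _, _, _, _, φ, ψ, h⟩ := exists_ringHom_to_padic_domain hF hgen hroot (s + 1) 1 rfl
      (2 * (d + 2 * d ^ 2)) (by push_cast; linear_combination hd)
    simp only [map_add, map_mul, map_one, map_ofNat, map_pow] at h
    set D := algebraMap ℤ_[2] A d
    have hθφ : φ (α ^ 2 ^ (s + 1)) = -(1 + 4 * D) ^ 2 := by
      rw [map_pow, h]; ring
    have hφγ : φ γ = 1 + 2 * (4 * (D + 2 * D ^ 2 + 4 * (D + 2 * D ^ 2) ^ 2)) := by
      apply mul_left_cancel₀ (two_ne_zero (α := A))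
      have := congrArg φ hγ
      rw [map_mul, map_ofNat, map_add, map_pow, hθφ, map_one] at this
      rw [this]; ring
    have hφδ : φ δ = 2 * (-2 * (D + 2 * D ^ 2) * φ γ) := by
      apply mul_left_cancel₀ (show (4 : A) ≠ 0 by norm_num)
      have := congrArg φ hδ
      rw [map_mul, map_ofNat, map_mul, map_add, map_add, map_pow φ (α ^ 2 ^ (s + 1)), hθφ,
        map_one] at this
      rw [this, hφγ]; ring
    refine ⟨ψ.comp φ, ?_, ?_⟩
    · rw [RingHom.comp_apply, hφγ, map_add, map_mul, map_ofNat, two, zero_mul, add_zero, map_one]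
    · rw [RingHom.comp_apply, hφδ, map_mul, map_ofNat, two, zero_mul]
  obtain ⟨χ₃, hγ₃⟩ : ∃ χ : 𝓞 K →+* ZMod 2, χ γ = 0 := by
    obtain ⟨A, _, _, _, _, φ, ψ, h⟩ := exists_ringHom_to_padic_domain hF hgen hroot (s + 2) 0 rfl
      (4 * (d + 2 * d ^ 2 + 4 * (d + 2 * d ^ 2) ^ 2)) (by push_cast; linear_combination hd)
    simp only [map_add, map_mul, map_one, map_ofNat, map_pow] at h
    set D := algebraMap ℤ_[2] A d
    have hθφ : φ (α ^ 2 ^ (s + 1)) ^ 2 = -(1 + 4 * D) ^ 4 := by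
      rw [map_pow, ← pow_mul, ← pow_succ, h]; ring
    have hφγ : φ γ = 2 * (-4 * (D + 2 * D ^ 2 + 4 * (D + 2 * D ^ 2) ^ 2)) := by
      apply mul_left_cancel₀ (two_ne_zero (α := A))
      have := congrArg φ hγ
      rw [map_mul, map_ofNat, map_add, map_pow, hθφ, map_one] at this
      rw [this]; ring
    exact ⟨ψ.comp φ, by rw [RingHom.comp_apply, hφγ, map_mul, map_ofNat, two, zero_mul]⟩
  have hne : ∀ {χ χ' : 𝓞 K →+* ZMod 2} (y : 𝓞 K), χ y = 1 → χ' y = 0 →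
      RingHom.ker χ ≠ RingHom.ker χ' := by
    intro χ χ' y h h' heq
    have : y ∈ RingHom.ker χ := heq ▸ h'
    exact one_ne_zero (h.symm.trans this)
  refine ⟨{RingHom.ker χ₁, RingHom.ker χ₂, RingHom.ker χ₃}, ?_, ?_⟩
  · rw [Finset.card_eq_three.2 ⟨_, _, _, hne δ hδ₁ hδ₂, hne γ hγ₁ hγ₃, hne γ hγ₂ hγ₃, rfl⟩]
  · simp only [Finset.mem_insert, Finset.mem_singleton]
    rintro P (rfl | rfl | rfl) <;> exact ker_ringHom_zmod_two _
end
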